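/- arXiv:2108.04421 — 3 statements merged into one kernel-verified Lean document; each statement's English description precedes it below -/
import Mathlib

section
/- For every integer N ≥ 1, the Coulomb gas integrals {F_β : β ∈ LP_N} are linearly independent over ℂ as functions on 𝔛_{2N}: if complex coefficients (λ_β)_{β ∈ LP_N} satisfy Σ_{β ∈ LP_N} λ_β F_β(x) = 0 for all x ∈ 𝔛_{2N}, then λ_β = 0 for every β ∈ LP_N. -/
open MeasureTheory

/-- A planar link pattern of size `N`: a noncrossing perfect matching of `{1,…,2N}`,
with the links `{a r, b r}` satisfying `a r < b r` and `a` strictly increasing. -/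
structure LinkPattern (N : ℕ) where
  a : Fin N → ℕ
  b : Fin N → ℕ
  a_lt_b : ∀ r, a r < b r
  a_mono : StrictMono a
  inj : Function.Injective (fun p : Fin N × Bool => if p.2 then b p.1 else a p.1)
  cover : ∀ k : ℕ, (∃ p : Fin N × Bool, (if p.2 then b p.1 else a p.1) = k) ↔ (1 ≤ k ∧ k ≤ 2 * N)
  noncross : ∀ r s : Fin N, ¬ (a r < a s ∧ a s < b r ∧ b r < b s)

/-- The (unordered) link relation of a link pattern. -/
def LinkPattern.Linked {N : ℕ} (β : LinkPattern N) (p q : ℕ) : Prop :=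
  ∃ r, (β.a r = p ∧ β.b r = q) ∨ (β.a r = q ∧ β.b r = p)

/-- The positive real integral `ρ_{k_1,…,k_N}(x)`. -/
noncomputable def rho (N : ℕ) (k : Fin N → ℕ) (x : ℕ → ℝ) : ℝ :=
  (∏ p ∈ (Finset.Icc 1 (2 * N) ×ˢ Finset.Icc 1 (2 * N)).filter fun p => p.1 < p.2,
      (x p.2 - x p.1) ^ ((4 : ℝ)⁻¹)) *
  ∫ u : Fin N → ℝ in Set.univ.pi fun r => Set.Ioo (x (k r)) (x (k r + 1)),
    (∏ p ∈ (Finset.univ ×ˢ Finset.univ : Finset (Fin N × Fin N)).filter fun p => p.1 < p.2,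
        (u p.2 - u p.1)) *
      ∏ r, ∏ i ∈ Finset.Icc 1 (2 * N), |u r - x i| ^ (-(2 : ℝ)⁻¹)

/-- The coefficient `c_β(k_1,…,k_N)`. -/
noncomputable def linkCoeff (N : ℕ) (β : LinkPattern N) (k : Fin N → ℕ) : ℂ :=
  Complex.I ^ ((∑ r, (k r : ℤ)) - ∑ r, (β.a r : ℤ)) *
    ∑ σ : Equiv.Perm (Fin N),
      ((Equiv.Perm.sign σ : ℤ) : ℂ) *
        ∏ r, if β.a r ≤ k (σ r) ∧ k (σ r) < β.b r then (1 : ℂ) else 0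

/-- The Coulomb gas integral `F_β(x)`. -/
noncomputable def coulomb (N : ℕ) (β : LinkPattern N) (x : ℕ → ℝ) : ℂ :=
  ∑ k ∈ (Fintype.piFinset fun _ : Fin N => Finset.Icc 1 (2 * N - 1)).filter
      fun k => ∀ r s : Fin N, r < s → k r < k s,
    linkCoeff N β k * (rho N k x : ℂ)

/-- Membership in the open chamber `𝔛_{2N}` (only coordinates `1,…,2N` are relevant). -/
def IsChamber (N : ℕ) (x : ℕ → ℝ) : Prop :=
  ∀ i k : ℕ, 1 ≤ i → i < k → k ≤ 2 * N → x i < x k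

open Function in
theorem MultilinearMap.congr_of_update {R ι M P : Type*} [Fintype ι] [DecidableEq ι]
    [CommSemiring R] [AddCommMonoid M] [AddCommMonoid P] [Module R M] [Module R P]
    (f : MultilinearMap R (fun _ : ι => M) P) (v w : ι → M)
    (h : ∀ i u, f (update u i (v i)) = f (update u i (w i))) : f v = f w := by
  have key : ∀ s : Finset ι, f (s.piecewise v w) = f w := by
    intro s
    induction s using Finset.induction_on with
    | empty => simp
    | insert a s ha ih =>
      rw [Finset.piecewise_insert, h, ← ih]
      congr 1
      rw [Function.update_eq_self_iff]
      simp [ha]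
  simpa using key Finset.univ

/-- The basis vector attached to the interval between the points `k` and `k + 1`. -/
noncomputable abbrev siteVec (k : ℕ) : ℕ →₀ ℂ := Finsupp.single k 1

/-- Alternating forms in the intervals `1,…,2N-1` whose contraction with the intersection
bivector `∑ e_j ∧ e_{j+1}` vanishes. -/
structure IsPrimitiveForm (N : ℕ) (G : (ℕ →₀ ℂ) [⋀^Fin N]→ₗ[ℂ] ℂ) : Prop where
  support : ∀ (u : Fin N → ℕ →₀ ℂ) (i : Fin N) (k : ℕ), k ∉ Finset.Icc 1 (2 * N - 1) →
    G (Function.update u i (siteVec k)) = 0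
  contract : ∀ (u : Fin N → ℕ →₀ ℂ) (p q : Fin N), p ≠ q →
    ∑ j ∈ Finset.range (2 * N),
      G (Function.update (Function.update u p (siteVec j)) q (siteVec (j + 1))) = 0

/-- The value of a form on a tuple of basis vectors. -/
noncomputable def formCoeff {N : ℕ} (G : (ℕ →₀ ℂ) [⋀^Fin N]→ₗ[ℂ] ℂ) (t : Fin N → ℕ) : ℂ :=
  G fun i => siteVec (t i)

theorem siteVec_update {N : ℕ} (t : Fin N → ℕ) (i : Fin N) (k : ℕ) :
    (fun l => siteVec (Function.update t i k l)) =
      Function.update (fun l => siteVec (t l)) i (siteVec k) := by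
  funext l
  by_cases h : l = i
  · subst h; simp
  · simp [h]

theorem formCoeff_eq_zero_of_not_injective {N : ℕ} (G : (ℕ →₀ ℂ) [⋀^Fin N]→ₗ[ℂ] ℂ)
    (t : Fin N → ℕ) {i j : Fin N} (h : t i = t j) (hij : i ≠ j) : formCoeff G t = 0 :=
  G.map_eq_zero_of_eq _ (by simp [h]) hij

theorem IsPrimitiveForm.formCoeff_eq_zero {N : ℕ} {G : (ℕ →₀ ℂ) [⋀^Fin N]→ₗ[ℂ] ℂ}
    (hG : IsPrimitiveForm N G) (t : Fin N → ℕ) (i : Fin N)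
    (h : t i ∉ Finset.Icc 1 (2 * N - 1)) : formCoeff G t = 0 := by
  have := hG.support (fun l => siteVec (t l)) i (t i) h
  rw [← siteVec_update] at this
  simpa [formCoeff] using this

theorem form_eq_zero_of_formCoeff {N : ℕ} {G : (ℕ →₀ ℂ) [⋀^Fin N]→ₗ[ℂ] ℂ}
    (h : ∀ t, formCoeff G t = 0) : G = 0 := by
  refine Module.Basis.ext_alternating (Finsupp.basisSingleOne (R := ℂ) (ι := ℕ)) fun t _ => ?_
  simpa [formCoeff] using h t

/-- A form which does not see the difference between `e_{j-1}` and `e_{j+1}` as long as `e_j`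
does not occur. -/
def HopInvariant {N : ℕ} (G : (ℕ →₀ ℂ) [⋀^Fin N]→ₗ[ℂ] ℂ) : Prop :=
  ∀ j ∈ Finset.Icc 1 (2 * N - 1), ∀ (t : Fin N → ℕ) (i : Fin N), (∀ l, l ≠ i → t l ≠ j) →
    formCoeff G (Function.update t i (j - 1)) = formCoeff G (Function.update t i (j + 1))

theorem HopInvariant.formCoeff_initial {N : ℕ} (hN : 2 ≤ N) {G : (ℕ →₀ ℂ) [⋀^Fin N]→ₗ[ℂ] ℂ}
    (hG : IsPrimitiveForm N G) (hop : HopInvariant G) :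
    formCoeff G (fun i : Fin N => (i : ℕ) + 1) = 0 := by
  set t₀ : Fin N → ℕ := fun i => (i : ℕ) + 1 with ht₀
  set p : Fin N := ⟨N - 2, by omega⟩ with hp
  set q : Fin N := ⟨N - 1, by omega⟩ with hq
  have hpq : p ≠ q := by simp [hp, hq, Fin.ext_iff]; omega
  have hother : ∀ l : Fin N, l ≠ p → l ≠ q → t₀ l ≤ N - 2 := by
    intro l h1 h2
    simp only [hp, hq, ne_eq, Fin.ext_iff] at h1 h2
    simp only [ht₀]
    omega
  set Q : ℕ → ℂ := fun j => formCoeff G (Function.update (Function.update t₀ p j) q (j + 1))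
    with hQ
  have hsum : ∑ j ∈ Finset.range (2 * N), Q j = 0 := by
    rw [← hG.contract (fun l => siteVec (t₀ l)) p q hpq]
    refine Finset.sum_congr rfl fun j _ => ?_
    simp only [hQ, formCoeff, siteVec_update]
  have hlow : ∀ j, j < N - 1 → Q j = 0 := by
    intro j hj
    rcases Nat.eq_zero_or_pos j with rfl | hj0
    · refine hG.formCoeff_eq_zero _ p ?_
      simp [hpq]
    · refine formCoeff_eq_zero_of_not_injective G _ (i := p) (j := ⟨j - 1, by omega⟩) ?_ ?_
      · have h1 : (⟨j - 1, by omega⟩ : Fin N) ≠ p := by simp [hp, Fin.ext_iff]; omega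
        have h2 : (⟨j - 1, by omega⟩ : Fin N) ≠ q := by simp [hq, Fin.ext_iff]; omega
        rw [Function.update_of_ne hpq, Function.update_self, Function.update_of_ne h2,
          Function.update_of_ne h1]
        simp only [ht₀]
        omega
      · simp [hp, Fin.ext_iff]; omega
  have hstep : ∀ j, N - 1 ≤ j → j + 3 ≤ 2 * N → Q j = Q (j + 2) := by
    intro j h1 h2
    have e1 := hop (j + 2) (by simp; omega) (Function.update t₀ p j) q (by
      intro l hl
      by_cases hlp : l = p
      · subst hlp; simp
      · rw [Function.update_of_ne hlp]
        have := hother l hlp hl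
        omega)
    have e2 := hop (j + 1) (by simp; omega) (Function.update t₀ q (j + 3)) p (by
      intro l hl
      by_cases hlq : l = q
      · subst hlq; simp
      · rw [Function.update_of_ne hlq]
        have := hother l hl hlq
        omega)
    simp only [hQ]
    have e3 : j + 2 - 1 = j + 1 := by omega
    have e4 : j + 1 - 1 = j := by omega
    rw [e3] at e1
    rw [e4, Function.update_comm hpq.symm, Function.update_comm hpq.symm] at e2
    rw [e1]
    exact e2
  have hlast : Q (2 * N - 1) = 0 := by
    refine hG.formCoeff_eq_zero _ q ?_
    simp
  have hodd : ∀ m, 2 * m ≤ N → Q (2 * N - 1 - 2 * m) = 0 := by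
    intro m
    induction m with
    | zero => intro _; simpa using hlast
    | succ m ih =>
      intro hm
      rw [hstep _ (by omega) (by omega)]
      convert ih (by omega) using 2
      omega
  have heven : ∀ m, 2 * m + 1 ≤ N → Q (2 * N - 2 - 2 * m) = Q (2 * N - 2) := by
    intro m
    induction m with
    | zero => intro _; simp
    | succ m ih =>
      intro hm
      rw [hstep _ (by omega) (by omega), ← ih (by omega)]
      congr 1
      omega
  have hval : ∀ j ∈ Finset.range (2 * N),
      Q j = if N - 1 ≤ j ∧ Even j then Q (2 * N - 2) else 0 := by
    intro j hj
    rw [Finset.mem_range] at hj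
    by_cases h1 : N - 1 ≤ j
    · rcases Nat.even_or_odd j with h2 | h2
      · rw [if_pos ⟨h1, h2⟩, ← heven ((2 * N - 2 - j) / 2) (by omega)]
        obtain ⟨r, rfl⟩ := h2
        congr 1
        omega
      · rw [if_neg (by rw [← Nat.not_even_iff_odd] at h2; tauto),
          ← hodd ((2 * N - 1 - j) / 2) (by omega)]
        obtain ⟨r, rfl⟩ := h2
        congr 1
        omega
    · rw [if_neg (by tauto)]
      exact hlow j (by omega)
  have hQ0 : Q (2 * N - 2) = 0 := by
    rw [Finset.sum_congr rfl hval, ← Finset.sum_filter, Finset.sum_const, nsmul_eq_mul,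
      mul_eq_zero] at hsum
    refine hsum.resolve_left ?_
    rw [← ne_eq, Nat.cast_ne_zero, ← Nat.pos_iff_ne_zero, Finset.card_pos]
    exact ⟨2 * N - 2, by
      simp only [Finset.mem_filter, Finset.mem_range]
      exact ⟨by omega, by omega, ⟨N - 1, by omega⟩⟩⟩
  have hfin := hval (N - 1) (by rw [Finset.mem_range]; omega)
  rw [hQ0, ite_self] at hfin
  rw [← hfin]
  simp only [hQ]
  congr 1
  have e1 : Function.update t₀ p (N - 1) = t₀ := by
    rw [Function.update_eq_self_iff]
    simp only [ht₀, hp]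
    omega
  rw [e1, eq_comm, Function.update_eq_self_iff]

theorem HopInvariant.eq_zero {N : ℕ} (hN : 2 ≤ N) {G : (ℕ →₀ ℂ) [⋀^Fin N]→ₗ[ℂ] ℂ}
    (hG : IsPrimitiveForm N G) (hop : HopInvariant G) : G = 0 := by
  refine form_eq_zero_of_formCoeff fun t => ?_
  induction h : ∑ i, t i using Nat.strong_induction_on generalizing t with
  | _ n ih =>
  by_cases hinj : Function.Injective t
  swap
  · simp only [Function.Injective, not_forall] at hinj
    obtain ⟨i, j, h1, h2⟩ := hinj
    exact formCoeff_eq_zero_of_not_injective G t h1 h2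
  by_cases hran : ∀ i, t i ∈ Finset.Icc 1 (2 * N - 1)
  swap
  · push Not at hran
    obtain ⟨i, hi⟩ := hran
    exact hG.formCoeff_eq_zero t i hi
  by_cases hmove : ∃ i, 2 ≤ t i ∧ ∀ l, t l ≠ t i - 1
  · obtain ⟨i, hi, hl⟩ := hmove
    have hi' := hran i
    rw [Finset.mem_Icc] at hi'
    have e1 := hop (t i - 1) (by rw [Finset.mem_Icc]; omega) t i (fun l _ => hl l)
    have e2 : t i - 1 + 1 = t i := by omega
    rw [e2, Function.update_eq_self] at e1
    rw [← e1]
    refine ih _ ?_ _ rfl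
    rw [← h]
    refine Finset.sum_lt_sum (fun l _ => ?_) ⟨i, Finset.mem_univ _, by simp; omega⟩
    by_cases hli : l = i
    · subst hli; simp only [Function.update_self]; omega
    · simp [hli]
  · push Not at hmove
    have hdown : ∀ d i, d < t i → ∃ l, t l = t i - d := by
      intro d
      induction d with
      | zero => exact fun i _ => ⟨i, by simp⟩
      | succ d ihd =>
        intro i hi
        obtain ⟨l, hl⟩ := ihd i (by omega)
        obtain ⟨l', hl'⟩ := hmove l (by omega)
        exact ⟨l', by omega⟩
    have hle : ∀ i, t i ≤ N := by
      intro i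
      have hsub : Finset.Icc 1 (t i) ⊆ Finset.univ.image t := by
        intro m hm
        rw [Finset.mem_Icc] at hm
        obtain ⟨l, hl⟩ := hdown (t i - m) i (by omega)
        rw [Finset.mem_image]
        exact ⟨l, Finset.mem_univ _, by omega⟩
      have := Finset.card_le_card hsub
      rw [Finset.card_image_of_injective _ hinj] at this
      simpa using this
    have h1 : ∀ i, 1 ≤ t i := fun i => (Finset.mem_Icc.1 (hran i)).1
    let s : Fin N → Fin N := fun i => ⟨t i - 1, by have := hle i; have := h1 i; omega⟩
    have hs : Function.Injective s := by
      intro i j hij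
      simp only [s, Fin.mk.injEq] at hij
      refine hinj ?_
      have := h1 i
      have := h1 j
      omega
    let σ : Equiv.Perm (Fin N) := Equiv.ofBijective s (Finite.injective_iff_bijective.1 hs)
    have ht : (fun i => siteVec (t i)) = (fun i : Fin N => siteVec ((i : ℕ) + 1)) ∘ σ := by
      funext i
      have : t i - 1 + 1 = t i := by have := h1 i; omega
      simp [σ, s, this]
    rw [formCoeff, ht, G.map_perm]
    have h0 := hop.formCoeff_initial hN hG
    rw [formCoeff] at h0
    rw [h0, smul_zero]

/-- The inclusion of the sites of the configuration with two points fewer, where the new points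
are inserted at positions `j` and `j + 1`. -/
noncomputable def pinchEmb (j : ℕ) : (ℕ →₀ ℂ) →ₗ[ℂ] (ℕ →₀ ℂ) :=
  Finsupp.lmapDomain ℂ ℂ fun k => if k < j then k else k + 2

theorem pinchEmb_siteVec_of_lt {j k : ℕ} (h : k < j) : pinchEmb j (siteVec k) = siteVec k := by
  simp [pinchEmb, h]

theorem pinchEmb_siteVec_of_le {j k : ℕ} (h : j ≤ k) :
    pinchEmb j (siteVec k) = siteVec (k + 2) := by
  simp [pinchEmb, not_lt.2 h]

/-- The form induced on the configuration with two points fewer when the points at positions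
`j` and `j + 1` collide. -/
noncomputable def pinchForm {N : ℕ} (j : ℕ) (G : (ℕ →₀ ℂ) [⋀^Fin (N + 1)]→ₗ[ℂ] ℂ) :
    (ℕ →₀ ℂ) [⋀^Fin N]→ₗ[ℂ] ℂ :=
  (G.curryLeft (siteVec (j - 1) - siteVec (j + 1))).compLinearMap (pinchEmb j)

theorem curryLeft_update_eq {N : ℕ} (j : ℕ) (G : (ℕ →₀ ℂ) [⋀^Fin (N + 1)]→ₗ[ℂ] ℂ)
    (w : Fin N → ℕ →₀ ℂ) (p : Fin N) :
    G.curryLeft (siteVec (j - 1) - siteVec (j + 1)) (Function.update w p (siteVec (j - 1))) =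
    G.curryLeft (siteVec (j - 1) - siteVec (j + 1)) (Function.update w p (siteVec (j + 1))) := by
  rw [← sub_eq_zero, ← AlternatingMap.map_update_sub, AlternatingMap.curryLeft_apply_apply]
  exact G.map_eq_zero_of_eq _ (i := 0) (j := p.succ) (by simp) (Fin.succ_ne_zero p).symm

theorem IsPrimitiveForm.curryLeft_support {N : ℕ} {G : (ℕ →₀ ℂ) [⋀^Fin (N + 1)]→ₗ[ℂ] ℂ}
    (hG : IsPrimitiveForm (N + 1) G) (z : ℕ →₀ ℂ) (w : Fin N → ℕ →₀ ℂ) (p : Fin N) (k : ℕ)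
    (hk : k ∉ Finset.Icc 1 (2 * N + 1)) :
    G.curryLeft z (Function.update w p (siteVec k)) = 0 := by
  rw [AlternatingMap.curryLeft_apply_apply, Matrix.vecCons, Fin.cons_update]
  exact hG.support _ _ k (by rwa [show 2 * (N + 1) - 1 = 2 * N + 1 by omega])

theorem IsPrimitiveForm.pinchForm {N : ℕ} {G : (ℕ →₀ ℂ) [⋀^Fin (N + 1)]→ₗ[ℂ] ℂ}
    (hG : IsPrimitiveForm (N + 1) G) {j : ℕ} (hj : j ∈ Finset.Icc 1 (2 * N + 1)) :
    IsPrimitiveForm N (pinchForm j G) := by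
  rw [Finset.mem_Icc] at hj
  have hupd : ∀ (w : Fin N → ℕ →₀ ℂ) (p : Fin N) (z : ℕ →₀ ℂ),
      (⇑(pinchEmb j) ∘ Function.update w p z) =
        Function.update (⇑(pinchEmb j) ∘ w) p (pinchEmb j z) :=
    fun w p z => Function.comp_update _ _ _ _
  constructor
  · intro u i k hk
    rw [Finset.mem_Icc] at hk
    change G.curryLeft _ (⇑(pinchEmb j) ∘ _) = 0
    rw [hupd]
    rcases lt_or_ge k j with h | h
    · rw [pinchEmb_siteVec_of_lt h]
      rcases Nat.eq_zero_or_pos k with rfl | h0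
      · exact hG.curryLeft_support _ _ _ _ (by simp)
      · have hk' : k = j - 1 := by omega
        rw [hk', curryLeft_update_eq]
        exact hG.curryLeft_support _ _ _ _ (by rw [Finset.mem_Icc]; omega)
    · rw [pinchEmb_siteVec_of_le h]
      exact hG.curryLeft_support _ _ _ _ (by rw [Finset.mem_Icc]; omega)
  · intro u p q hpq
    set H := G.curryLeft (siteVec (j - 1) - siteVec (j + 1)) with hH
    set w : Fin N → ℕ →₀ ℂ := ⇑(pinchEmb j) ∘ u with hw
    set B : ℕ → ℕ → ℂ := fun a b =>
      H (Function.update (Function.update w p (siteVec a)) q (siteVec b)) with hB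
    have hBl : ∀ b, B (j - 1) b = B (j + 1) b := by
      intro b
      simp only [hB]
      rw [Function.update_comm hpq, Function.update_comm hpq]
      exact curryLeft_update_eq j G _ p
    have hanti : ∀ a b, B a b + B b a = 0 := by
      intro a b
      have h1 := H.map_swap (Function.update (Function.update w p (siteVec a)) q (siteVec b)) hpq
      have h2 : (Function.update (Function.update w p (siteVec a)) q (siteVec b)) ∘
          (Equiv.swap p q) = Function.update (Function.update w p (siteVec b)) q (siteVec a) := by
        funext l
        by_cases hlp : l = p
        · subst hlp; simp [hpq]
        · by_cases hlq : l = q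
          · subst hlq; simp [hpq]
          · simp [Equiv.swap_apply_of_ne_of_ne hlp hlq, hlp, hlq]
      rw [h2] at h1
      simp only [hB, h1]
      ring
    have htot : ∑ k ∈ Finset.range (2 * N + 2), B k (k + 1) = 0 := by
      have := hG.contract (Matrix.vecCons (siteVec (j - 1) - siteVec (j + 1)) w) p.succ q.succ
        (by simpa using hpq)
      rw [← this]
      refine Finset.sum_congr (by ring_nf) fun k _ => ?_
      simp only [hB, hH]
      rw [AlternatingMap.curryLeft_apply_apply, Matrix.vecCons, Fin.cons_update, Fin.cons_update]
      rfl
    have hterm : ∀ m ∈ Finset.range (2 * N),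
        G.curryLeft (siteVec (j - 1) - siteVec (j + 1)) (⇑(pinchEmb j) ∘
          Function.update (Function.update u p (siteVec m)) q (siteVec (m + 1))) =
        if m < j - 1 then B m (m + 1) else B (m + 2) (m + 3) := by
      intro m _
      rw [hupd, hupd, ← hH, ← hw]
      by_cases h1 : m < j - 1
      · rw [if_pos h1, pinchEmb_siteVec_of_lt (by omega), pinchEmb_siteVec_of_lt (by omega)]
      · rw [if_neg h1, pinchEmb_siteVec_of_le (by omega : j ≤ m + 1)]
        by_cases h2 : m = j - 1
        · rw [pinchEmb_siteVec_of_lt (by omega)]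
          have h3 : m + 2 = j + 1 := by omega
          rw [h3, ← hBl, ← h2]
        · rw [pinchEmb_siteVec_of_le (by omega)]
    refine (Finset.sum_congr rfl hterm).trans ?_
    obtain ⟨a, rfl⟩ : ∃ a, j = a + 1 := ⟨j - 1, by omega⟩
    obtain ⟨r, hr⟩ : ∃ r, 2 * N = a + r := ⟨2 * N - a, by omega⟩
    have hmid : B a (a + 1) + B (a + 1) (a + 2) = 0 := by
      have h1 := hBl (a + 1)
      simp only [Nat.add_sub_cancel] at h1
      rw [h1]
      exact hanti _ _
    rw [hr, show a + r + 2 = a + 2 + r by ring, Finset.sum_range_add, Finset.sum_range_succ,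
      Finset.sum_range_succ, add_assoc _ (B a _), hmid, add_zero] at htot
    rw [hr, Finset.sum_range_add, ← htot]
    congr 1
    · refine Finset.sum_congr rfl fun m hm => ?_
      rw [Finset.mem_range] at hm
      rw [if_pos (by omega)]
    · refine Finset.sum_congr rfl fun m hm => ?_
      rw [if_neg (by omega)]
      congr 1 <;> ring

theorem hopInvariant_of_pinchForm_eq_zero {N : ℕ} {G : (ℕ →₀ ℂ) [⋀^Fin (N + 1)]→ₗ[ℂ] ℂ}
    (h : ∀ j ∈ Finset.Icc 1 (2 * N + 1), pinchForm j G = 0) : HopInvariant G := by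
  intro j hj t i hi
  have hj' : j ∈ Finset.Icc 1 (2 * N + 1) := by
    rwa [show 2 * (N + 1) - 1 = 2 * N + 1 by omega] at hj
  rw [Finset.mem_Icc] at hj
  set f := siteVec (j - 1) - siteVec (j + 1) with hf
  have hcons : ∀ t' : Fin N → ℕ, (∀ l, t' l ≠ j) →
      G.curryLeft f (fun l => siteVec (t' l)) = 0 := by
    intro t' ht'
    set τ : ℕ → ℕ := fun k => if k < j then k else if k = j + 1 then j - 1 else k - 2 with hτ
    have h1 : G.curryLeft f (fun l => siteVec (t' l)) =
        G.curryLeft f (fun l => pinchEmb j (siteVec (τ (t' l)))) := by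
      refine MultilinearMap.congr_of_update (G.curryLeft f).toMultilinearMap _ _ fun l u => ?_
      have := ht' l
      simp only [AlternatingMap.coe_multilinearMap, hτ]
      by_cases c1 : t' l < j
      · rw [if_pos c1, pinchEmb_siteVec_of_lt c1]
      · rw [if_neg c1]
        by_cases c2 : t' l = j + 1
        · rw [if_pos c2, pinchEmb_siteVec_of_lt (by omega), c2]
          exact (curryLeft_update_eq j G u l).symm
        · rw [if_neg c2, pinchEmb_siteVec_of_le (by omega),
            show t' l - 2 + 2 = t' l by omega]
    rw [h1]
    exact congrArg (fun F : (ℕ →₀ ℂ) [⋀^Fin N]→ₗ[ℂ] ℂ => F fun l => siteVec (τ (t' l))) (h j hj')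
  rw [← sub_eq_zero, formCoeff, formCoeff, siteVec_update, siteVec_update,
    ← AlternatingMap.map_update_sub, ← hf]
  set v := Function.update (fun l => siteVec (t l)) i f with hv
  have h2 := G.map_perm v (Equiv.swap 0 i)
  have h3 : v ∘ Equiv.swap 0 i = Matrix.vecCons f
      (fun l => siteVec (t (Equiv.swap 0 i l.succ))) := by
    funext l
    refine Fin.cases ?_ (fun l => ?_) l
    · simp [hv]
    · have : Equiv.swap 0 i l.succ ≠ i := by
        intro hh
        have := (Equiv.swap 0 i).injective (hh.trans (Equiv.swap_apply_left 0 i).symm)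
        exact Fin.succ_ne_zero l this
      simp [hv, this]
  rw [h3, ← AlternatingMap.curryLeft_apply_apply, hcons _ fun l => hi _ ?_] at h2
  · rcases Int.units_eq_one_or (Equiv.Perm.sign (Equiv.swap 0 i)) with h4 | h4
    · rw [h4, one_smul] at h2; exact h2.symm
    · rw [h4] at h2; simpa using h2.symm
  · intro hh
    have := (Equiv.swap 0 i).injective (hh.trans (Equiv.swap_apply_left 0 i).symm)
    exact Fin.succ_ne_zero l this

/-- The factor which a symmetric pair of points at `±ε` contributes to the weight. -/
noncomputable def pairKernel (ε s : ℝ) : ℝ := |s + ε| ^ (-(2 : ℝ)⁻¹) * |s - ε| ^ (-(2 : ℝ)⁻¹)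

theorem pairKernel_nonneg (ε s : ℝ) : 0 ≤ pairKernel ε s := by
  unfold pairKernel; positivity

theorem pairKernel_neg (ε s : ℝ) : pairKernel ε (-s) = pairKernel ε s := by
  unfold pairKernel
  rw [show -s + ε = -(s - ε) by ring, show -s - ε = -(s + ε) by ring, abs_neg, abs_neg, mul_comm]

theorem measurable_pairKernel (ε : ℝ) : Measurable (pairKernel ε) := by
  unfold pairKernel; fun_prop

theorem pairKernel_eq (ε s : ℝ) : pairKernel ε s = (√|s ^ 2 - ε ^ 2|)⁻¹ := by
  unfold pairKernel
  rw [← Real.mul_rpow (abs_nonneg _) (abs_nonneg _), ← abs_mul, Real.rpow_neg (abs_nonneg _),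
    Real.sqrt_eq_rpow, one_div]
  ring_nf

theorem pairKernel_of_lt {ε s : ℝ} (hε : 0 ≤ ε) (h : ε < s) :
    pairKernel ε s = (√(s ^ 2 - ε ^ 2))⁻¹ := by
  rw [pairKernel_eq, abs_of_pos (by nlinarith)]

theorem pairKernel_of_mem {ε s : ℝ} (h : s ∈ Set.Ioo (-ε) ε) :
    pairKernel ε s = (√(ε ^ 2 - s ^ 2))⁻¹ := by
  rw [pairKernel_eq, abs_of_neg (by nlinarith [h.1, h.2]), neg_sub]

theorem continuousOn_pairKernel {ε m b : ℝ} (hε : 0 ≤ ε) (h : ε < m) (hmb : m ≤ b) :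
    ContinuousOn (pairKernel ε) (Set.uIcc m b) := by
  rw [show pairKernel ε = fun s => (√|s ^ 2 - ε ^ 2|)⁻¹ from funext (pairKernel_eq ε)]
  refine ContinuousOn.inv₀ (by fun_prop) fun s hs => ?_
  rw [Set.uIcc_of_le hmb] at hs
  have : 0 < s ^ 2 - ε ^ 2 := by nlinarith [hs.1]
  rw [abs_of_pos this]
  exact (Real.sqrt_pos.2 this).ne'

theorem hasDerivAt_sqrt_sq_sub {ε s : ℝ} (hε : 0 ≤ ε) (h : ε < s) :
    HasDerivAt (fun s => √(s ^ 2 - ε ^ 2)) (s * pairKernel ε s) s := by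
  have h1 : HasDerivAt (fun s : ℝ => s ^ 2 - ε ^ 2) (2 * s) s := by
    simpa using (hasDerivAt_pow 2 s).sub_const (ε ^ 2)
  have h0 : 0 < s ^ 2 - ε ^ 2 := by nlinarith
  have h2 := h1.sqrt h0.ne'
  rw [pairKernel_of_lt hε h]
  convert h2 using 1
  have := (Real.sqrt_pos.2 h0).ne'
  field_simp

theorem intervalIntegrable_mul_pairKernel {ε m : ℝ} (hε : 0 ≤ ε) (h : ε ≤ m) :
    IntervalIntegrable (fun s => s * pairKernel ε s) volume ε m := by
  refine intervalIntegral.intervalIntegrable_deriv_of_nonneg (g := fun s => √(s ^ 2 - ε ^ 2))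
    (by fun_prop) ?_ ?_
  · rw [min_eq_left h, max_eq_right h]
    exact fun s hs => hasDerivAt_sqrt_sq_sub hε hs.1
  · rw [min_eq_left h, max_eq_right h]
    exact fun s hs => mul_nonneg (hε.trans hs.1.le) (pairKernel_nonneg _ _)

theorem integral_mul_pairKernel {ε m : ℝ} (hε : 0 ≤ ε) (h : ε ≤ m) :
    ∫ s in ε..m, s * pairKernel ε s = √(m ^ 2 - ε ^ 2) := by
  rw [intervalIntegral.integral_eq_sub_of_hasDerivAt_of_le h (f := fun s => √(s ^ 2 - ε ^ 2))
    (by fun_prop) (fun s hs => hasDerivAt_sqrt_sq_sub hε hs.1)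
    (intervalIntegrable_mul_pairKernel hε h)]
  simp

theorem intervalIntegrable_pairKernel {ε m : ℝ} (hε : 0 < ε) (h : ε ≤ m) :
    IntervalIntegrable (pairKernel ε) volume ε m := by
  have h1 := (intervalIntegrable_mul_pairKernel hε.le h).continuousOn_mul (g := fun s => s⁻¹) (by
    refine continuousOn_inv₀.mono fun s hs => ?_
    rw [Set.uIcc_of_le h] at hs
    exact (hε.trans_le hs.1).ne')
  refine h1.congr ?_
  rw [Set.uIoc_of_le h]
  intro s hs
  have : s ≠ 0 := (hε.trans hs.1).ne'
  field_simp

theorem log_le_integral_pairKernel {ε m : ℝ} (hε : 0 < ε) (h : ε ≤ m) :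
    Real.log (m / ε) ≤ ∫ s in ε..m, pairKernel ε s := by
  rw [← integral_inv_of_pos hε (hε.trans_le h)]
  refine intervalIntegral.integral_mono_on_of_le_Ioo h ?_ (intervalIntegrable_pairKernel hε h) ?_
  · refine (continuousOn_inv₀.mono fun s hs => ?_).intervalIntegrable
    rw [Set.uIcc_of_le h] at hs
    exact (hε.trans_le hs.1).ne'
  · intro s hs
    have hs0 : 0 < s := hε.trans hs.1
    rw [pairKernel_of_lt hε.le hs.1]
    have : 0 < √(s ^ 2 - ε ^ 2) := Real.sqrt_pos.2 (by nlinarith [hs.1])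
    refine inv_anti₀ this ?_
    refine Real.sqrt_le_iff.2 ⟨hs0.le, by nlinarith⟩

theorem hasDerivAt_arcsin_div {ε s : ℝ} (h : s ∈ Set.Ioo (-ε) ε) :
    HasDerivAt (fun s => Real.arcsin (s / ε)) (pairKernel ε s) s := by
  have hε : 0 < ε := by linarith [h.1, h.2]
  have h1 : s / ε < 1 := (div_lt_one hε).2 h.2
  have h2 : -1 < s / ε := by rw [lt_div_iff₀ hε]; linarith [h.1]
  have h3 := (Real.hasDerivAt_arcsin h2.ne' h1.ne).comp s ((hasDerivAt_id s).div_const ε)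
  rw [pairKernel_of_mem h]
  have h4 : 1 - (s / ε) ^ 2 = (ε ^ 2 - s ^ 2) / ε ^ 2 := by field_simp
  have h5 : 0 < √(ε ^ 2 - s ^ 2) := Real.sqrt_pos.2 (by nlinarith [h.1, h.2])
  have h6 : (√(ε ^ 2 - s ^ 2))⁻¹ = 1 / √(1 - (s / ε) ^ 2) * (1 / ε) := by
    rw [h4, Real.sqrt_div' _ (sq_nonneg ε), Real.sqrt_sq hε.le]
    field_simp
  rw [h6]
  exact h3

theorem intervalIntegrable_pairKernel_neg_self {ε : ℝ} (hε : 0 < ε) :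
    IntervalIntegrable (pairKernel ε) volume (-ε) ε := by
  have h : -ε ≤ ε := by linarith
  refine intervalIntegral.intervalIntegrable_deriv_of_nonneg
    (g := fun s => Real.arcsin (s / ε)) (by fun_prop) ?_ fun s _ => pairKernel_nonneg _ _
  rw [min_eq_left h, max_eq_right h]
  exact fun s hs => hasDerivAt_arcsin_div hs

theorem integral_pairKernel_neg_self {ε : ℝ} (hε : 0 < ε) :
    ∫ s in (-ε)..ε, pairKernel ε s = Real.pi := by
  rw [intervalIntegral.integral_eq_sub_of_hasDerivAt_of_le (by linarith)
    (f := fun s => Real.arcsin (s / ε)) (by fun_prop) (fun s hs => hasDerivAt_arcsin_div hs)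
    (intervalIntegrable_pairKernel_neg_self hε)]
  simp only [neg_div, div_self hε.ne', Real.arcsin_neg, Real.arcsin_one]
  ring

open Filter Topology

theorem tendsto_integral_mul_pairKernel_near {m : ℝ} (hm : 0 < m) {h : ℝ → ℝ}
    (hh : ContinuousOn h (Set.Icc 0 m)) :
    Tendsto (fun ε => ∫ s in ε..m, h s * (s * pairKernel ε s)) (𝓝[>] 0)
      (𝓝 (∫ s in (0 : ℝ)..m, h s)) := by
  obtain ⟨B, hB⟩ := isCompact_Icc.exists_bound_of_continuousOn hh
  have hlim : Tendsto (fun ε : ℝ => B * (√(m ^ 2 - ε ^ 2) - (m - ε)) + B * ε) (𝓝[>] 0) (𝓝 0) := by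
    have : Continuous fun ε : ℝ => B * (√(m ^ 2 - ε ^ 2) - (m - ε)) + B * ε := by fun_prop
    have h1 := this.tendsto 0
    simp only [ne_eq, OfNat.ofNat_ne_zero, not_false_eq_true, zero_pow, sub_zero, mul_zero,
      Real.sqrt_sq hm.le, sub_self, add_zero] at h1
    exact h1.mono_left nhdsWithin_le_nhds
  rw [tendsto_iff_norm_sub_tendsto_zero]
  refine squeeze_zero' (Eventually.of_forall fun _ => norm_nonneg _) ?_ hlim
  filter_upwards [Ioo_mem_nhdsGT hm] with ε hε
  have hsub : Set.uIcc ε m ⊆ Set.Icc 0 m := by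
    rw [Set.uIcc_of_le hε.2.le]; exact Set.Icc_subset_Icc_left hε.1.le
  have hsub' : Set.uIcc 0 ε ⊆ Set.Icc 0 m := by
    rw [Set.uIcc_of_le hε.1.le]; exact Set.Icc_subset_Icc_right hε.2.le
  have hi0 : IntervalIntegrable h volume 0 ε := (hh.mono hsub').intervalIntegrable
  have hi1 : IntervalIntegrable h volume ε m := (hh.mono hsub).intervalIntegrable
  have hk := intervalIntegrable_mul_pairKernel hε.1.le hε.2.le
  have hi2 : IntervalIntegrable (fun s => h s * (s * pairKernel ε s)) volume ε m :=
    hk.continuousOn_mul (hh.mono hsub)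
  rw [← intervalIntegral.integral_add_adjacent_intervals hi0 hi1, add_comm, ← sub_sub,
    ← intervalIntegral.integral_sub hi2 hi1]
  refine (norm_sub_le _ _).trans (add_le_add ?_ ?_)
  · have hb : IntervalIntegrable (fun s => B * (s * pairKernel ε s - 1)) volume ε m :=
      (hk.sub intervalIntegrable_const).const_mul B
    refine (intervalIntegral.norm_integral_le_of_norm_le hε.2.le
      (g := fun s => B * (s * pairKernel ε s - 1)) ?_ hb).trans ?_
    · refine Eventually.of_forall fun s hs => ?_
      have hs0 : 0 < s := hε.1.trans hs.1
      have hge : 1 ≤ s * pairKernel ε s := by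
        rw [pairKernel_of_lt hε.1.le hs.1, ← div_eq_mul_inv, one_le_div]
        · exact Real.sqrt_le_iff.2 ⟨hs0.le, by nlinarith⟩
        · exact Real.sqrt_pos.2 (by nlinarith [hs.1, hε.1])
      rw [show h s * (s * pairKernel ε s) - h s = h s * (s * pairKernel ε s - 1) by ring, norm_mul,
        Real.norm_of_nonneg (sub_nonneg.2 hge)]
      exact mul_le_mul_of_nonneg_right (hB s ⟨hs0.le, hs.2⟩) (sub_nonneg.2 hge)
    · rw [intervalIntegral.integral_const_mul, intervalIntegral.integral_sub hk
        intervalIntegrable_const, integral_mul_pairKernel hε.1.le hε.2.le]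
      simp
  · have := intervalIntegral.norm_integral_le_of_norm_le_const (a := 0) (b := ε) (f := h) (C := B)
      fun s hs => hB s (by
        rw [Set.uIoc_of_le hε.1.le] at hs
        exact ⟨hs.1.le, hs.2.trans hε.2.le⟩)
    simpa [abs_of_pos hε.1] using this

theorem tendsto_integral_pairKernel_atTop {m : ℝ} (hm : 0 < m) :
    Tendsto (fun ε => ∫ s in ε..m, pairKernel ε s) (𝓝[>] 0) atTop := by
  have h1 : Tendsto (fun ε => Real.log (m / ε)) (𝓝[>] 0) atTop := by
    refine Real.tendsto_log_atTop.comp ?_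
    exact (tendsto_inv_nhdsGT_zero.const_mul_atTop hm).congr fun ε => (div_eq_mul_inv m ε).symm
  refine tendsto_atTop_mono' _ ?_ h1
  filter_upwards [Ioo_mem_nhdsGT hm] with ε hε
  exact log_le_integral_pairKernel hε.1 hε.2.le

theorem tendsto_integral_mul_pairKernel_far {a b δ : ℝ} (hδ : 0 < δ) {f : ℝ → ℝ}
    (hf : IntervalIntegrable f volume a b) (hs : ∀ s ∈ Set.uIoc a b, δ ≤ |s|) :
    Tendsto (fun ε => ∫ s in a..b, f s * pairKernel ε s) (𝓝[>] 0)
      (𝓝 (∫ s in a..b, f s * |s|⁻¹)) := by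
  refine intervalIntegral.tendsto_integral_filter_of_dominated_convergence
    (fun s => ‖f s‖ * (δ / 2)⁻¹) ?_ ?_ (hf.norm.mul_const _) ?_
  · refine Eventually.of_forall fun ε => ?_
    exact hf.def'.aestronglyMeasurable.mul (measurable_pairKernel ε).aestronglyMeasurable
  · filter_upwards [Ioo_mem_nhdsGT (half_pos hδ)] with ε hε
    refine Eventually.of_forall fun s hs' => ?_
    rw [norm_mul, Real.norm_of_nonneg (pairKernel_nonneg _ _)]
    refine mul_le_mul_of_nonneg_left ?_ (norm_nonneg _)
    rw [pairKernel_eq]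
    refine inv_anti₀ (half_pos hδ) (Real.le_sqrt_of_sq_le ?_)
    have h1 := hs s hs'
    have h2 : s ^ 2 = |s| ^ 2 := (sq_abs s).symm
    refine le_trans ?_ (le_abs_self _)
    rw [h2]
    nlinarith [hε.1, hε.2]
  · refine Eventually.of_forall fun s hs' => ?_
    refine Tendsto.const_mul _ ?_
    have h1 : 0 < |s| := hδ.trans_le (hs s hs')
    have h2 : ContinuousAt (fun ε => pairKernel ε s) 0 := by
      simp only [pairKernel_eq]
      refine ContinuousAt.inv₀ (by fun_prop) ?_
      have : 0 < |s ^ 2 - 0 ^ 2| := by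
        have := abs_pos.1 h1
        rw [zero_pow two_ne_zero, sub_zero]
        positivity
      exact (Real.sqrt_pos.2 this).ne'
    have h3 := h2.tendsto
    rw [pairKernel_eq] at h3
    simp only [ne_eq, OfNat.ofNat_ne_zero, not_false_eq_true, zero_pow, sub_zero, abs_pow, sq_abs,
      Real.sqrt_sq_eq_abs] at h3
    exact h3.mono_left nhdsWithin_le_nhds

theorem tendsto_integral_pow_mul_pairKernel {m b : ℝ} (hm : 0 < m) (hmb : m ≤ b) {h : ℝ → ℝ}
    (hi : IntervalIntegrable h volume 0 b) (hh : ContinuousOn h (Set.Icc 0 m)) (r : ℕ) :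
    Tendsto (fun ε => ∫ s in ε..b, s ^ (r + 1) * h s * pairKernel ε s) (𝓝[>] 0)
      (𝓝 (∫ s in (0 : ℝ)..b, s ^ r * h s)) := by
  have him : IntervalIntegrable h volume m b :=
    hi.mono_set (Set.uIcc_subset_uIcc_right (Set.mem_uIcc_of_le hm.le hmb))
  have hh' : ContinuousOn (fun s => s ^ r * h s) (Set.Icc 0 m) := by fun_prop
  have hpow : ∀ k, IntervalIntegrable (fun s => s ^ k * h s) volume m b := fun k =>
    him.continuousOn_mul (by fun_prop)
  have h1 := tendsto_integral_mul_pairKernel_near hm hh'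
  have h2 := tendsto_integral_mul_pairKernel_far hm (hpow (r + 1)) (fun s hs => by
    rw [Set.uIoc_of_le hmb] at hs
    exact hs.1.le.trans (le_abs_self s))
  have h3 := h1.add h2
  have e1 : ∫ s in m..b, s ^ (r + 1) * h s * |s|⁻¹ = ∫ s in m..b, s ^ r * h s := by
    refine intervalIntegral.integral_congr fun s hs => ?_
    rw [Set.uIcc_of_le hmb] at hs
    have : 0 < s := hm.trans_le hs.1
    simp only [abs_of_pos this]
    field_simp
    ring
  rw [e1, intervalIntegral.integral_add_adjacent_intervals] at h3
  · refine h3.congr' ?_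
    filter_upwards [Ioo_mem_nhdsGT hm] with ε hε
    have e2 : ∫ s in ε..m, s ^ r * h s * (s * pairKernel ε s) =
        ∫ s in ε..m, s ^ (r + 1) * h s * pairKernel ε s :=
      intervalIntegral.integral_congr fun s _ => by ring
    rw [e2, intervalIntegral.integral_add_adjacent_intervals]
    · refine (intervalIntegrable_pairKernel hε.1 hε.2.le).continuousOn_mul ?_
      have : ContinuousOn (fun s => s ^ (r + 1) * h s) (Set.Icc 0 m) := by fun_prop
      refine this.mono ?_
      rw [Set.uIcc_of_le hε.2.le]; exact Set.Icc_subset_Icc_left hε.1.le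
    · refine (hpow (r + 1)).mul_continuousOn ?_
      exact continuousOn_pairKernel hε.1.le hε.2 hmb
  · refine ContinuousOn.intervalIntegrable ?_
    rwa [Set.uIcc_of_le hm.le]
  · exact hpow r

theorem tendsto_integral_mul_pairKernel_div {m b C : ℝ} (hm : 0 < m) (hmb : m ≤ b) {h : ℝ → ℝ}
    (hi : IntervalIntegrable h volume 0 b) (hh : ContinuousOn h (Set.Icc 0 m))
    (hC : ∀ s ∈ Set.Icc 0 m, |h s - h 0| ≤ C * s) :
    Tendsto (fun ε => (∫ s in ε..b, h s * pairKernel ε s) / ∫ s in ε..m, pairKernel ε s) (𝓝[>] 0)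
      (𝓝 (h 0)) := by
  have hΛ := tendsto_integral_pairKernel_atTop hm
  have him : IntervalIntegrable h volume m b :=
    hi.mono_set (Set.uIcc_subset_uIcc_right (Set.mem_uIcc_of_le hm.le hmb))
  have h2 := tendsto_integral_mul_pairKernel_far hm him (fun s hs => by
    rw [Set.uIoc_of_le hmb] at hs
    exact hs.1.le.trans (le_abs_self s))
  have h3 := h2.div_atTop hΛ
  have hC0 : 0 ≤ C := by
    have := (abs_nonneg _).trans (hC m ⟨hm.le, le_rfl⟩)
    exact nonneg_of_mul_nonneg_left this hm
  have h4 : Tendsto (fun ε => (∫ s in ε..m, (h s - h 0) * pairKernel ε s) /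
      ∫ s in ε..m, pairKernel ε s) (𝓝[>] 0) (𝓝 0) := by
    have h5 : Tendsto (fun ε => C * m / ∫ s in ε..m, pairKernel ε s) (𝓝[>] 0) (𝓝 0) :=
      tendsto_const_nhds.div_atTop hΛ
    rw [tendsto_zero_iff_norm_tendsto_zero]
    refine squeeze_zero' (Eventually.of_forall fun _ => norm_nonneg _) ?_ h5
    filter_upwards [Ioo_mem_nhdsGT hm, hΛ.eventually_gt_atTop 0] with ε hε hpos
    rw [norm_div, Real.norm_of_nonneg hpos.le]
    refine div_le_div_of_nonneg_right ?_ hpos.le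
    have hk := intervalIntegrable_mul_pairKernel hε.1.le hε.2.le
    refine (intervalIntegral.norm_integral_le_of_norm_le hε.2.le
      (g := fun s => C * (s * pairKernel ε s)) ?_ (hk.const_mul C)).trans ?_
    · refine Eventually.of_forall fun s hs => ?_
      rw [norm_mul, Real.norm_of_nonneg (pairKernel_nonneg _ _), ← mul_assoc]
      exact mul_le_mul_of_nonneg_right (hC s ⟨hε.1.le.trans hs.1.le, hs.2⟩)
        (pairKernel_nonneg _ _)
    · rw [intervalIntegral.integral_const_mul, integral_mul_pairKernel hε.1.le hε.2.le]
      refine mul_le_mul_of_nonneg_left ?_ hC0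
      exact Real.sqrt_le_iff.2 ⟨hm.le, by nlinarith [hε.1]⟩
  have h6 := (h4.add_const (h 0)).add h3
  simp only [zero_add, add_zero] at h6
  refine h6.congr' ?_
  filter_upwards [Ioo_mem_nhdsGT hm, hΛ.eventually_gt_atTop 0] with ε hε hpos
  have hk := intervalIntegrable_pairKernel hε.1 hε.2.le
  have hc : ContinuousOn h (Set.uIcc ε m) := by
    rw [Set.uIcc_of_le hε.2.le]; exact hh.mono (Set.Icc_subset_Icc_left hε.1.le)
  have e1 : ∫ s in ε..m, (h s - h 0) * pairKernel ε s =
      (∫ s in ε..m, h s * pairKernel ε s) - h 0 * ∫ s in ε..m, pairKernel ε s := by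
    rw [← intervalIntegral.integral_const_mul, ← intervalIntegral.integral_sub
      (hk.continuousOn_mul hc) (hk.const_mul _)]
    exact intervalIntegral.integral_congr fun s _ => by ring
  rw [e1, ← intervalIntegral.integral_add_adjacent_intervals (hk.continuousOn_mul hc)
    (him.mul_continuousOn (continuousOn_pairKernel hε.1.le hε.2 hmb))]
  field_simp
  ring

theorem norm_integral_pow_mul_pairKernel_le {ε B : ℝ} (hε : 0 < ε) {h : ℝ → ℝ}
    (hB : ∀ s ∈ Set.Icc (-ε) ε, |h s| ≤ B) (r : ℕ) :
    |∫ s in (-ε)..ε, s ^ r * h s * pairKernel ε s| ≤ ε ^ r * B * Real.pi := by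
  have hle : -ε ≤ ε := by linarith
  rw [← integral_pairKernel_neg_self hε, ← intervalIntegral.integral_const_mul, ← Real.norm_eq_abs]
  refine intervalIntegral.norm_integral_le_of_norm_le hle
    (g := fun s => ε ^ r * B * pairKernel ε s) (Eventually.of_forall fun s hs => ?_)
    ((intervalIntegrable_pairKernel_neg_self hε).const_mul _)
  rw [norm_mul, norm_mul, norm_pow, Real.norm_of_nonneg (pairKernel_nonneg _ _)]
  refine mul_le_mul_of_nonneg_right ?_ (pairKernel_nonneg _ _)
  refine mul_le_mul (pow_le_pow_left₀ (norm_nonneg _) (abs_le.2 ⟨hs.1.le, hs.2⟩) r)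
    (hB s ⟨hs.1.le, hs.2⟩) (norm_nonneg _) (by positivity)

/-- The weight `∏ |u - x i| ^ (-1/2)` of the screening variable. -/
noncomputable def weight (n : ℕ) (x : ℕ → ℝ) (u : ℝ) : ℝ :=
  ∏ i ∈ Finset.Icc 1 n, |u - x i| ^ (-(2 : ℝ)⁻¹)

theorem locallyIntegrable_abs_rpow_neg_half (c : ℝ) :
    LocallyIntegrable (fun u : ℝ => |u - c| ^ (-(2 : ℝ)⁻¹)) := by
  have h1 : ∀ b : ℝ, 0 ≤ b → IntervalIntegrable (fun u : ℝ => |u| ^ (-(2 : ℝ)⁻¹)) volume 0 b := by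
    intro b hb
    refine (intervalIntegral.intervalIntegrable_rpow' (r := -(2 : ℝ)⁻¹) (by norm_num)).congr ?_
    rw [Set.uIoc_of_le hb]
    intro u hu
    simp only [abs_of_pos hu.1]
  have h2 : ∀ b : ℝ, 0 ≤ b → IntervalIntegrable
      (fun u : ℝ => |u| ^ (-(2 : ℝ)⁻¹)) volume (-b) b := by
    intro b hb
    refine IntervalIntegrable.trans (b := 0) ?_ (h1 b hb)
    rw [IntervalIntegrable.iff_comp_neg]
    simpa using (h1 b hb).symm
  intro u
  have h3 := (h2 (|u - c| + 1) (by positivity)).comp_sub_right c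
  rw [intervalIntegrable_iff_integrableOn_Ioc_of_le (by linarith [abs_nonneg (u - c)])] at h3
  refine ⟨_, Ioc_mem_nhds ?_ ?_, h3⟩
  · linarith [neg_abs_le (u - c)]
  · linarith [le_abs_self (u - c)]

theorem measurable_weight (n : ℕ) (x : ℕ → ℝ) : Measurable (weight n x) := by
  unfold weight; fun_prop

theorem continuousAt_abs_rpow_neg_half {u c : ℝ} (h : u ≠ c) :
    ContinuousAt (fun u : ℝ => |u - c| ^ (-(2 : ℝ)⁻¹)) u :=
  ContinuousAt.rpow_const (by fun_prop) (Or.inl (abs_ne_zero.2 (sub_ne_zero.2 h)))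

theorem weight_pos {n : ℕ} {x : ℕ → ℝ} {u : ℝ} (h : ∀ i ∈ Finset.Icc 1 n, u ≠ x i) :
    0 < weight n x u :=
  Finset.prod_pos fun i hi => Real.rpow_pos_of_pos (abs_pos.2 (sub_ne_zero.2 (h i hi))) _

theorem locallyIntegrable_weight {n : ℕ} {x : ℕ → ℝ} (hx : Set.InjOn x (Finset.Icc 1 n)) :
    LocallyIntegrable (weight n x) := by
  intro u
  have hm : StronglyMeasurableAtFilter (weight n x) (𝓝 u) volume :=
    (measurable_weight n x).aestronglyMeasurable.stronglyMeasurableAtFilter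
  by_cases h : ∃ i ∈ Finset.Icc 1 n, u = x i
  · obtain ⟨i, hi, rfl⟩ := h
    refine Asymptotics.IsBigO.integrableAtFilter ?_ hm
      (locallyIntegrable_abs_rpow_neg_half (x i) (x i))
    have hc : ContinuousAt
        (fun v => ∏ j ∈ (Finset.Icc 1 n).erase i, |v - x j| ^ (-(2 : ℝ)⁻¹)) (x i) := by
      refine tendsto_finsetProd _ fun j hj => ?_
      rw [Finset.mem_erase] at hj
      exact continuousAt_abs_rpow_neg_half fun h => hj.1 (hx hj.2 hi h.symm)
    have h1 := (Asymptotics.isBigO_refl (fun v => |v - x i| ^ (-(2 : ℝ)⁻¹)) (𝓝 (x i))).mul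
      (hc.tendsto.isBigO_one ℝ)
    refine (h1.congr_left fun v => ?_).congr_right fun v => mul_one _
    exact Finset.mul_prod_erase _ (fun j => |v - x j| ^ (-(2 : ℝ)⁻¹)) hi
  · push Not at h
    have hc : ContinuousAt (weight n x) u :=
      tendsto_finsetProd _ fun j hj => continuousAt_abs_rpow_neg_half (h j hj)
    exact (hc.tendsto.isBigO_one ℝ).integrableAtFilter hm (locallyIntegrable_const (1 : ℝ) u)

theorem IsChamber.injOn {N : ℕ} {x : ℕ → ℝ} (hx : IsChamber N x) :
    Set.InjOn x (Finset.Icc 1 (2 * N)) := by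
  intro i hi j hj h
  simp only [Finset.coe_Icc, Set.mem_Icc] at hi hj
  rcases lt_trichotomy i j with h1 | h1 | h1
  · exact absurd h (hx i j hi.1 h1 hj.2).ne
  · exact h1
  · exact absurd h.symm (hx j i hj.1 h1 hi.2).ne

theorem IsChamber.intervalIntegrable_weight {N : ℕ} {x : ℕ → ℝ} (hx : IsChamber N x) (a b : ℝ) :
    IntervalIntegrable (weight (2 * N) x) volume a b :=
  intervalIntegrable_iff.2
    (((locallyIntegrable_weight hx.injOn).integrableOn_isCompact isCompact_uIcc).mono_set
      Set.uIoc_subset_uIcc)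

theorem IsChamber.intervalIntegrable_pow_mul_weight {N : ℕ} {x : ℕ → ℝ} (hx : IsChamber N x)
    (ξ : ℝ) (r : ℕ) (a b : ℝ) :
    IntervalIntegrable (fun u => (u - ξ) ^ r * weight (2 * N) x u) volume a b :=
  (hx.intervalIntegrable_weight a b).continuousOn_mul (by fun_prop)

/-- The `r`-th moment, centred at `ξ`, of the weight over the interval `(x k, x (k + 1))`. -/
noncomputable def period (N : ℕ) (x : ℕ → ℝ) (ξ : ℝ) (r k : ℕ) : ℝ :=
  ∫ u in x k..x (k + 1), (u - ξ) ^ r * weight (2 * N) x u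

/-- The formal sum of the intervals `(x k, x (k + 1))` weighted by their `r`-th moments. -/
noncomputable def periodVec (N : ℕ) (x : ℕ → ℝ) (ξ : ℝ) (r : ℕ) : ℕ →₀ ℂ :=
  ∑ k ∈ Finset.Icc 1 (2 * N - 1), (Complex.I ^ k * (period N x ξ r k : ℂ)) • siteVec k

theorem sum_perm_prod_period {N : ℕ} {x : ℕ → ℝ} (hx : IsChamber N x) (ξ : ℝ) {k : Fin N → ℕ}
    (hk : ∀ r, k r ∈ Finset.Icc 1 (2 * N - 1)) :
    ∑ σ : Equiv.Perm (Fin N), (Equiv.Perm.sign σ : ℝ) * ∏ r : Fin N, period N x ξ r (k (σ r)) =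
      ∫ u : Fin N → ℝ in Set.univ.pi fun r => Set.Ioo (x (k r)) (x (k r + 1)),
        (∏ p ∈ (Finset.univ ×ˢ Finset.univ : Finset (Fin N × Fin N)).filter fun p => p.1 < p.2,
          (u p.2 - u p.1)) * ∏ r, weight (2 * N) x (u r) := by
  have hlt : ∀ r, x (k r) ≤ x (k r + 1) := fun r => by
    have := Finset.mem_Icc.1 (hk r)
    exact (hx _ _ this.1 (Nat.lt_succ_self _) (by omega)).le
  have hper : ∀ (σ : Equiv.Perm (Fin N)), ∏ r : Fin N, period N x ξ r (k (σ r)) =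
      ∏ r, ∫ u in Set.Ioo (x (k r)) (x (k r + 1)),
        (u - ξ) ^ ((σ⁻¹ r : Fin N) : ℕ) * weight (2 * N) x u := by
    intro σ
    symm
    rw [← Equiv.prod_comp σ]
    refine Finset.prod_congr rfl fun r _ => ?_
    rw [period, intervalIntegral.integral_of_le (hlt _), integral_Ioc_eq_integral_Ioo]
    simp
  have h_int : ∀ (s : Fin N → ℕ) (r : Fin N), Integrable
      (fun u => (u - ξ) ^ (s r) * weight (2 * N) x u)
      (volume.restrict (Set.Ioo (x (k r)) (x (k r + 1)))) := fun s r =>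
    ((intervalIntegrable_iff_integrableOn_Ioc_of_le (hlt r)).1
      (hx.intervalIntegrable_pow_mul_weight ξ (s r) _ _)).mono_set Set.Ioo_subset_Ioc_self
  have hdet : ∀ u : Fin N → ℝ,
      (∏ p ∈ (Finset.univ ×ˢ Finset.univ : Finset (Fin N × Fin N)).filter fun p => p.1 < p.2,
        (u p.2 - u p.1)) = ∑ σ : Equiv.Perm (Fin N), (Equiv.Perm.sign σ : ℝ) *
          ∏ r, (u r - ξ) ^ ((σ⁻¹ r : Fin N) : ℕ) := by
    intro u
    have h1 : (∏ p ∈ (Finset.univ ×ˢ Finset.univ : Finset (Fin N × Fin N)).filter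
        fun p => p.1 < p.2, (u p.2 - u p.1)) = (Matrix.vandermonde u).det := by
      rw [Matrix.det_vandermonde, Finset.prod_filter, Finset.prod_product]
      refine Finset.prod_congr rfl fun i _ => ?_
      rw [← Finset.prod_filter]
      refine Finset.prod_congr ?_ fun _ _ => rfl
      ext; simp
    rw [h1, ← Matrix.det_vandermonde_sub u ξ, Matrix.det_apply]
    refine Finset.sum_congr rfl fun σ _ => ?_
    rw [← Equiv.prod_comp σ (fun r => (u r - ξ) ^ ((σ⁻¹ r : Fin N) : ℕ))]
    simp [Matrix.vandermonde_apply, Units.smul_def]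
  have hvol : (volume : Measure (Fin N → ℝ)).restrict
      (Set.univ.pi fun r => Set.Ioo (x (k r)) (x (k r + 1))) =
      Measure.pi fun r => volume.restrict (Set.Ioo (x (k r)) (x (k r + 1))) := by
    rw [volume_pi, Measure.restrict_pi_pi]
  simp only [hdet, hvol, Finset.sum_mul, mul_assoc, ← Finset.prod_mul_distrib, hper]
  rw [integral_finsetSum]
  · refine Finset.sum_congr rfl fun σ _ => ?_
    rw [integral_const_mul]
    congr 1
    exact (integral_fintype_prod_eq_prod _).symm
  · intro σ _
    refine Integrable.const_mul ?_ _
    exact Integrable.fintype_prod (h_int fun r => ((σ⁻¹ r : Fin N) : ℕ))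

theorem form_sum_smul_siteVec {N : ℕ} (G : (ℕ →₀ ℂ) [⋀^Fin N]→ₗ[ℂ] ℂ) (s : Finset ℕ)
    (P : Fin N → ℕ → ℂ) :
    G (fun r => ∑ k ∈ s, P r k • siteVec k) =
      ∑ t ∈ Fintype.piFinset fun _ : Fin N => s, (∏ r, P r (t r)) * formCoeff G t := by
  have := G.toMultilinearMap.map_sum_finset (fun r k => P r k • siteVec k) (fun _ => s)
  refine this.trans (Finset.sum_congr rfl fun t _ => ?_)
  exact (G.toMultilinearMap.map_smul_univ (fun r => P r (t r)) fun r => siteVec (t r))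

theorem sum_formCoeff_eq_sum_strictMono {N n : ℕ} (G : (ℕ →₀ ℂ) [⋀^Fin N]→ₗ[ℂ] ℂ)
    (P : Fin N → ℕ → ℂ) :
    G (fun r => ∑ k ∈ Finset.Icc 1 n, P r k • siteVec k) =
      ∑ k ∈ (Fintype.piFinset fun _ : Fin N => Finset.Icc 1 n).filter
        fun k => ∀ r s : Fin N, r < s → k r < k s,
        formCoeff G k * ∑ σ : Equiv.Perm (Fin N), (Equiv.Perm.sign σ : ℂ) * ∏ r, P r (k (σ r)) := by
  rw [form_sum_smul_siteVec]
  simp only [Finset.mul_sum]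
  rw [Finset.sum_sigma']
  symm
  refine Finset.sum_of_injOn (fun p => p.1 ∘ p.2) ?_ ?_ ?_ ?_
  · rintro ⟨k, σ⟩ hp ⟨l, τ⟩ hq hpq
    simp only [Finset.coe_sigma, Set.mem_sigma_iff, Finset.mem_coe, Finset.mem_filter] at hp hq hpq
    have hk : StrictMono k := fun r s => hp.1.2 r s
    have hl : StrictMono l := fun r s => hq.1.2 r s
    have hkl : k = l := by
      refine (hk.range_inj hl).1 ?_
      rw [← EquivLike.range_comp k σ, ← EquivLike.range_comp l τ, hpq]
    subst hkl
    have : σ = τ := Equiv.ext fun r => hk.injective (congrFun hpq r)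
    rw [this]
  · rintro ⟨k, σ⟩ hp
    simp only [Finset.coe_sigma, Set.mem_sigma_iff, Finset.mem_coe, Finset.mem_filter,
      Fintype.mem_piFinset] at hp ⊢
    exact fun r => hp.1.1 (σ r)
  · intro t ht hnot
    by_cases hinj : Function.Injective t
    · refine absurd ?_ hnot
      have hmono : StrictMono (t ∘ Tuple.sort t) :=
        (Tuple.monotone_sort t).strictMono_of_injective (hinj.comp (Tuple.sort t).injective)
      refine ⟨⟨t ∘ Tuple.sort t, (Tuple.sort t)⁻¹⟩, ?_, ?_⟩
      · simp only [Finset.coe_sigma, Set.mem_sigma_iff, Finset.mem_coe, Finset.mem_filter,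
          Fintype.mem_piFinset] at ht ⊢
        exact ⟨⟨fun r => ht _, fun r s h => hmono h⟩, Finset.mem_univ _⟩
      · ext r; simp
    · simp only [Function.Injective, not_forall] at hinj
      obtain ⟨r, s, h, hrs⟩ := hinj
      rw [formCoeff_eq_zero_of_not_injective G t h hrs, mul_zero]
  · rintro ⟨k, σ⟩ _
    have : formCoeff G (k ∘ σ) = (Equiv.Perm.sign σ : ℂ) * formCoeff G k := by
      have := G.map_perm (fun r => siteVec (k r)) σ
      simpa [formCoeff, Units.smul_def, Function.comp_def] using this
    dsimp only
    rw [this]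
    simp only [Function.comp_apply]
    ring

theorem form_periodVec {N : ℕ} {x : ℕ → ℝ} (hx : IsChamber N x) (ξ : ℝ)
    (G : (ℕ →₀ ℂ) [⋀^Fin N]→ₗ[ℂ] ℂ) :
    ((∏ p ∈ (Finset.Icc 1 (2 * N) ×ˢ Finset.Icc 1 (2 * N)).filter fun p => p.1 < p.2,
      (x p.2 - x p.1) ^ ((4 : ℝ)⁻¹) : ℝ) : ℂ) * G (fun r : Fin N => periodVec N x ξ r) =
      ∑ k ∈ (Fintype.piFinset fun _ : Fin N => Finset.Icc 1 (2 * N - 1)).filter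
        fun k => ∀ r s : Fin N, r < s → k r < k s,
        Complex.I ^ (∑ r, k r) * formCoeff G k * (rho N k x : ℂ) := by
  have h1 := sum_formCoeff_eq_sum_strictMono (n := 2 * N - 1) G
    (fun r k => Complex.I ^ k * (period N x ξ r k : ℂ))
  unfold periodVec
  rw [h1, Finset.mul_sum]
  refine Finset.sum_congr rfl fun k hk => ?_
  rw [Finset.mem_filter, Fintype.mem_piFinset] at hk
  have h2 := sum_perm_prod_period hx ξ hk.1
  unfold weight at h2
  rw [rho, ← h2]
  push_cast
  have h3 : ∀ σ : Equiv.Perm (Fin N), ∏ r : Fin N, (Complex.I ^ k (σ r) *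
      (period N x ξ r (k (σ r)) : ℂ)) =
      Complex.I ^ (∑ r, k r) * ∏ r : Fin N, (period N x ξ r (k (σ r)) : ℂ) := by
    intro σ
    rw [Finset.prod_mul_distrib, Finset.prod_pow_eq_pow_sum, Equiv.sum_comp σ k]
  simp only [h3, mul_left_comm _ (Complex.I ^ _), ← Finset.mul_sum]
  ring

/-- A form vanishes on all period vectors, for any choice of centre. -/
def VanishesOnPeriods (N : ℕ) (G : (ℕ →₀ ℂ) [⋀^Fin N]→ₗ[ℂ] ℂ) : Prop :=
  ∀ x, IsChamber N x → ∀ ξ, G (fun r : Fin N => periodVec N x ξ r) = 0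

theorem IsChamber.prefactor_pos {N : ℕ} {x : ℕ → ℝ} (hx : IsChamber N x) :
    0 < ∏ p ∈ (Finset.Icc 1 (2 * N) ×ˢ Finset.Icc 1 (2 * N)).filter fun p => p.1 < p.2,
      (x p.2 - x p.1) ^ ((4 : ℝ)⁻¹) := by
  refine Finset.prod_pos fun p hp => ?_
  simp only [Finset.mem_filter, Finset.mem_product, Finset.mem_Icc] at hp
  exact Real.rpow_pos_of_pos (sub_pos.2 (hx _ _ hp.1.1.1 hp.2 hp.1.2.2)) _

theorem vanishesOnPeriods_of_exists_centre {N : ℕ} {G : (ℕ →₀ ℂ) [⋀^Fin N]→ₗ[ℂ] ℂ}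
    (h : ∀ x, IsChamber N x → ∃ ξ, G (fun r : Fin N => periodVec N x ξ r) = 0) :
    VanishesOnPeriods N G := by
  intro x hx ξ
  obtain ⟨ξ', h'⟩ := h x hx
  have h1 := form_periodVec hx ξ G
  rw [← form_periodVec hx ξ' G, h', mul_zero] at h1
  exact (mul_eq_zero.1 h1).resolve_left (Complex.ofReal_ne_zero.2 hx.prefactor_pos.ne')

/-- The configuration obtained from `x` by inserting the two points `ξ - ε`, `ξ + ε` at
positions `j`, `j + 1`. -/
noncomputable def splitPts (j : ℕ) (ξ ε : ℝ) (x : ℕ → ℝ) (i : ℕ) : ℝ :=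
  if i < j then x i else if i = j then ξ - ε else if i = j + 1 then ξ + ε else x (i - 2)

theorem splitPts_of_lt {j i : ℕ} (ξ ε : ℝ) (x : ℕ → ℝ) (h : i < j) : splitPts j ξ ε x i = x i :=
  if_pos h

theorem splitPts_self (j : ℕ) (ξ ε : ℝ) (x : ℕ → ℝ) : splitPts j ξ ε x j = ξ - ε := by
  simp [splitPts]

theorem splitPts_self_add_one (j : ℕ) (ξ ε : ℝ) (x : ℕ → ℝ) :
    splitPts j ξ ε x (j + 1) = ξ + ε := by
  simp [splitPts]

theorem splitPts_add_two {j i : ℕ} (ξ ε : ℝ) (x : ℕ → ℝ) (h : j ≤ i) :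
    splitPts j ξ ε x (i + 2) = x i := by
  simp [splitPts, show ¬ i + 2 < j by omega, show i + 2 ≠ j by omega, show i + 1 ≠ j by omega]

theorem prod_splitPts {j n : ℕ} (hj : j ∈ Finset.Icc 1 (n + 1)) (ξ ε : ℝ) (x : ℕ → ℝ) (F : ℝ → ℝ) :
    ∏ i ∈ Finset.Icc 1 (n + 2), F (splitPts j ξ ε x i) =
      (∏ i ∈ Finset.Icc 1 n, F (x i)) * (F (ξ - ε) * F (ξ + ε)) := by
  rw [Finset.mem_Icc] at hj
  rw [← Finset.Ico_add_one_right_eq_Icc, ← Finset.Ico_add_one_right_eq_Icc,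
    ← Finset.prod_Ico_consecutive _ hj.1 (show j ≤ n + 2 + 1 by omega),
    ← Finset.prod_Ico_consecutive _ (show j ≤ j + 2 by omega) (show j + 2 ≤ n + 2 + 1 by omega),
    ← Finset.prod_Ico_consecutive _ hj.1 hj.2,
    Finset.prod_Ico_succ_top (by omega), Finset.prod_Ico_succ_top (by omega), Finset.Ico_self,
    Finset.prod_empty, one_mul, splitPts_self, splitPts_self_add_one,
    show n + 2 + 1 = n + 1 + 2 by omega, ← Finset.prod_Ico_add']
  have h1 : ∏ i ∈ Finset.Ico 1 j, F (splitPts j ξ ε x i) = ∏ i ∈ Finset.Ico 1 j, F (x i) :=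
    Finset.prod_congr rfl fun i hi => by rw [splitPts_of_lt _ _ _ (Finset.mem_Ico.1 hi).2]
  have h2 : ∏ i ∈ Finset.Ico j (n + 1), F (splitPts j ξ ε x (i + 2)) =
      ∏ i ∈ Finset.Ico j (n + 1), F (x i) :=
    Finset.prod_congr rfl fun i hi => by rw [splitPts_add_two _ _ _ (Finset.mem_Ico.1 hi).1]
  rw [h1, h2]
  ring

theorem weight_splitPts {j n : ℕ} (hj : j ∈ Finset.Icc 1 (n + 1)) (ξ ε : ℝ) (x : ℕ → ℝ) (s : ℝ) :
    weight (n + 2) (splitPts j ξ ε x) (ξ + s) = weight n x (ξ + s) * pairKernel ε s := by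
  unfold weight pairKernel
  rw [prod_splitPts hj ξ ε x fun y => |ξ + s - y| ^ (-(2 : ℝ)⁻¹)]
  congr 4 <;> ring

theorem period_splitPts {j N : ℕ} (hj : j ∈ Finset.Icc 1 (2 * N + 1)) (ξ ε : ℝ) (x : ℕ → ℝ)
    (r k : ℕ) :
    period (N + 1) (splitPts j ξ ε x) ξ r k =
      ∫ s in (splitPts j ξ ε x k - ξ)..(splitPts j ξ ε x (k + 1) - ξ),
        s ^ r * weight (2 * N) x (ξ + s) * pairKernel ε s := by
  rw [period, ← intervalIntegral.integral_comp_sub_right]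
  refine intervalIntegral.integral_congr fun u _ => ?_
  have := weight_splitPts hj ξ ε x (u - ξ)
  rw [add_sub_cancel] at this
  simp only [add_sub_cancel]
  rw [show 2 * (N + 1) = 2 * N + 2 by ring, this, mul_assoc]

theorem period_eq_integral_shift (N : ℕ) (x : ℕ → ℝ) (ξ : ℝ) (r k : ℕ) :
    period N x ξ r k = ∫ s in (x k - ξ)..(x (k + 1) - ξ), s ^ r * weight (2 * N) x (ξ + s) := by
  rw [period, ← intervalIntegral.integral_comp_sub_right]
  simp only [add_sub_cancel]

/-- The ball of radius `m` about `ξ` fits in the `j`-th gap of the configuration `x`, and the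
weight is Lipschitz at `ξ` on that ball with constant `C`. -/
structure IsGap (N : ℕ) (x : ℕ → ℝ) (j : ℕ) (ξ m C : ℝ) : Prop where
  mem : j ∈ Finset.Icc 1 (2 * N + 1)
  pos : 0 < m
  left : ∀ i, 1 ≤ i → i < j → x i - ξ ≤ -m
  right : ∀ i, j ≤ i → i ≤ 2 * N → m ≤ x i - ξ
  weight_pos : 0 < weight (2 * N) x ξ
  cont : ContinuousOn (fun s => weight (2 * N) x (ξ + s)) (Set.Icc (-m) m)
  lipschitz : ∀ s, |s| ≤ m → |weight (2 * N) x (ξ + s) - weight (2 * N) x ξ| ≤ C * |s|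

theorem differentiableAt_weight {n : ℕ} {x : ℕ → ℝ} {u : ℝ} (h : ∀ i ∈ Finset.Icc 1 n, u ≠ x i) :
    DifferentiableAt ℝ (weight n x) u := by
  unfold weight
  refine DifferentiableAt.fun_finsetProd fun i hi => ?_
  have := sub_ne_zero.2 (h i hi)
  exact ((differentiableAt_id.sub_const _).abs this).rpow_const (Or.inl (abs_ne_zero.2 this))

theorem IsChamber.exists_isGap {N : ℕ} {x : ℕ → ℝ} (hx : IsChamber N x) {j : ℕ}
    (hj : j ∈ Finset.Icc 1 (2 * N + 1)) :
    ∃ ξ m C, IsGap N x j ξ m C := by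
  obtain ⟨ξ, hl, hr⟩ := Order.exists_between_finsets
    (((Finset.Icc 1 (2 * N)).filter (· < j)).image x) (((Finset.Icc j (2 * N))).image x) (by
      simp only [Finset.mem_image, Finset.mem_filter, Finset.mem_Icc]
      rintro _ ⟨i, ⟨hi, hij⟩, rfl⟩ _ ⟨l, hl, rfl⟩
      exact hx i l hi.1 (by omega) hl.2)
  simp only [Finset.mem_image, Finset.mem_filter, Finset.mem_Icc, forall_exists_index,
    and_imp] at hl hr
  have hj' := Finset.mem_Icc.1 hj
  have hl' := fun i h1 h2 h3 => hl _ i h1 h2 h3 rfl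
  have hr' := fun i h1 h2 => hr _ i h1 h2 rfl
  have hne : ∀ i ∈ Finset.Icc 1 (2 * N), ξ ≠ x i := by
    intro i hi
    rw [Finset.mem_Icc] at hi
    by_cases h : i < j
    · exact (hl' i hi.1 hi.2 h).ne'
    · exact (hr' i (not_lt.1 h) hi.2).ne
  obtain ⟨C, hC⟩ := (differentiableAt_weight hne).isBigO_sub.bound
  have h1 : ∀ᶠ u in 𝓝 ξ, ‖weight (2 * N) x u - weight (2 * N) x ξ‖ ≤ C * ‖u - ξ‖ ∧
      ∀ i ∈ Finset.Icc 1 (2 * N), u ≠ x i := by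
    refine hC.and ?_
    rw [Filter.eventually_all_finset]
    exact fun i hi => isOpen_ne.mem_nhds (hne i hi)
  obtain ⟨δ, hδ, hball⟩ := Metric.eventually_nhds_iff.1 h1
  have hin : ∀ s, |s| ≤ δ / 2 → dist (ξ + s) ξ < δ := by
    intro s hs
    rw [Real.dist_eq, add_sub_cancel_left]
    linarith
  have hfar : ∀ i ∈ Finset.Icc 1 (2 * N), δ / 2 < |x i - ξ| := by
    intro i hi
    by_contra! h
    have := (hball (hin _ h)).2 i hi
    simp at this
  refine ⟨ξ, δ / 2, C, hj, half_pos hδ, ?_, ?_, weight_pos hne, ?_, ?_⟩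
  · intro i hi hij
    have h2 : i ≤ 2 * N := by omega
    have := hfar i (Finset.mem_Icc.2 ⟨hi, h2⟩)
    rw [abs_of_neg (sub_neg.2 (hl' i hi h2 hij))] at this
    linarith
  · intro i hji hi
    have := hfar i (Finset.mem_Icc.2 ⟨hj'.1.trans hji, hi⟩)
    rw [abs_of_pos (sub_pos.2 (hr' i hji hi))] at this
    exact this.le
  · intro s hs
    have h2 := (hball (hin s (abs_le.2 hs))).2
    refine ContinuousAt.continuousWithinAt ?_
    exact (differentiableAt_weight h2).continuousAt.comp_of_eq (by fun_prop) rfl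
  · intro s hs
    simpa using (hball (hin s hs)).1

theorem IsChamber.splitPts {N : ℕ} {x : ℕ → ℝ} (hx : IsChamber N x) {j : ℕ}
    {ξ m C ε : ℝ} (hg : IsGap N x j ξ m C) (hε : ε ∈ Set.Ioo 0 m) :
    IsChamber (N + 1) (splitPts j ξ ε x) := by
  intro i k hi hik hk
  have hl := hg.left
  have hr := hg.right
  have hj := Finset.mem_Icc.1 hg.mem
  obtain ⟨h0, hm⟩ := hε
  unfold _root_.splitPts
  split_ifs with h1 h2 h3 h4 h5 h6 h7 h8 h9
  all_goals first
    | omega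
    | exact hx _ _ (by omega) (by omega) (by omega)
    | linarith
    | (have := hl i (by omega) (by omega); linarith)
    | (have := hr (k - 2) (by omega) (by omega); linarith)

/-- The limit of the moments of positive order over the `k`-th interval as `ε → 0`. -/
noncomputable def limPeriod (N : ℕ) (x : ℕ → ℝ) (ξ : ℝ) (j r k : ℕ) : ℝ :=
  if k + 1 < j then -period N x ξ r k
  else if k + 1 = j then -∫ s in (x k - ξ)..0, s ^ r * weight (2 * N) x (ξ + s)
  else if k = j then 0
  else if k = j + 1 then ∫ s in (0 : ℝ)..(x j - ξ), s ^ r * weight (2 * N) x (ξ + s)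
  else period N x ξ r (k - 2)

section Limits

variable {N : ℕ} {x : ℕ → ℝ} {j : ℕ} {ξ m C : ℝ}

theorem IsChamber.intervalIntegrable_weight_shift (hx : IsChamber N x) (ξ a b : ℝ) :
    IntervalIntegrable (fun s => weight (2 * N) x (ξ + s)) volume a b := by
  have := (hx.intervalIntegrable_weight (ξ + a) (ξ + b)).comp_add_left ξ
  simpa using this

theorem IsChamber.intervalIntegrable_pow_mul_weight_shift (hx : IsChamber N x) (ξ : ℝ) (r : ℕ)
    (a b : ℝ) :
    IntervalIntegrable (fun s => s ^ r * weight (2 * N) x (ξ + s)) volume a b :=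
  (hx.intervalIntegrable_weight_shift ξ a b).continuousOn_mul (by fun_prop)

theorem IsGap.left_mono (hg : IsGap N x j ξ m C) (hx : IsChamber N x) {k : ℕ} (hk : 1 ≤ k)
    (hkj : k + 1 < j) : ∀ s ∈ Set.uIoc (x k - ξ) (x (k + 1) - ξ), s ≤ -m := by
  have hj := Finset.mem_Icc.1 hg.mem
  intro s hs
  have h1 := hx k (k + 1) hk (by omega) (by omega)
  rw [Set.uIoc_of_le (by linarith)] at hs
  exact hs.2.trans (hg.left _ (by omega) hkj)

theorem IsGap.right_mono (hg : IsGap N x j ξ m C) (hx : IsChamber N x) {k : ℕ} (hjk : j ≤ k)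
    (hk : k + 1 ≤ 2 * N) : ∀ s ∈ Set.uIoc (x k - ξ) (x (k + 1) - ξ), m ≤ s := by
  have hj := Finset.mem_Icc.1 hg.mem
  intro s hs
  have h1 := hx k (k + 1) (by omega) (by omega) (by omega)
  rw [Set.uIoc_of_le (by linarith)] at hs
  exact (hg.right _ hjk (by omega)).trans hs.1.le

theorem IsGap.tendsto_far (hg : IsGap N x j ξ m C) (hx : IsChamber N x) (r : ℕ) {a b : ℝ}
    (h : ∀ s ∈ Set.uIoc a b, m ≤ |s|) :
    Tendsto (fun ε => ∫ s in a..b, s ^ r * weight (2 * N) x (ξ + s) * pairKernel ε s) (𝓝[>] 0)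
      (𝓝 (∫ s in a..b, s ^ r * weight (2 * N) x (ξ + s) * |s|⁻¹)) :=
  tendsto_integral_mul_pairKernel_far hg.pos
    (hx.intervalIntegrable_pow_mul_weight_shift ξ r a b) h

theorem period_splitPts_of_lt (hj : j ∈ Finset.Icc 1 (2 * N + 1)) (ξ ε : ℝ) (x : ℕ → ℝ) (r : ℕ)
    {k : ℕ} (h : k + 1 < j) :
    period (N + 1) (splitPts j ξ ε x) ξ r k =
      ∫ s in (x k - ξ)..(x (k + 1) - ξ), s ^ r * weight (2 * N) x (ξ + s) * pairKernel ε s := by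
  rw [period_splitPts hj, splitPts_of_lt _ _ _ h, splitPts_of_lt _ _ _ (by omega)]

theorem period_splitPts_left {k : ℕ} (hj : k + 1 ∈ Finset.Icc 1 (2 * N + 1)) (ξ ε : ℝ)
    (x : ℕ → ℝ) (r : ℕ) :
    period (N + 1) (splitPts (k + 1) ξ ε x) ξ r k = (-1) ^ r *
      ∫ s in ε..(ξ - x k), s ^ r * weight (2 * N) x (ξ - s) * pairKernel ε s := by
  rw [period_splitPts hj, splitPts_self, splitPts_of_lt _ _ _ (by omega),
    show x k - ξ = -(ξ - x k) by ring, show ξ - ε - ξ = -ε by ring,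
    ← intervalIntegral.integral_comp_neg, ← intervalIntegral.integral_const_mul]
  refine intervalIntegral.integral_congr fun s _ => ?_
  simp only [pairKernel_neg, ← sub_eq_add_neg]
  rw [neg_pow]
  ring

theorem period_splitPts_self (hj : j ∈ Finset.Icc 1 (2 * N + 1)) (ξ ε : ℝ) (x : ℕ → ℝ) (r : ℕ) :
    period (N + 1) (splitPts j ξ ε x) ξ r j =
      ∫ s in (-ε)..ε, s ^ r * weight (2 * N) x (ξ + s) * pairKernel ε s := by
  rw [period_splitPts hj, splitPts_self, splitPts_self_add_one]
  congr 1 <;> ring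

theorem period_splitPts_right (hj : j ∈ Finset.Icc 1 (2 * N + 1)) (ξ ε : ℝ) (x : ℕ → ℝ) (r : ℕ) :
    period (N + 1) (splitPts j ξ ε x) ξ r (j + 1) =
      ∫ s in ε..(x j - ξ), s ^ r * weight (2 * N) x (ξ + s) * pairKernel ε s := by
  rw [period_splitPts hj, splitPts_self_add_one, splitPts_add_two _ _ _ le_rfl, add_sub_cancel_left]

theorem period_splitPts_of_gt (hj : j ∈ Finset.Icc 1 (2 * N + 1)) (ξ ε : ℝ) (x : ℕ → ℝ) (r : ℕ)
    {k : ℕ} (h : j ≤ k) :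
    period (N + 1) (splitPts j ξ ε x) ξ r (k + 2) =
      ∫ s in (x k - ξ)..(x (k + 1) - ξ), s ^ r * weight (2 * N) x (ξ + s) * pairKernel ε s := by
  rw [period_splitPts hj, splitPts_add_two _ _ _ h, show k + 2 + 1 = (k + 1) + 2 by ring,
    splitPts_add_two _ _ _ (by omega)]

theorem IsGap.abs_period_self_le (hg : IsGap N x j ξ m C) (r : ℕ) :
    ∃ B, ∀ ε ∈ Set.Ioo 0 m,
      |period (N + 1) (_root_.splitPts j ξ ε x) ξ r j| ≤ ε ^ r * B * Real.pi := by
  obtain ⟨B, hB⟩ := isCompact_Icc.exists_bound_of_continuousOn hg.cont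
  refine ⟨B, fun ε hε => ?_⟩
  rw [period_splitPts_self hg.mem]
  exact norm_integral_pow_mul_pairKernel_le hε.1
    (fun s hs => hB s ⟨(neg_le_neg hε.2.le).trans hs.1, hs.2.trans hε.2.le⟩) r

theorem IsGap.cont_right (hg : IsGap N x j ξ m C) :
    ContinuousOn (fun s => weight (2 * N) x (ξ + s)) (Set.Icc 0 m) :=
  hg.cont.mono (Set.Icc_subset_Icc_left (by linarith [hg.pos]))

theorem IsGap.cont_left (hg : IsGap N x j ξ m C) :
    ContinuousOn (fun s => weight (2 * N) x (ξ - s)) (Set.Icc 0 m) := by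
  have := hg.cont.comp (s := Set.Icc 0 m) (f := fun s => -s) (by fun_prop) fun s hs =>
    ⟨neg_le_neg hs.2, by linarith [hs.1, hg.pos]⟩
  simpa only [Function.comp_def, ← sub_eq_add_neg] using this

theorem IsChamber.intervalIntegrable_weight_reflect (hx : IsChamber N x) (ξ a b : ℝ) :
    IntervalIntegrable (fun s => weight (2 * N) x (ξ - s)) volume a b := by
  have := (hx.intervalIntegrable_weight (ξ - a) (ξ - b)).comp_sub_left ξ
  simpa using this

theorem IsGap.tendsto_period_succ (hg : IsGap N x j ξ m C) (hx : IsChamber N x) (r : ℕ) {k : ℕ}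
    (hk : k ∈ Finset.Icc 1 (2 * N + 1)) :
    Tendsto (fun ε => period (N + 1) (_root_.splitPts j ξ ε x) ξ (r + 1) k) (𝓝[>] 0)
      (𝓝 (limPeriod N x ξ j r k)) := by
  have hj := Finset.mem_Icc.1 hg.mem
  rw [Finset.mem_Icc] at hk
  unfold limPeriod
  split_ifs with h1 h2 h3 h4
  · simp only [period_splitPts_of_lt hg.mem _ _ _ _ h1]
    have hs := hg.left_mono hx hk.1 h1
    convert hg.tendsto_far hx (r + 1) (fun s h => by
      rw [abs_of_neg (by linarith [hs s h, hg.pos])]; linarith [hs s h]) using 2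
    rw [period_eq_integral_shift, ← intervalIntegral.integral_neg]
    refine intervalIntegral.integral_congr_ae (Eventually.of_forall fun s h => ?_)
    have : s < 0 := by linarith [hs s h, hg.pos]
    simp only [abs_of_neg this]
    have := this.ne
    field_simp
    ring
  · subst h2
    simp only [period_splitPts_left hg.mem]
    have hm : m ≤ ξ - x k := by linarith [hg.left k hk.1 (by omega)]
    have h2 := (tendsto_integral_pow_mul_pairKernel hg.pos hm
      (hx.intervalIntegrable_weight_reflect ξ _ _) hg.cont_left r).const_mul ((-1) ^ (r + 1))
    convert h2 using 2
    rw [show x k - ξ = -(ξ - x k) by ring, show (0 : ℝ) = -0 by ring,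
      ← intervalIntegral.integral_comp_neg, ← intervalIntegral.integral_const_mul,
      ← intervalIntegral.integral_neg, neg_zero]
    refine intervalIntegral.integral_congr fun s _ => ?_
    simp only [← sub_eq_add_neg]
    rw [neg_pow]
    ring
  · subst h3
    obtain ⟨B, hB⟩ := hg.abs_period_self_le (r + 1)
    rw [tendsto_zero_iff_norm_tendsto_zero]
    refine squeeze_zero' (Eventually.of_forall fun _ => norm_nonneg _)
      (by filter_upwards [Ioo_mem_nhdsGT hg.pos] with ε hε using hB ε hε) ?_
    have : Continuous fun ε : ℝ => ε ^ (r + 1) * B * Real.pi := by fun_prop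
    simpa using (this.tendsto 0).mono_left nhdsWithin_le_nhds
  · subst h4
    simp only [period_splitPts_right hg.mem]
    exact tendsto_integral_pow_mul_pairKernel hg.pos (hg.right j le_rfl (by omega))
      (hx.intervalIntegrable_weight_shift ξ _ _) hg.cont_right r
  · obtain ⟨l, rfl⟩ : ∃ l, k = l + 2 := ⟨k - 2, by omega⟩
    simp only [period_splitPts_of_gt hg.mem _ _ _ _ (show j ≤ l by omega)]
    have hs := hg.right_mono hx (show j ≤ l by omega) (by omega)
    convert hg.tendsto_far hx (r + 1) (fun s h => (hs s h).trans (le_abs_self s)) using 2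
    rw [Nat.add_sub_cancel, period_eq_integral_shift]
    refine intervalIntegral.integral_congr_ae (Eventually.of_forall fun s h => ?_)
    have : 0 < s := by linarith [hs s h, hg.pos]
    simp only [abs_of_pos this]
    field_simp
    ring

theorem IsGap.tendsto_period_zero_div (hg : IsGap N x j ξ m C) (hx : IsChamber N x) {k : ℕ}
    (hk : k ∈ Finset.Icc 1 (2 * N + 1)) :
    Tendsto (fun ε => period (N + 1) (_root_.splitPts j ξ ε x) ξ 0 k /
      ∫ s in ε..m, pairKernel ε s) (𝓝[>] 0)
      (𝓝 (if k + 1 = j ∨ k = j + 1 then weight (2 * N) x ξ else 0)) := by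
  have hj := Finset.mem_Icc.1 hg.mem
  have hΛ := tendsto_integral_pairKernel_atTop hg.pos
  rw [Finset.mem_Icc] at hk
  rcases lt_trichotomy (k + 1) j with h1 | rfl | h1
  · rw [if_neg (by omega)]
    simp only [period_splitPts_of_lt hg.mem _ _ _ _ h1]
    have hs := hg.left_mono hx hk.1 h1
    exact (hg.tendsto_far hx 0 (fun s h => by
      rw [abs_of_neg (by linarith [hs s h, hg.pos])]; linarith [hs s h])).div_atTop hΛ
  · rw [if_pos (by omega)]
    simp only [period_splitPts_left hg.mem, pow_zero, one_mul]
    have hm : m ≤ ξ - x k := by linarith [hg.left k hk.1 (by omega)]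
    have := tendsto_integral_mul_pairKernel_div hg.pos hm (C := C)
      (hx.intervalIntegrable_weight_reflect ξ _ _) hg.cont_left (fun s hs => by
        have := hg.lipschitz (-s) (by rw [abs_neg, abs_of_nonneg hs.1]; exact hs.2)
        rw [abs_neg, abs_of_nonneg hs.1, ← sub_eq_add_neg] at this
        simpa using this)
    simpa using this
  rcases lt_trichotomy k (j + 1) with h2 | rfl | h2
  · obtain rfl : k = j := by omega
    rw [if_neg (by omega)]
    obtain ⟨B, hB⟩ := hg.abs_period_self_le 0
    rw [tendsto_zero_iff_norm_tendsto_zero]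
    refine squeeze_zero' (Eventually.of_forall fun _ => norm_nonneg _) ?_
      (tendsto_const_nhds (x := B * Real.pi) |>.div_atTop hΛ)
    filter_upwards [Ioo_mem_nhdsGT hg.pos, hΛ.eventually_gt_atTop 0] with ε hε hpos
    rw [norm_div, Real.norm_of_nonneg hpos.le]
    refine div_le_div_of_nonneg_right ?_ hpos.le
    simpa using hB ε hε
  · rw [if_pos (by omega)]
    simp only [period_splitPts_right hg.mem, pow_zero, one_mul]
    have := tendsto_integral_mul_pairKernel_div hg.pos (hg.right j le_rfl (by omega)) (C := C)
      (hx.intervalIntegrable_weight_shift ξ _ _) hg.cont_right (fun s hs => by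
        have := hg.lipschitz s (by rw [abs_of_nonneg hs.1]; exact hs.2)
        rw [abs_of_nonneg hs.1] at this
        simpa using this)
    simpa using this
  · obtain ⟨l, rfl⟩ : ∃ l, k = l + 2 := ⟨k - 2, by omega⟩
    rw [if_neg (by omega)]
    simp only [period_splitPts_of_gt hg.mem _ _ _ _ (show j ≤ l by omega)]
    have hs := hg.right_mono hx (show j ≤ l by omega) (by omega)
    exact (hg.tendsto_far hx 0 (fun s h => (hs s h).trans (le_abs_self s))).div_atTop hΛ

end Limits

theorem tendsto_form_sum_smul_siteVec {α : Type*} {l : Filter α} {N : ℕ}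
    (G : (ℕ →₀ ℂ) [⋀^Fin N]→ₗ[ℂ] ℂ) {s : Finset ℕ} {P : α → Fin N → ℕ → ℂ} {Q : Fin N → ℕ → ℂ}
    (h : ∀ r, ∀ k ∈ s, Tendsto (fun a => P a r k) l (𝓝 (Q r k))) :
    Tendsto (fun a => G (fun r => ∑ k ∈ s, P a r k • siteVec k)) l
      (𝓝 (G (fun r => ∑ k ∈ s, Q r k • siteVec k))) := by
  simp only [form_sum_smul_siteVec]
  refine tendsto_finsetSum _ fun t ht => Tendsto.mul_const _ (tendsto_finsetProd _ fun r _ => ?_)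
  exact h r _ (Fintype.mem_piFinset.1 ht r)

theorem sum_range_split {M : Type*} [AddCommMonoid M] (f : ℕ → M) {a n : ℕ} (h : a + 3 ≤ n) :
    ∑ k ∈ Finset.range n, f k = ∑ k ∈ Finset.range a, f k + (f a + f (a + 1) + f (a + 2)) +
      ∑ k ∈ Finset.Ico a (n - 3), f (k + 3) := by
  rw [Finset.sum_Ico_add', show n - 3 + 3 = n by omega,
    ← Finset.sum_range_add_sum_Ico f h, Finset.sum_range_succ, Finset.sum_range_succ,
    Finset.sum_range_succ]
  simp only [add_assoc]

theorem sum_Icc_eq_sum_range_of_eq_zero {M : Type*} [AddCommMonoid M] {f : ℕ → M} {n l : ℕ}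
    (hl : n < l) (h0 : f 0 = 0) (h : ∀ k, n < k → f k = 0) :
    ∑ k ∈ Finset.Icc 1 n, f k = ∑ k ∈ Finset.range l, f k := by
  refine Finset.sum_subset (fun k hk => ?_) fun k _ hk => ?_
  · rw [Finset.mem_Icc] at hk; rw [Finset.mem_range]; omega
  · rw [Finset.mem_Icc] at hk
    rcases Nat.eq_zero_or_pos k with rfl | hk0
    · exact h0
    · exact h k (by omega)

section Step

variable {N : ℕ} {x : ℕ → ℝ} {j : ℕ} {ξ m C : ℝ}

/-- The limit of the period vectors of positive order as `ε → 0`. -/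
noncomputable def limPeriodVec (N : ℕ) (x : ℕ → ℝ) (ξ : ℝ) (j r : ℕ) : ℕ →₀ ℂ :=
  ∑ k ∈ Finset.Icc 1 (2 * N + 1), (Complex.I ^ k * (limPeriod N x ξ j r k : ℂ)) • siteVec k

theorem IsGap.map_limPeriodVec (hg : IsGap N x j ξ m C) (hx : IsChamber N x) (r : ℕ)
    (φ : (ℕ →₀ ℂ) →ₗ[ℂ] ℂ) (hφ : ∀ k, k ∉ Finset.Icc 1 (2 * N + 1) → φ (siteVec k) = 0)
    (hφj : φ (siteVec (j - 1)) = φ (siteVec (j + 1))) :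
    φ (limPeriodVec N x ξ j r) = φ (-pinchEmb j (periodVec N x ξ r)) := by
  obtain ⟨a, rfl⟩ : ∃ a, j = a + 1 := ⟨j - 1, by have := Finset.mem_Icc.1 hg.mem; omega⟩
  have hj := Finset.mem_Icc.1 hg.mem
  have hzero : φ (siteVec 0) = 0 := hφ 0 (by simp)
  have hlarge : ∀ k, 2 * N + 1 < k → φ (siteVec k) = 0 := fun k hk =>
    hφ k (by rw [Finset.mem_Icc]; omega)
  rw [Nat.add_sub_cancel] at hφj
  rw [map_neg]
  unfold limPeriodVec periodVec
  simp only [map_sum, map_smul, smul_eq_mul]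
  have hE : ∀ k, φ (pinchEmb (a + 1) (siteVec k)) =
      if k < a + 1 then φ (siteVec k) else φ (siteVec (k + 2)) := by
    intro k
    split_ifs with h
    · rw [pinchEmb_siteVec_of_lt h]
    · rw [pinchEmb_siteVec_of_le (not_lt.1 h)]
  have hE' : ∀ k, 2 * N - 1 < k → φ (pinchEmb (a + 1) (siteVec k)) = 0 := by
    intro k hk
    rw [hE]
    split_ifs with h
    · obtain rfl : k = a := by omega
      rw [hφj]
      exact hlarge _ (by omega)
    · exact hlarge _ (by omega)
  rw [sum_Icc_eq_sum_range_of_eq_zero (l := 2 * N + 3) (by omega) (by rw [hzero, mul_zero])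
      (fun k hk => by rw [hlarge k hk, mul_zero]),
    sum_Icc_eq_sum_range_of_eq_zero (l := 2 * N + 1) (by omega)
      (by rw [hE, if_pos (by omega), hzero, mul_zero]) (fun k hk => by rw [hE' k hk, mul_zero]),
    sum_range_split _ (show a + 3 ≤ 2 * N + 3 by omega), Nat.add_sub_cancel,
    ← Finset.sum_range_add_sum_Ico _ (show a + 1 ≤ 2 * N + 1 by omega), Finset.sum_range_succ,
    ← Finset.sum_Ico_add', neg_add, neg_add]
  congr 1
  · congr 1
    · rw [← Finset.sum_neg_distrib]
      refine Finset.sum_congr rfl fun k hk => ?_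
      rw [Finset.mem_range] at hk
      rw [hE, if_pos (by omega), limPeriod, if_pos (by omega)]
      push_cast
      ring
    · rw [hE, if_pos (by omega)]
      by_cases ha : φ (siteVec a) = 0
      · rw [← hφj, ha]
        simp [limPeriod]
      · have ha0 : a ≠ 0 := by rintro rfl; exact ha hzero
        have haN : a + 2 ≤ 2 * N + 1 := by
          by_contra! h
          exact ha (hφj.trans (hlarge _ h))
        have hadd : period N x ξ r a =
            (∫ s in (x a - ξ)..0, s ^ r * weight (2 * N) x (ξ + s)) +
              ∫ s in (0 : ℝ)..(x (a + 1) - ξ), s ^ r * weight (2 * N) x (ξ + s) := by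
          rw [period_eq_integral_shift, intervalIntegral.integral_add_adjacent_intervals
            (hx.intervalIntegrable_pow_mul_weight_shift ξ r _ _)
            (hx.intervalIntegrable_pow_mul_weight_shift ξ r _ _)]
        rw [hadd, ← hφj]
        simp [limPeriod, pow_add]
        ring
  · rw [← Finset.sum_neg_distrib]
    refine Finset.sum_congr rfl fun k hk => ?_
    rw [Finset.mem_Ico] at hk
    rw [hE, if_neg (by omega), limPeriod, if_neg (by omega), if_neg (by omega), if_neg (by omega),
      if_neg (by omega), show k + 3 - 2 = k + 1 by omega, show k + 3 = k + 1 + 2 by ring,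
      pow_add Complex.I (k + 1) 2, Complex.I_sq]
    ring

theorem IsPrimitiveForm.map_vecCons_limit {G : (ℕ →₀ ℂ) [⋀^Fin (N + 1)]→ₗ[ℂ] ℂ}
    (hG : IsPrimitiveForm (N + 1) G) (hj : j ∈ Finset.Icc 1 (2 * N + 1)) (c : ℂ)
    (w : Fin N → ℕ →₀ ℂ) :
    G (Fin.cons (∑ k ∈ Finset.Icc 1 (2 * N + 1),
      (Complex.I ^ k * if k + 1 = j ∨ k = j + 1 then c else 0) • siteVec k) w) =
      Complex.I ^ (j - 1) * c * G.curryLeft (siteVec (j - 1) - siteVec (j + 1)) w := by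
  obtain ⟨a, rfl⟩ : ∃ a, j = a + 1 := ⟨j - 1, by have := Finset.mem_Icc.1 hj; omega⟩
  rw [Finset.mem_Icc] at hj
  obtain ⟨ψ, hψ⟩ : ∃ ψ : (ℕ →₀ ℂ) →ₗ[ℂ] ℂ, ∀ v, ψ v = G (Fin.cons v w) :=
    ⟨G.toMultilinearMap.toLinearMap (Fin.cons 0 w) 0, fun v => by simp [Fin.update_cons_zero]⟩
  have hz : ∀ k, k ∉ Finset.Icc 1 (2 * N + 1) → ψ (siteVec k) = 0 := by
    intro k hk
    have := hG.support (Fin.cons 0 w) 0 k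
      (by rwa [show 2 * (N + 1) - 1 = 2 * N + 1 by omega])
    rwa [Fin.update_cons_zero, ← hψ] at this
  have h1 : ∀ v, G.curryLeft v w = ψ v := fun v => (hψ v).symm
  rw [h1, ← hψ]
  simp only [map_sum, map_smul, map_sub, smul_eq_mul]
  rw [sum_Icc_eq_sum_range_of_eq_zero (l := 2 * N + 3) (by omega)
      (by rw [hz 0 (by simp), mul_zero])
      (fun k hk => by rw [hz k (by rw [Finset.mem_Icc]; omega), mul_zero]),
    sum_range_split _ (show a + 3 ≤ 2 * N + 3 by omega), Finset.sum_eq_zero, Finset.sum_eq_zero]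
  · simp [pow_add]
    ring
  · intro k hk
    rw [Finset.mem_Ico] at hk
    rw [if_neg (by omega), mul_zero, zero_mul]
  · intro k hk
    rw [Finset.mem_range] at hk
    rw [if_neg (by omega), mul_zero, zero_mul]

theorem IsPrimitiveForm.vanishesOnPeriods_pinchForm {G : (ℕ →₀ ℂ) [⋀^Fin (N + 1)]→ₗ[ℂ] ℂ}
    (hG : IsPrimitiveForm (N + 1) G) (hv : VanishesOnPeriods (N + 1) G)
    (hj : j ∈ Finset.Icc 1 (2 * N + 1)) : VanishesOnPeriods N (_root_.pinchForm j G) := by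
  refine vanishesOnPeriods_of_exists_centre fun x hx => ?_
  obtain ⟨ξ, m, C, hg⟩ := hx.exists_isGap hj
  refine ⟨ξ, ?_⟩
  let P : ℝ → Fin (N + 1) → ℕ → ℂ := fun ε => Fin.cons
    (fun k => Complex.I ^ k * ((period (N + 1) (splitPts j ξ ε x) ξ 0 k /
      ∫ s in ε..m, pairKernel ε s : ℝ) : ℂ))
    fun r k => Complex.I ^ k * (period (N + 1) (splitPts j ξ ε x) ξ (r + 1) k : ℂ)
  let Q : Fin (N + 1) → ℕ → ℂ := Fin.cons
    (fun k => Complex.I ^ k * ((if k + 1 = j ∨ k = j + 1 then weight (2 * N) x ξ else 0 : ℝ) : ℂ))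
    fun r k => Complex.I ^ k * (limPeriod N x ξ j r k : ℂ)
  have hlim := tendsto_form_sum_smul_siteVec (l := 𝓝[>] (0 : ℝ)) G
    (s := Finset.Icc 1 (2 * N + 1)) (P := P) (Q := Q) (by
      intro r k hk
      refine Fin.cases ?_ (fun r => ?_) r
      · exact (Complex.continuous_ofReal.tendsto _).comp
          (hg.tendsto_period_zero_div hx hk) |>.const_mul _
      · exact (Complex.continuous_ofReal.tendsto _).comp
          (hg.tendsto_period_succ hx r hk) |>.const_mul _)
  have hzero : ∀ᶠ ε in 𝓝[>] (0 : ℝ),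
      G (fun r => ∑ k ∈ Finset.Icc 1 (2 * N + 1), P ε r k • siteVec k) = 0 := by
    filter_upwards [Ioo_mem_nhdsGT hg.pos] with ε hε
    have h1 := hv _ (hx.splitPts hg hε) ξ
    unfold periodVec at h1
    rw [form_sum_smul_siteVec, show 2 * (N + 1) - 1 = 2 * N + 1 by omega] at h1
    rw [form_sum_smul_siteVec]
    have h2 : ∀ t : Fin (N + 1) → ℕ, ∏ r, P ε r (t r) =
        ((∫ s in ε..m, pairKernel ε s : ℝ) : ℂ)⁻¹ * ∏ r : Fin (N + 1), (Complex.I ^ t r *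
          (period (N + 1) (splitPts j ξ ε x) ξ r (t r) : ℂ)) := by
      intro t
      rw [Fin.prod_univ_succ, Fin.prod_univ_succ]
      simp only [P, Fin.cons_zero, Fin.cons_succ, Fin.val_zero, Fin.val_succ]
      push_cast
      ring
    simp only [h2, mul_assoc, ← Finset.mul_sum]
    rw [h1, mul_zero]
  have h3 := tendsto_nhds_unique hlim (tendsto_const_nhds.congr' (hzero.mono fun _ h => h.symm))
  have h4 : (fun r => ∑ k ∈ Finset.Icc 1 (2 * N + 1), Q r k • siteVec k) =
      Fin.cons (∑ k ∈ Finset.Icc 1 (2 * N + 1), (Complex.I ^ k *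
        if k + 1 = j ∨ k = j + 1 then (weight (2 * N) x ξ : ℂ) else 0) • siteVec k)
        fun r : Fin N => limPeriodVec N x ξ j r := by
    funext r
    refine Fin.cases ?_ (fun r => ?_) r
    · simp only [Q, Fin.cons_zero]
      refine Finset.sum_congr rfl fun k _ => ?_
      split_ifs <;> simp
    · simp only [Q, Fin.cons_succ]
      rfl
  rw [h4, hG.map_vecCons_limit hj] at h3
  have h5 : G.curryLeft (siteVec (j - 1) - siteVec (j + 1))
      (fun r : Fin N => limPeriodVec N x ξ j r) = 0 := by
    refine (mul_eq_zero.1 h3).resolve_left (mul_ne_zero (pow_ne_zero _ Complex.I_ne_zero) ?_)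
    exact Complex.ofReal_ne_zero.2 hg.weight_pos.ne'
  have h6 := MultilinearMap.congr_of_update
    (G.curryLeft (siteVec (j - 1) - siteVec (j + 1))).toMultilinearMap
    (fun r : Fin N => limPeriodVec N x ξ j r)
    (fun r : Fin N => (-1 : ℂ) • pinchEmb j (periodVec N x ξ r)) (by
      intro p u
      simp only [neg_smul, one_smul]
      exact hg.map_limPeriodVec hx p
        ((G.curryLeft (siteVec (j - 1) - siteVec (j + 1))).toMultilinearMap.toLinearMap u p)
        (fun k hk => hG.curryLeft_support _ u p k hk) (curryLeft_update_eq j G u p))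
  rw [MultilinearMap.map_smul_univ] at h6
  have h7 := h6.symm.trans h5
  refine (mul_eq_zero.1 h7).resolve_left ?_
  exact Finset.prod_ne_zero_iff.2 fun _ _ => by norm_num

end Step

theorem IsPrimitiveForm.eq_zero_of_vanishesOnPeriods {N : ℕ} (hN : 1 ≤ N)
    {G : (ℕ →₀ ℂ) [⋀^Fin N]→ₗ[ℂ] ℂ} (hG : IsPrimitiveForm N G) (hv : VanishesOnPeriods N G) :
    G = 0 := by
  induction N, hN using Nat.le_induction with
  | base =>
    have hx : IsChamber 1 fun i => (i : ℝ) := fun i k _ hik _ => Nat.cast_lt.2 hik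
    have h1 := hv _ hx 0
    have hpos : 0 < period 1 (fun i => (i : ℝ)) 0 0 1 := by
      unfold period
      have hlt : ((1 : ℕ) : ℝ) < ((1 + 1 : ℕ) : ℝ) := by norm_num
      refine intervalIntegral.intervalIntegral_pos_of_pos_on
        (hx.intervalIntegrable_pow_mul_weight 0 0 _ _) (fun u hu => ?_) hlt
      rw [pow_zero, one_mul]
      refine weight_pos fun i hi => ?_
      have : i = 1 ∨ i = 2 := by rw [Finset.mem_Icc] at hi; omega
      rcases this with rfl | rfl
      · exact hu.1.ne'
      · exact hu.2.ne
    unfold periodVec at h1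
    rw [form_sum_smul_siteVec] at h1
    have hcoeff : formCoeff G (fun _ => 1) = 0 := by
      simp [Fintype.piFinset_singleton] at h1
      exact h1.resolve_left hpos.ne'
    refine form_eq_zero_of_formCoeff fun t => ?_
    by_cases ht : t = fun _ => 1
    · rw [ht, hcoeff]
    · refine hG.formCoeff_eq_zero t (i := 0) fun h => ht ?_
      funext i
      rw [Subsingleton.elim i 0]
      rw [Finset.mem_Icc] at h
      omega
  | succ N hN ih =>
    exact HopInvariant.eq_zero (by omega) hG (hopInvariant_of_pinchForm_eq_zero fun j hj =>
      ih (hG.pinchForm hj) (hG.vanishesOnPeriods_pinchForm hv hj))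

namespace LinkPattern

variable {N : ℕ} (β : LinkPattern N)

theorem a_ne_b (r s : Fin N) : β.a r ≠ β.b s := fun h => by
  have := @β.inj (r, false) (s, true) (by simpa using h)
  simp at this

theorem b_injective : Function.Injective β.b := fun r s h => by
  have := @β.inj (r, true) (s, true) (by simpa using h)
  simpa using this

theorem one_le_a (r : Fin N) : 1 ≤ β.a r :=
  ((β.cover (β.a r)).1 ⟨(r, false), by simp⟩).1

theorem b_le (r : Fin N) : β.b r ≤ 2 * N :=
  ((β.cover (β.b r)).1 ⟨(r, true), by simp⟩).2

theorem not_b_lt_b_of_a_eq {β γ : LinkPattern N} (h : β.a = γ.a) {r : Fin N}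
    (ih : ∀ s, r < s → β.b s = γ.b s) : ¬ β.b r < γ.b r := by
  intro hlt
  obtain ⟨⟨t, c⟩, ht⟩ := (γ.cover (β.b r)).2
    ⟨(β.one_le_a r).trans (β.a_lt_b r).le, β.b_le r⟩
  cases c
  · simp only [Bool.false_eq_true, if_false, ← h] at ht
    exact β.a_ne_b t r ht
  · simp only [if_true] at ht
    rcases lt_trichotomy r t with hrt | rfl | hrt
    · exact hrt.ne' (β.b_injective ((ih t hrt).trans ht))
    · omega
    · have h1 := γ.a_mono hrt
      have h2 := β.a_lt_b r
      rw [congrFun h r] at h2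
      exact γ.noncross t r ⟨h1, by omega, by omega⟩

theorem a_injective : Function.Injective (LinkPattern.a : LinkPattern N → Fin N → ℕ) := by
  intro β γ h
  have hb : ∀ r, β.b r = γ.b r := by
    intro r
    induction r using WellFoundedGT.induction with
    | ind r ih =>
      exact le_antisymm (not_lt.1 (not_b_lt_b_of_a_eq h.symm fun s hs => (ih s hs).symm))
        (not_lt.1 (not_b_lt_b_of_a_eq h ih))
  cases β
  cases γ
  simp only [LinkPattern.mk.injEq]
  exact ⟨h, funext hb⟩

instance : Finite (LinkPattern N) :=
  Finite.of_injective
    (fun β r => (⟨β.a r, by have := β.a_lt_b r; have := β.b_le r; omega⟩ : Fin (2 * N + 1)))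
    fun β γ h => a_injective (funext fun r => by simpa using congrFun h r)

/-- The sums of the coordinates over the intervals covered by the links. -/
noncomputable def arcSum : (ℕ →₀ ℂ) →ₗ[ℂ] Fin N → ℂ :=
  LinearMap.pi fun r => ∑ k ∈ Finset.Ico (β.a r) (β.b r), Finsupp.lapply k

/-- The wedge product of the functionals attached to the links. -/
noncomputable def form : (ℕ →₀ ℂ) [⋀^Fin N]→ₗ[ℂ] ℂ :=
  (Matrix.detRowAlternating (n := Fin N) (R := ℂ)).compLinearMap β.arcSum

theorem arcSum_siteVec (k : ℕ) (r : Fin N) :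
    β.arcSum (siteVec k) r = if β.a r ≤ k ∧ k < β.b r then 1 else 0 := by
  simp [arcSum, Finsupp.single_apply]

theorem formCoeff_form (t : Fin N → ℕ) :
    formCoeff β.form t = ∑ σ : Equiv.Perm (Fin N), ((Equiv.Perm.sign σ : ℤ) : ℂ) *
      ∏ r, if β.a r ≤ t (σ r) ∧ t (σ r) < β.b r then (1 : ℂ) else 0 := by
  have h : formCoeff β.form t =
      Matrix.det (Matrix.of fun i r => β.arcSum (siteVec (t i)) r) := rfl
  rw [h, Matrix.det_apply']
  simp only [Matrix.of_apply, arcSum_siteVec]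

theorem linkCoeff_eq (k : Fin N → ℕ) :
    linkCoeff N β k =
      Complex.I ^ (∑ r, k r) * ((Complex.I ^ ∑ r, β.a r)⁻¹ * formCoeff β.form k) := by
  rw [linkCoeff, formCoeff_form, zpow_sub₀ Complex.I_ne_zero, div_eq_mul_inv, mul_assoc,
    ← Nat.cast_sum, ← Nat.cast_sum, zpow_natCast, zpow_natCast]

theorem card_arc_overlap_comm (r s : Fin N) :
    ((Finset.range (2 * N)).filter fun j =>
        (β.a r ≤ j ∧ j < β.b r) ∧ β.a s ≤ j + 1 ∧ j + 1 < β.b s).card =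
      ((Finset.range (2 * N)).filter fun j =>
        (β.a s ≤ j ∧ j < β.b s) ∧ β.a r ≤ j + 1 ∧ j + 1 < β.b r).card := by
  wlog hrs : r < s generalizing r s
  · rcases (not_lt.1 hrs).eq_or_lt with rfl | h
    · rfl
    · exact (this s r h).symm
  have h1 := β.a_mono hrs
  have h2 := β.noncross r s
  have h3 := β.a_ne_b s r
  have h4 := β.b_injective.ne hrs.ne
  have h5 := β.one_le_a s
  have h6 := β.b_le r
  have h7 := β.a_lt_b s
  rcases lt_or_gt_of_ne h3 with h | h
  · have e1 : ((Finset.range (2 * N)).filter fun j =>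
        (β.a r ≤ j ∧ j < β.b r) ∧ β.a s ≤ j + 1 ∧ j + 1 < β.b s) =
        Finset.Ico (β.a s - 1) (β.b s - 1) := by
      ext j
      simp only [Finset.mem_filter, Finset.mem_range, Finset.mem_Ico]
      omega
    have e2 : ((Finset.range (2 * N)).filter fun j =>
        (β.a s ≤ j ∧ j < β.b s) ∧ β.a r ≤ j + 1 ∧ j + 1 < β.b r) =
        Finset.Ico (β.a s) (β.b s) := by
      ext j
      simp only [Finset.mem_filter, Finset.mem_range, Finset.mem_Ico]
      omega
    rw [e1, e2, Nat.card_Ico, Nat.card_Ico]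
    omega
  · congr 1
    ext j
    simp only [Finset.mem_filter, Finset.mem_range]
    omega

end LinkPattern

theorem AlternatingMap.sum_map_update_eq_zero {R ι κ : Type*} [CommRing R] [NoZeroDivisors R]
    [CharZero R] [Fintype ι] [DecidableEq ι] (f : (ι → R) [⋀^ι]→ₗ[R] R) (w : ι → ι → R)
    {p q : ι} (hpq : p ≠ q) (s : Finset κ) (v v' : κ → ι → R)
    (h : ∀ i i', ∑ j ∈ s, v j i * v' j i' = ∑ j ∈ s, v j i' * v' j i) :
    ∑ j ∈ s, f (Function.update (Function.update w p (v j)) q (v' j)) = 0 := by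
  set B : ι → ι → R := fun i i' =>
    f (Function.update (Function.update w p (Pi.single i 1)) q (Pi.single i' 1)) with hB
  have hanti : ∀ i i', B i' i = -B i i' := by
    intro i i'
    rw [hB]
    simp only
    rw [← f.map_swap _ hpq]
    congr 1
    funext l
    rcases eq_or_ne l p with rfl | hp
    · simp [hpq]
    · rcases eq_or_ne l q with rfl | hq
      · simp [hpq]
      · simp [Equiv.swap_apply_of_ne_of_ne hp hq, hp, hq]
  have hexp : ∀ u : ι → R, u = ∑ i, u i • (Pi.single i (1 : R) : ι → R) := fun u => by
    funext l
    simp [Finset.sum_apply, Pi.single_apply]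
  have hval : ∀ u u' : ι → R, f (Function.update (Function.update w p u) q u') =
      ∑ i, ∑ i', u i * u' i' * B i i' := by
    intro u u'
    conv_lhs => rw [Function.update_comm hpq, hexp u]
    rw [f.map_update_sum]
    refine Finset.sum_congr rfl fun i _ => ?_
    rw [f.map_update_smul, ← Function.update_comm hpq]
    conv_lhs => rw [hexp u']
    rw [f.map_update_sum, Finset.smul_sum]
    refine Finset.sum_congr rfl fun i' _ => ?_
    rw [f.map_update_smul]
    simp only [smul_eq_mul, hB, mul_assoc]
  have hsum : ∑ j ∈ s, f (Function.update (Function.update w p (v j)) q (v' j)) =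
      ∑ i, ∑ i', (∑ j ∈ s, v j i * v' j i') * B i i' := by
    simp only [hval, Finset.sum_mul]
    rw [Finset.sum_comm]
    exact Finset.sum_congr rfl fun i _ => Finset.sum_comm
  have hself : ∑ i, ∑ i', (∑ j ∈ s, v j i * v' j i') * B i i' =
      -∑ i, ∑ i', (∑ j ∈ s, v j i * v' j i') * B i i' := by
    conv_lhs => rw [Finset.sum_comm]
    simp only [← Finset.sum_neg_distrib]
    refine Finset.sum_congr rfl fun i _ => Finset.sum_congr rfl fun i' _ => ?_
    rw [hanti, h i' i, mul_neg]
  rw [hsum]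
  exact self_eq_neg.1 hself

theorem AlternatingMap.finset_sum_apply {R ι κ M P : Type*} [CommSemiring R] [AddCommMonoid M]
    [AddCommMonoid P] [Module R M] [Module R P] (s : Finset κ) (f : κ → M [⋀^ι]→ₗ[R] P)
    (u : ι → M) : (∑ i ∈ s, f i) u = ∑ i ∈ s, f i u := by
  classical
  induction s using Finset.induction_on with
  | empty => simp
  | insert a s ha ih => rw [Finset.sum_insert ha, Finset.sum_insert ha, add_apply, ih]

theorem LinkPattern.isPrimitiveForm_form {N : ℕ} (β : LinkPattern N) :
    IsPrimitiveForm N β.form where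
  support u i k hk := by
    have h0 : β.arcSum (siteVec k) = 0 := by
      funext r
      rw [β.arcSum_siteVec, if_neg, Pi.zero_apply]
      intro h
      have h1 := β.one_le_a r
      have h2 := β.b_le r
      rw [Finset.mem_Icc] at hk
      omega
    refine (Matrix.detRowAlternating (n := Fin N) (R := ℂ)).map_coord_zero i ?_
    simp [h0]
  contract u p q hpq := by
    have h : ∀ j, β.form (Function.update (Function.update u p (siteVec j)) q (siteVec (j + 1))) =
        (Matrix.detRowAlternating (n := Fin N) (R := ℂ))
          (Function.update (Function.update (fun l => β.arcSum (u l)) p (β.arcSum (siteVec j))) q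
            (β.arcSum (siteVec (j + 1)))) := by
      intro j
      change (Matrix.detRowAlternating (n := Fin N) (R := ℂ)) (fun l => β.arcSum _) = _
      congr 1
      funext l
      simp only [Function.update_apply]
      split_ifs <;> rfl
    rw [Finset.sum_congr rfl fun j _ => h j]
    refine AlternatingMap.sum_map_update_eq_zero _ _ hpq _ _ _ fun r s => ?_
    simp only [β.arcSum_siteVec, ite_zero_mul_ite_zero, mul_one, Finset.sum_boole]
    exact_mod_cast β.card_arc_overlap_comm r s

theorem IsPrimitiveForm.sum_smul {N : ℕ} {ι : Type*} (s : Finset ι) (c : ι → ℂ)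
    {G : ι → (ℕ →₀ ℂ) [⋀^Fin N]→ₗ[ℂ] ℂ} (hG : ∀ i, IsPrimitiveForm N (G i)) :
    IsPrimitiveForm N (∑ i ∈ s, c i • G i) where
  support u i k hk := by
    rw [AlternatingMap.finset_sum_apply]
    exact Finset.sum_eq_zero fun l _ => by
      rw [AlternatingMap.smul_apply, (hG l).support u i k hk, smul_zero]
  contract u p q hpq := by
    simp only [AlternatingMap.finset_sum_apply, AlternatingMap.smul_apply]
    rw [Finset.sum_comm]
    exact Finset.sum_eq_zero fun l _ => by
      rw [← Finset.smul_sum, (hG l).contract u p q hpq, smul_zero]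

theorem formCoeff_sum_smul {N : ℕ} {ι : Type*} (s : Finset ι) (c : ι → ℂ)
    (G : ι → (ℕ →₀ ℂ) [⋀^Fin N]→ₗ[ℂ] ℂ) (t : Fin N → ℕ) :
    formCoeff (∑ i ∈ s, c i • G i) t = ∑ i ∈ s, c i * formCoeff (G i) t := by
  simp [formCoeff, AlternatingMap.finset_sum_apply]

theorem LinkPattern.perm_eq_one_of_le {N : ℕ} {β γ : LinkPattern N}
    (hle : ∑ r, γ.a r ≤ ∑ r, β.a r) {σ : Equiv.Perm (Fin N)}
    (h : ∀ r, β.a r ≤ γ.a (σ r)) : β = γ ∧ σ = 1 := by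
  have hsum : ∑ r, γ.a (σ r) = ∑ r, γ.a r := Equiv.sum_comp σ γ.a
  have heq : ∀ r, β.a r = γ.a (σ r) := by
    have := (Finset.sum_eq_sum_iff_of_le fun r (_ : r ∈ Finset.univ) => h r).1
      (le_antisymm (Finset.sum_le_sum fun r _ => h r) (hsum.trans_le hle))
    exact fun r => this r (Finset.mem_univ r)
  have hσ : StrictMono σ := fun r s hrs =>
    γ.a_mono.lt_iff_lt.1 (by rw [← heq, ← heq]; exact β.a_mono hrs)
  have hσ1 : σ = 1 := by
    ext r
    have := Subsingleton.elim (hσ.orderIsoOfSurjective σ σ.surjective) (OrderIso.refl (Fin N))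
    simpa using congrArg (fun e : Fin N ≃o Fin N => (e r : ℕ)) this
  subst hσ1
  exact ⟨a_injective (funext fun r => by simpa using heq r), rfl⟩

theorem LinkPattern.formCoeff_form_self {N : ℕ} (β : LinkPattern N) :
    formCoeff β.form β.a = 1 := by
  rw [formCoeff_form, Finset.sum_eq_single 1]
  · simp [β.a_lt_b]
  · intro σ _ hσ
    by_contra hne
    refine hσ (perm_eq_one_of_le (β := β) (γ := β) le_rfl fun r => ?_).2
    have := Finset.prod_ne_zero_iff.1 (right_ne_zero_of_mul hne) r (Finset.mem_univ r)
    rw [ne_eq, ite_eq_right_iff, Classical.not_imp] at this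
    exact this.1.1
  · simp

theorem LinkPattern.formCoeff_form_eq_zero {N : ℕ} {β γ : LinkPattern N}
    (hle : ∑ r, γ.a r ≤ ∑ r, β.a r) (hne : β ≠ γ) : formCoeff β.form γ.a = 0 := by
  rw [formCoeff_form]
  refine Finset.sum_eq_zero fun σ _ => ?_
  by_contra h0
  refine hne (perm_eq_one_of_le (σ := σ) hle fun r => ?_).1
  have := Finset.prod_ne_zero_iff.1 (right_ne_zero_of_mul h0) r (Finset.mem_univ r)
  rw [ne_eq, ite_eq_right_iff, Classical.not_imp] at this
  exact this.1.1

theorem LinkPattern.linearIndependent_form (N : ℕ) :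
    LinearIndependent ℂ (LinkPattern.form : LinkPattern N → (ℕ →₀ ℂ) [⋀^Fin N]→ₗ[ℂ] ℂ) := by
  have := Fintype.ofFinite (LinkPattern N)
  rw [Fintype.linearIndependent_iff]
  intro c hc
  by_contra! hne
  obtain ⟨γ, hγ, hmin⟩ := Finset.exists_min_image (Finset.univ.filter fun β => c β ≠ 0)
    (fun β : LinkPattern N => ∑ r, β.a r) (by obtain ⟨β, hβ⟩ := hne; exact ⟨β, by simp [hβ]⟩)
  simp only [Finset.mem_filter, Finset.mem_univ, true_and] at hγ hmin
  have h1 := formCoeff_sum_smul Finset.univ c LinkPattern.form γ.a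
  rw [hc, Finset.sum_eq_single γ, γ.formCoeff_form_self, mul_one] at h1
  · exact hγ h1.symm
  · intro β _ hβ
    by_cases h0 : c β = 0
    · rw [h0, zero_mul]
    · rw [formCoeff_form_eq_zero (hmin β h0) hβ, mul_zero]
  · simp

/-- **Linear independence of the Coulomb gas integrals** `{F_β : β ∈ LP_N}` over `ℂ`. -/
theorem coulomb_linearIndependent (N : ℕ) (hN : 1 ≤ N) (lam : LinkPattern N → ℂ)
    (h : ∀ x : ℕ → ℝ, IsChamber N x → ∑ᶠ β : LinkPattern N, lam β * coulomb N β x = 0) :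
    ∀ β : LinkPattern N, lam β = 0 := by
  have := Fintype.ofFinite (LinkPattern N)
  set c : LinkPattern N → ℂ := fun β => lam β * (Complex.I ^ ∑ r, β.a r)⁻¹ with hc
  have hv : VanishesOnPeriods N (∑ β, c β • β.form) := by
    intro x hx ξ
    have h1 := h x hx
    rw [finsum_eq_sum_of_fintype] at h1
    refine (mul_eq_zero.1 (?_ : _ * _ = (0 : ℂ))).resolve_left
      (Complex.ofReal_ne_zero.2 hx.prefactor_pos.ne')
    rw [form_periodVec hx, ← h1]
    simp only [coulomb, Finset.mul_sum, LinkPattern.linkCoeff_eq, formCoeff_sum_smul,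
      Finset.sum_mul]
    rw [Finset.sum_comm]
    refine Finset.sum_congr rfl fun β _ => Finset.sum_congr rfl fun k _ => ?_
    rw [hc]
    ring
  have h0 := (IsPrimitiveForm.sum_smul Finset.univ c
    fun β : LinkPattern N => β.isPrimitiveForm_form).eq_zero_of_vanishesOnPeriods hN hv
  intro β
  have hβ := Fintype.linearIndependent_iff.1 (LinkPattern.linearIndependent_form N) c h0 β
  exact (mul_eq_zero.1 hβ).resolve_right (inv_ne_zero (pow_ne_zero _ Complex.I_ne_zero))
end

section
/- For N = 2 and real numbers x_1 < x_2 < x_3 < x_4, set z = ((x_2 − x_1)(x_4 − x_3))/((x_3 − x_1)(x_4 − x_2)); then 0 < z < 1 and the Coulomb gas integrals of the two planar link patterns of size 2 satisfy F_{{{1,2},{3,4}}}(x_1,x_2,x_3,x_4) = π²·(x_4 − x_1)^{1/4}·(x_3 − x_2)^{1/4}·z^{1/4}·G(z) and F_{{{1,4},{2,3}}}(x_1,x_2,x_3,x_4) = π²·(x_2 − x_1)^{1/4}·(x_4 − x_3)^{1/4}·(1 − z)^{1/4}·G(1 − z), where G(w) := Σ_{n=0}^{∞} (binom(2n,n)·4^{−n})²·wⁿ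 for |w| < 1 is the Gauss hypergeometric function ₂F₁(1/2, 1/2, 1; w). -/
open MeasureTheory

/-- The Gauss hypergeometric function `₂F₁(1/2, 1/2, 1; w) = Σ_n (binom(2n,n) 4^{−n})² wⁿ`. -/
noncomputable def gaussHyp (w : ℝ) : ℝ :=
  ∑' n : ℕ, ((Nat.choose (2 * n) n : ℝ) / 4 ^ n) ^ 2 * w ^ n

/-- The function `|y|^{-1/2}`. -/
noncomputable def invSqrtAbs (y : ℝ) : ℝ := |y| ^ (-(2 : ℝ)⁻¹)

theorem invSqrtAbs_of_pos {y : ℝ} (hy : 0 < y) : invSqrtAbs y = y ^ (-(2 : ℝ)⁻¹) := by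
  rw [invSqrtAbs, abs_of_pos hy]

theorem invSqrtAbs_nonneg (y : ℝ) : 0 ≤ invSqrtAbs y := Real.rpow_nonneg (abs_nonneg y) _

theorem invSqrtAbs_pos {y : ℝ} (hy : y ≠ 0) : 0 < invSqrtAbs y :=
  Real.rpow_pos_of_pos (abs_pos.2 hy) _

theorem invSqrtAbs_mul (y y' : ℝ) : invSqrtAbs (y * y') = invSqrtAbs y * invSqrtAbs y' := by
  rw [invSqrtAbs, abs_mul, Real.mul_rpow (abs_nonneg _) (abs_nonneg _)]; rfl

theorem invSqrtAbs_div (y y' : ℝ) : invSqrtAbs (y / y') = invSqrtAbs y / invSqrtAbs y' := by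
  rw [invSqrtAbs, abs_div, Real.div_rpow (abs_nonneg _) (abs_nonneg _)]; rfl

theorem invSqrtAbs_sub_comm (y y' : ℝ) : invSqrtAbs (y - y') = invSqrtAbs (y' - y) := by
  rw [invSqrtAbs, abs_sub_comm]; rfl

theorem invSqrtAbs_mul_self {y : ℝ} (hy : y ≠ 0) : invSqrtAbs y * invSqrtAbs y = |y|⁻¹ := by
  rw [invSqrtAbs, ← Real.rpow_add (abs_pos.2 hy), ← Real.rpow_neg_one]
  norm_num [Real.rpow_neg_one]

@[fun_prop]
theorem measurable_invSqrtAbs : Measurable invSqrtAbs := by unfold invSqrtAbs; fun_prop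

/-- The normalised central binomial coefficient `binom(2n,n) / 4ⁿ`. -/
noncomputable def normBinom (n : ℕ) : ℝ := (Nat.choose (2 * n) n : ℝ) / 4 ^ n

theorem normBinom_zero : normBinom 0 = 1 := by simp [normBinom]

theorem normBinom_nonneg (n : ℕ) : 0 ≤ normBinom n := by unfold normBinom; positivity

theorem normBinom_succ (n : ℕ) :
    ((n : ℝ) + 1) * normBinom (n + 1) = (n + 1 / 2) * normBinom n := by
  have h := Nat.succ_mul_centralBinom_succ n
  rw [Nat.centralBinom_eq_two_mul_choose, Nat.centralBinom_eq_two_mul_choose] at h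
  have h' : ((n : ℝ) + 1) * (Nat.choose (2 * (n + 1)) (n + 1) : ℝ)
      = 2 * (2 * n + 1) * (Nat.choose (2 * n) n : ℝ) := by exact_mod_cast h
  unfold normBinom
  rw [pow_succ]
  field_simp
  linarith

theorem normBinom_le_one (n : ℕ) : normBinom n ≤ 1 := by
  unfold normBinom
  rw [div_le_one (by positivity)]
  have := Nat.centralBinom_le_four_pow n
  rw [Nat.centralBinom_eq_two_mul_choose] at this
  exact_mod_cast this

theorem ringChoose_half (n : ℕ) : Ring.choose ((2 : ℝ)⁻¹ + n - 1) n = normBinom n := by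
  have h2 := Ring.factorial_nsmul_multichoose_eq_ascPochhammer (2 : ℝ)⁻¹ n
  have h3 : (ascPochhammer ℝ n).eval (2 : ℝ)⁻¹ = n.factorial * normBinom n := by
    induction n with
    | zero => simp [normBinom_zero]
    | succ n ih =>
      rw [ascPochhammer_succ_eval, ih (Ring.factorial_nsmul_multichoose_eq_ascPochhammer _ n),
        Nat.factorial_succ]
      push_cast
      linear_combination (-(n.factorial : ℝ)) * normBinom_succ n
  rw [Polynomial.ascPochhammer_smeval_eq_eval, h3, nsmul_eq_mul] at h2
  rw [← Ring.multichoose_eq]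
  exact mul_left_cancel₀ (by exact_mod_cast n.factorial_ne_zero) h2

/-- The binomial series of `(1 - s)^{-1/2}`. -/
theorem hasSum_normBinom {s : ℝ} (hs : |s| < 1) :
    HasSum (fun n => normBinom n * s ^ n) ((1 - s) ^ (-(2 : ℝ)⁻¹)) := by
  have h := (Real.one_div_one_sub_rpow_hasFPowerSeriesOnBall_zero (2 : ℝ)⁻¹).hasSum
    (y := s) (by simpa [enorm_eq_nnnorm, ← NNReal.coe_lt_coe] using hs)
  simp only [FormalMultilinearSeries.ofScalars_apply_eq, ringChoose_half, zero_add,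
    smul_eq_mul] at h
  rw [Real.rpow_neg (by linarith [(abs_lt.mp hs).2]), ← one_div]
  exact h

/-- The arcsine weight `t^{-1/2} (1-t)^{-1/2}`. -/
theorem integrableOn_arcsine :
    IntegrableOn (fun t : ℝ => invSqrtAbs t * invSqrtAbs (1 - t)) (Set.Ioo 0 1) := by
  have h := Complex.betaIntegral_convergent (u := (2:ℂ)⁻¹) (v := (2:ℂ)⁻¹)
    (by norm_num) (by norm_num)
  rw [intervalIntegrable_iff_integrableOn_Ioo_of_le zero_le_one] at h
  refine IntegrableOn.congr_fun h.norm (fun t ht => ?_) measurableSet_Ioo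
  have h1 : ((1 : ℂ) - t) = ((1 - t : ℝ) : ℂ) := by push_cast; ring
  simp only [norm_mul]
  rw [h1, Complex.norm_cpow_eq_rpow_re_of_pos ht.1,
    Complex.norm_cpow_eq_rpow_re_of_pos (by linarith [ht.2]), invSqrtAbs_of_pos ht.1,
    invSqrtAbs_of_pos (by linarith [ht.2])]
  norm_num

theorem Gamma_nat_add_half_eq_normBinom (n : ℕ) :
    Real.Gamma (n + 2⁻¹) = n.factorial * normBinom n * √Real.pi := by
  induction n with
  | zero => simp [normBinom_zero, ← one_div, Real.Gamma_one_half_eq]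
  | succ n ih =>
    have := Real.Gamma_add_one (s := (n : ℝ) + 2⁻¹) (by positivity)
    rw [show ((n + 1 : ℕ) : ℝ) + 2⁻¹ = n + 2⁻¹ + 1 by push_cast; ring, this, ih,
      Nat.factorial_succ]
    push_cast
    linear_combination (-(n.factorial : ℝ) * √Real.pi) * normBinom_succ n

theorem integral_pow_mul_arcsine (n : ℕ) :
    ∫ t in Set.Ioo (0 : ℝ) 1, t ^ n * (invSqrtAbs t * invSqrtAbs (1 - t))
      = Real.pi * normBinom n := by
  have h := Complex.betaIntegral_eq_Gamma_mul_div ((n + 2⁻¹ : ℝ) : ℂ) ((2⁻¹ : ℝ) : ℂ)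
    (by simp; positivity) (by simp)
  have h1 : Complex.betaIntegral ((n + 2⁻¹ : ℝ) : ℂ) ((2⁻¹ : ℝ) : ℂ) =
     ((∫ t in Set.Ioo (0 : ℝ) 1, t ^ n * (invSqrtAbs t * invSqrtAbs (1 - t)) : ℝ) : ℂ) := by
    rw [Complex.betaIntegral, intervalIntegral.integral_of_le zero_le_one,
      integral_Ioc_eq_integral_Ioo, ← integral_complex_ofReal]
    refine setIntegral_congr_fun measurableSet_Ioo (fun t ht => ?_)
    have h1 : ((1 : ℂ) - t) = ((1 - t : ℝ) : ℂ) := by push_cast; ring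
    have h0 : 0 < 1 - t := by linarith [ht.2]
    rw [h1, invSqrtAbs_of_pos ht.1, invSqrtAbs_of_pos h0, ← Complex.ofReal_one, ← Complex.ofReal_sub,
      ← Complex.ofReal_sub, ← Complex.ofReal_cpow ht.1.le, ← Complex.ofReal_cpow h0.le,
      ← Complex.ofReal_mul, ← mul_assoc, ← Real.rpow_natCast, ← Real.rpow_add ht.1]
    rw [show (n : ℝ) + 2⁻¹ - 1 = n + -2⁻¹ by ring, show (2 : ℝ)⁻¹ - 1 = -2⁻¹ by norm_num]
  rw [h1, ← Complex.ofReal_add, Complex.Gamma_ofReal, Complex.Gamma_ofReal, Complex.Gamma_ofReal] at h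
  have h' := Complex.ofReal_injective (by push_cast; exact h : _ =
    ((Real.Gamma (n + 2⁻¹) * Real.Gamma 2⁻¹ / Real.Gamma (n + 2⁻¹ + 2⁻¹) : ℝ) : ℂ))
  have hg : Real.Gamma 2⁻¹ = √Real.pi := by rw [← one_div]; exact Real.Gamma_one_half_eq
  rw [h', show (n : ℝ) + 2⁻¹ + 2⁻¹ = n + 1 by ring, Real.Gamma_nat_eq_factorial,
    Gamma_nat_add_half_eq_normBinom, hg]
  have := n.factorial_ne_zero
  field_simp
  rw [Real.sq_sqrt Real.pi_pos.le]

theorem integrableOn_mul_arcsine {f : ℝ → ℝ} {C : ℝ} (hf : Measurable f)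
    (hC : ∀ t ∈ Set.Ioo (0 : ℝ) 1, |f t| ≤ C) :
    IntegrableOn (fun t : ℝ => f t * (invSqrtAbs t * invSqrtAbs (1 - t)))
      (Set.Ioo 0 1) :=
  Integrable.bdd_mul integrableOn_arcsine hf.aestronglyMeasurable
    ((ae_restrict_iff' measurableSet_Ioo).2 (.of_forall hC))

/-- Euler's integral for `₂F₁(1/2, 1/2; 1; w)`. -/
theorem integral_euler {w : ℝ} (hw0 : 0 ≤ w) (hw1 : w < 1) :
    ∫ t in Set.Ioo (0 : ℝ) 1,
      invSqrtAbs (1 - w * t) * (invSqrtAbs t * invSqrtAbs (1 - t))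
      = Real.pi * ∑' n : ℕ, normBinom n ^ 2 * w ^ n := by
  have hint : ∀ n : ℕ, IntegrableOn (fun t : ℝ => (normBinom n * w ^ n * t ^ n) *
      (invSqrtAbs t * invSqrtAbs (1 - t))) (Set.Ioo 0 1) := fun n =>
    integrableOn_mul_arcsine (C := normBinom n * w ^ n) (by fun_prop) fun t ht => by
      have := normBinom_nonneg n
      have ht0 := ht.1.le
      rw [abs_of_nonneg (by positivity)]
      exact mul_le_of_le_one_right (by positivity) (pow_le_one₀ ht0 ht.2.le)
  have hval : ∀ n : ℕ, ∫ t in Set.Ioo (0 : ℝ) 1, (normBinom n * w ^ n * t ^ n) *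
      (invSqrtAbs t * invSqrtAbs (1 - t)) = Real.pi * (normBinom n ^ 2 * w ^ n) := by
    intro n
    simp_rw [mul_assoc (normBinom n * w ^ n)]
    rw [integral_const_mul, integral_pow_mul_arcsine]
    ring
  have hsum : Summable fun n : ℕ => Real.pi * (normBinom n ^ 2 * w ^ n) := by
    refine Summable.mul_left _ (Summable.of_nonneg_of_le (fun n => by positivity) (fun n => ?_)
      (summable_geometric_of_lt_one hw0 hw1))
    exact mul_le_of_le_one_left (by positivity)
      (pow_le_one₀ (normBinom_nonneg n) (normBinom_le_one n))
  have h := hasSum_integral_of_summable_integral_norm hint (by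
    refine hsum.congr fun n => ?_
    rw [← hval n]
    refine setIntegral_congr_fun measurableSet_Ioo fun t ht => ?_
    have := normBinom_nonneg n
    have ht0 := ht.1.le
    exact (Real.norm_of_nonneg (mul_nonneg (by positivity)
      (mul_nonneg (invSqrtAbs_nonneg _) (invSqrtAbs_nonneg _)))).symm)
  simp_rw [hval] at h
  rw [← tsum_mul_left, h.tsum_eq]
  refine setIntegral_congr_fun measurableSet_Ioo fun t ht => ?_
  have h1 : |w * t| < 1 := by
    rw [abs_of_nonneg (mul_nonneg hw0 ht.1.le)]
    nlinarith [ht.1, ht.2]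
  have h2 := (hasSum_normBinom h1).mul_right (invSqrtAbs t * invSqrtAbs (1 - t))
  rw [invSqrtAbs_of_pos (by linarith [(abs_lt.mp h1).2] : 0 < 1 - w * t), ← h2.tsum_eq]
  simp_rw [mul_pow, ← mul_assoc]

theorem mobius_denom_ne_zero {a b d t : ℝ} (hab : a < b) (hd : d < a ∨ b < d)
    (ht : t ∈ Set.Ioo (0 : ℝ) 1) : (d - b) + t * (b - a) ≠ 0 := by
  rcases hd with hd | hd
  · nlinarith [ht.1, ht.2]
  · nlinarith [ht.1, ht.2]

/-- The Möbius map sending `0, 1, ∞` to `a, b, d` maps `(0,1)` onto `(a,b)`. -/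
theorem mobius_image {a b d : ℝ} (hab : a < b) (hd : d < a ∨ b < d) :
    (fun t => ((d - b) * a + t * (b - a) * d) / ((d - b) + t * (b - a))) '' Set.Ioo 0 1
      = Set.Ioo a b := by
  have hba : 0 < b - a := sub_pos.2 hab
  ext y
  constructor
  · rintro ⟨t, ht, rfl⟩
    have hne := mobius_denom_ne_zero hab hd ht
    obtain ⟨h0, h1⟩ := ht
    have h2 : ((d - b) * a + t * (b - a) * d) / ((d - b) + t * (b - a)) - a
      = t * (b - a) * ((d - a) / ((d - b) + t * (b - a))) := by field_simp; ring
    have h3 : b - ((d - b) * a + t * (b - a) * d) / ((d - b) + t * (b - a))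
      = (1 - t) * (b - a) * ((d - b) / ((d - b) + t * (b - a))) := by field_simp; ring
    have h1' : 0 < 1 - t := by linarith
    constructor
    · rw [← sub_pos, h2]
      refine mul_pos (by positivity) ?_
      rcases hd with hd | hd
      · exact div_pos_of_neg_of_neg (by linarith) (by nlinarith)
      · exact div_pos (by linarith) (by nlinarith)
    · rw [← sub_pos, h3]
      refine mul_pos (by positivity) ?_
      rcases hd with hd | hd
      · exact div_pos_of_neg_of_neg (by linarith) (by nlinarith)
      · exact div_pos (by linarith) (by nlinarith)
  · rintro ⟨hay, hyb⟩
    have hdy : d - y ≠ 0 := by rcases hd with hd | hd <;> intro h <;> linarith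
    refine ⟨((y - a) * (d - b)) / ((d - y) * (b - a)), ⟨?_, ?_⟩, ?_⟩
    · rcases hd with hd | hd
      · exact div_pos_of_neg_of_neg (by nlinarith) (by nlinarith)
      · exact div_pos (mul_pos (by linarith) (by linarith)) (mul_pos (by linarith) hba)
    · have : 1 - ((y - a) * (d - b)) / ((d - y) * (b - a))
          = ((b - y) * (d - a)) / ((d - y) * (b - a)) := by field_simp; ring
      rw [← sub_pos, this]
      rcases hd with hd | hd
      · exact div_pos_of_neg_of_neg (by nlinarith) (by nlinarith)
      · exact div_pos (mul_pos (by linarith) (by linarith)) (mul_pos (by linarith) hba)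
    · have hda : d - a ≠ 0 := by rcases hd with hd | hd <;> intro h <;> linarith
      have hdb : d - b ≠ 0 := by rcases hd with hd | hd <;> intro h <;> linarith
      have h4 : (d - b) + ((y - a) * (d - b)) / ((d - y) * (b - a)) * (b - a)
        = (d - b) * (d - a) / (d - y) := by field_simp; ring
      simp only [h4]
      field_simp
      ring

theorem mobius_injOn {a b d : ℝ} (hab : a < b) (hd : d < a ∨ b < d) :
    Set.InjOn (fun t => ((d - b) * a + t * (b - a) * d) / ((d - b) + t * (b - a)))
      (Set.Ioo 0 1) := by
  intro s hs t ht h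
  have h1 := mobius_denom_ne_zero hab hd hs
  have h2 := mobius_denom_ne_zero hab hd ht
  simp only at h
  rw [div_eq_div_iff h1 h2] at h
  have h3 : (d - b) * (b - a) * (d - a) * (s - t) = 0 := by linear_combination h
  have h4 : (d - b) * (b - a) * (d - a) ≠ 0 := by
    refine mul_ne_zero (mul_ne_zero ?_ ?_) ?_
    all_goals rcases hd with hd | hd <;> intro h <;> linarith
  have := (mul_eq_zero.1 h3).resolve_left h4
  linarith

theorem mobius_hasDerivAt {a b d t : ℝ} (h : (d - b) + t * (b - a) ≠ 0) :
    HasDerivAt (fun t => ((d - b) * a + t * (b - a) * d) / ((d - b) + t * (b - a)))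
      ((d - b) * (b - a) * (d - a) / ((d - b) + t * (b - a)) ^ 2) t := by
  have h1 : HasDerivAt (fun t : ℝ => (d - b) * a + t * (b - a) * d) ((b - a) * d) t := by
    simpa using (((hasDerivAt_id t).mul_const (b - a)).mul_const d).const_add ((d - b) * a)
  have h2 : HasDerivAt (fun t : ℝ => (d - b) + t * (b - a)) (b - a) t := by
    simpa using ((hasDerivAt_id t).mul_const (b - a)).const_add (d - b)
  convert! h1.div h2 h using 1
  congr 1
  ring

/-- Pullback of the elliptic integrand under the Möbius map. -/
theorem mobius_pullback {a b c d t : ℝ} (hab : a < b) (hd : d < a ∨ b < d) (hc : c ≠ a)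
    (ht : t ∈ Set.Ioo (0 : ℝ) 1) :
    |(d - b) * (b - a) * (d - a) / ((d - b) + t * (b - a)) ^ 2| •
      (fun y => invSqrtAbs (y - a) * invSqrtAbs (y - b) * invSqrtAbs (y - c) * invSqrtAbs (y - d))
        (((d - b) * a + t * (b - a) * d) / ((d - b) + t * (b - a)))
    = invSqrtAbs ((c - a) * (d - b)) *
      (invSqrtAbs (1 - (b - a) * (d - c) / ((c - a) * (d - b)) * t) *
        (invSqrtAbs t * invSqrtAbs (1 - t))) := by
  have hD := mobius_denom_ne_zero hab hd ht
  have hda : d - a ≠ 0 := by rcases hd with hd | hd <;> intro h <;> linarith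
  have hdb : d - b ≠ 0 := by rcases hd with hd | hd <;> intro h <;> linarith
  have hba : b - a ≠ 0 := (sub_pos.2 hab).ne'
  have hca : c - a ≠ 0 := sub_ne_zero.2 hc
  set D := (d - b) + t * (b - a) with hDdef
  set y := ((d - b) * a + t * (b - a) * d) / D with hy
  have e1 : y - a = t * (b - a) * (d - a) / D := by rw [hy]; field_simp; rw [hDdef]; ring
  have e2 : b - y = (d - b) * (b - a) * (1 - t) / D := by rw [hy]; field_simp; rw [hDdef]; ring
  have e4 : d - y = (d - b) * (d - a) / D := by rw [hy]; field_simp; rw [hDdef]; ring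
  have e3 : c - y = (d - b) * (c - a) * (1 - (b - a) * (d - c) / ((c - a) * (d - b)) * t) / D := by
    rw [hy]; field_simp; rw [hDdef]; ring
  have hP : |(d - b) * (b - a) * (d - a) / D ^ 2| = (invSqrtAbs D) ^ 4 /
      ((invSqrtAbs (d - b)) ^ 2 * (invSqrtAbs (b - a)) ^ 2 * (invSqrtAbs (d - a)) ^ 2) := by
    have g : ∀ {v : ℝ}, v ≠ 0 → (invSqrtAbs v) ^ 2 = |v|⁻¹ := fun hv => by
      rw [sq, invSqrtAbs_mul_self hv]
    rw [show (4 : ℕ) = 2 * 2 from rfl, pow_mul, g hD, g hdb, g hba, g hda, abs_div, abs_mul,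
      abs_mul, abs_pow]
    field_simp
  simp only [smul_eq_mul]
  rw [hP, invSqrtAbs_sub_comm y b, invSqrtAbs_sub_comm y c, invSqrtAbs_sub_comm y d, e1, e2, e3, e4]
  simp only [invSqrtAbs_mul, invSqrtAbs_div]
  have p1 := (invSqrtAbs_pos hD).ne'
  have p2 := (invSqrtAbs_pos hda).ne'
  have p3 := (invSqrtAbs_pos hdb).ne'
  have p4 := (invSqrtAbs_pos hba).ne'
  have p5 := (invSqrtAbs_pos hca).ne'
  field_simp

theorem integral_mobius {a b c d : ℝ} (hab : a < b) (hd : d < a ∨ b < d) (hc : c ≠ a) :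
    ∫ y in Set.Ioo a b,
      invSqrtAbs (y - a) * invSqrtAbs (y - b) * invSqrtAbs (y - c) * invSqrtAbs (y - d)
    = invSqrtAbs ((c - a) * (d - b)) * ∫ t in Set.Ioo (0 : ℝ) 1,
      (invSqrtAbs (1 - (b - a) * (d - c) / ((c - a) * (d - b)) * t) *
        (invSqrtAbs t * invSqrtAbs (1 - t))) := by
  rw [← mobius_image hab hd, integral_image_eq_integral_abs_deriv_smul measurableSet_Ioo
    (fun t ht => (mobius_hasDerivAt (mobius_denom_ne_zero hab hd ht)).hasDerivWithinAt)
    (mobius_injOn hab hd), ← integral_const_mul]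
  exact setIntegral_congr_fun measurableSet_Ioo fun t ht => mobius_pullback hab hd hc ht

/-- The elliptic integral as a hypergeometric function. -/
theorem integral_elliptic {a b c d w : ℝ} (hab : a < b) (hd : d < a ∨ b < d) (hc : c ≠ a)
    (hw : w = (b - a) * (d - c) / ((c - a) * (d - b))) (hw0 : 0 ≤ w) (hw1 : w < 1) :
    ∫ y in Set.Ioo a b,
      invSqrtAbs (y - a) * invSqrtAbs (y - b) * invSqrtAbs (y - c) * invSqrtAbs (y - d)
    = invSqrtAbs ((c - a) * (d - b)) * (Real.pi * ∑' n : ℕ, normBinom n ^ 2 * w ^ n) := by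
  rw [integral_mobius hab hd hc, ← hw, integral_euler hw0 hw1]

theorem integral_arcsine : ∫ t in Set.Ioo (0 : ℝ) 1, invSqrtAbs t * invSqrtAbs (1 - t) = Real.pi := by
  simpa [normBinom_zero] using integral_pow_mul_arcsine 0

/-- The Cauchy transform of the arcsine weight. -/
theorem integral_arcsine_cauchy {a b c : ℝ} (hab : a < b) (hc : c < a ∨ b < c) :
    ∫ y in Set.Ioo a b, invSqrtAbs (y - a) * invSqrtAbs (y - b) * |y - c|⁻¹
    = Real.pi * (invSqrtAbs (c - a) * invSqrtAbs (c - b)) := by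
  have hca : c ≠ a := by rcases hc with h | h <;> intro h' <;> linarith
  have h := integral_mobius hab hc hca
  simp only [sub_self, mul_zero, zero_div, zero_mul, sub_zero] at h
  rw [show invSqrtAbs 1 = 1 by simp [invSqrtAbs]] at h
  simp only [one_mul] at h
  rw [integral_arcsine, invSqrtAbs_mul, mul_comm] at h
  rw [← h]
  refine setIntegral_congr_fun measurableSet_Ioo fun y hy => ?_
  have hyc : y - c ≠ 0 := by
    rcases hc with h | h <;> intro h' <;> linarith [hy.1, hy.2]
  rw [mul_assoc _ (invSqrtAbs (y - c)), invSqrtAbs_mul_self hyc]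

theorem integral_affine {a b : ℝ} (hab : a < b) :
    IntegrableOn (fun y => invSqrtAbs (y - a) * invSqrtAbs (y - b)) (Set.Ioo a b) ∧
    ∫ y in Set.Ioo a b, invSqrtAbs (y - a) * invSqrtAbs (y - b) = Real.pi := by
  have hba : 0 < b - a := sub_pos.2 hab
  have himg : (fun t : ℝ => (b - a) * t + a) '' Set.Ioo 0 1 = Set.Ioo a b := by
    rw [Set.image_affine_Ioo hba]; simp
  have hder : ∀ t ∈ Set.Ioo (0 : ℝ) 1,
      HasDerivWithinAt (fun t : ℝ => (b - a) * t + a) (b - a) (Set.Ioo 0 1) t := fun t _ => by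
    simpa using (((hasDerivAt_id t).const_mul (b - a)).add_const a).hasDerivWithinAt
  have hinj : Set.InjOn (fun t : ℝ => (b - a) * t + a) (Set.Ioo 0 1) := fun s _ t _ h => by
    simpa [hba.ne'] using h
  have hpull : ∀ t : ℝ, |b - a| • (fun y => invSqrtAbs (y - a) * invSqrtAbs (y - b))
      ((b - a) * t + a) = invSqrtAbs t * invSqrtAbs (1 - t) := fun t => by
    have h1 := invSqrtAbs_mul_self hba.ne'
    simp only [smul_eq_mul]
    rw [invSqrtAbs_sub_comm _ b, show b - ((b - a) * t + a) = (b - a) * (1 - t) by ring,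
      add_sub_cancel_right, invSqrtAbs_mul, invSqrtAbs_mul]
    have h2 : |b - a| ≠ 0 := (abs_pos.2 hba.ne').ne'
    have h3 : |b - a| * (invSqrtAbs (b - a) * invSqrtAbs (b - a)) = 1 := by
      rw [h1, mul_inv_cancel₀ h2]
    linear_combination (invSqrtAbs t * invSqrtAbs (1 - t)) * h3
  constructor
  · rw [← himg, integrableOn_image_iff_integrableOn_abs_deriv_smul measurableSet_Ioo hder hinj]
    simp_rw [hpull]
    exact integrableOn_arcsine
  · rw [← himg, integral_image_eq_integral_abs_deriv_smul measurableSet_Ioo hder hinj]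
    simp_rw [hpull]
    exact integral_arcsine

theorem invSqrtAbs_sub_bounded {a b c : ℝ} (hc : c < a ∨ b < c) :
    ∃ C, ∀ y ∈ Set.Ioo a b, |invSqrtAbs (y - c)| ≤ C := by
  rcases hc with hc | hc
  · refine ⟨(a - c) ^ (-(2 : ℝ)⁻¹), fun y hy => ?_⟩
    rw [abs_of_nonneg (invSqrtAbs_nonneg _), invSqrtAbs_of_pos (by linarith [hy.1])]
    exact Real.rpow_le_rpow_of_nonpos (by linarith) (by linarith [hy.1]) (by norm_num)
  · refine ⟨(c - b) ^ (-(2 : ℝ)⁻¹), fun y hy => ?_⟩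
    rw [abs_of_nonneg (invSqrtAbs_nonneg _), invSqrtAbs_sub_comm,
      invSqrtAbs_of_pos (by linarith [hy.2])]
    exact Real.rpow_le_rpow_of_nonpos (by linarith) (by linarith [hy.2]) (by norm_num)

theorem integrableOn_elliptic {a b c d : ℝ} (hab : a < b) (hc : c < a ∨ b < c)
    (hd : d < a ∨ b < d) :
    IntegrableOn (fun y => invSqrtAbs (y - a) * invSqrtAbs (y - b) * invSqrtAbs (y - c) *
      invSqrtAbs (y - d)) (Set.Ioo a b) := by
  obtain ⟨C, hC⟩ := invSqrtAbs_sub_bounded (b := b) hc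
  obtain ⟨D, hD⟩ := invSqrtAbs_sub_bounded (b := b) hd
  refine Integrable.mul_bdd (c := D) (Integrable.mul_bdd (c := C) (integral_affine hab).1 ?_ ?_) ?_ ?_
  · exact Measurable.aestronglyMeasurable (by fun_prop)
  · exact (ae_restrict_iff' measurableSet_Ioo).2 (.of_forall hC)
  · exact Measurable.aestronglyMeasurable (by fun_prop)
  · exact (ae_restrict_iff' measurableSet_Ioo).2 (.of_forall hD)

theorem integrableOn_id_mul {a b : ℝ} {f : ℝ → ℝ} (hf : IntegrableOn f (Set.Ioo a b)) :
    IntegrableOn (fun y => y * f y) (Set.Ioo a b) :=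
  Integrable.bdd_mul (c := max |a| |b|) hf (Measurable.aestronglyMeasurable (by fun_prop))
    ((ae_restrict_iff' measurableSet_Ioo).2 (.of_forall fun _ hy =>
      abs_le_max_abs_abs hy.1.le hy.2.le))

/-- The product of two arcsine weights on separated intervals stays integrable against a
bounded multiple of the Cauchy kernel. -/
theorem integrable_arcsine_prod {a b c d C : ℝ} (hab : a < b) (hbc : b < c) (hcd : c < d)
    {h : ℝ × ℝ → ℝ} (hm : Measurable h)
    (hC : ∀ p ∈ Set.Ioo a b ×ˢ Set.Ioo c d, |h p| ≤ C) :
    Integrable (fun p : ℝ × ℝ => h p * |p.1 - p.2|⁻¹ *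
      ((invSqrtAbs (p.1 - a) * invSqrtAbs (p.1 - b)) *
        (invSqrtAbs (p.2 - c) * invSqrtAbs (p.2 - d))))
      ((volume.restrict (Set.Ioo a b)).prod (volume.restrict (Set.Ioo c d))) := by
  refine Integrable.bdd_mul (c := C * (c - b)⁻¹)
    ((integral_affine hab).1.mul_prod (integral_affine hcd).1)
    (Measurable.aestronglyMeasurable (by fun_prop)) ?_
  rw [Measure.prod_restrict]
  refine (ae_restrict_iff' (measurableSet_Ioo.prod measurableSet_Ioo)).2 (.of_forall fun p hp => ?_)
  rw [Real.norm_eq_abs, abs_mul]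
  have hcb : 0 < c - b := sub_pos.2 hbc
  refine mul_le_mul (hC p hp) ?_ (abs_nonneg _) ((abs_nonneg _).trans (hC p hp))
  rw [abs_inv, abs_abs, abs_sub_comm]
  refine inv_anti₀ hcb ((le_abs_self _).trans' ?_)
  linarith [hp.1.2, hp.2.1]

/-- The period relation coming from the residue of `u du / √∏(u - xᵢ)` at infinity. -/
theorem moment_sub_moment {a b c d : ℝ} (hab : a < b) (hbc : b < c) (hcd : c < d) :
    (∫ y in Set.Ioo c d, y * (invSqrtAbs (y - a) * invSqrtAbs (y - b) * invSqrtAbs (y - c) *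
      invSqrtAbs (y - d))) -
    (∫ y in Set.Ioo a b, y * (invSqrtAbs (y - a) * invSqrtAbs (y - b) * invSqrtAbs (y - c) *
      invSqrtAbs (y - d))) = Real.pi := by
  set v : ℝ → ℝ := fun y => invSqrtAbs (y - a) * invSqrtAbs (y - b) with hv
  set w : ℝ → ℝ := fun y => invSqrtAbs (y - c) * invSqrtAbs (y - d) with hw
  have h2 := integrable_arcsine_prod hab hbc hcd (h := Prod.snd) (C := max |c| |d|) measurable_snd
    fun p hp => abs_le_max_abs_abs hp.2.1.le hp.2.2.le
  have h1 := integrable_arcsine_prod hab hbc hcd (h := Prod.fst) (C := max |a| |b|) measurable_fst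
    fun p hp => abs_le_max_abs_abs hp.1.1.le hp.1.2.le
  have e0 : ∫ y in Set.Ioo a b, ∫ u in Set.Ioo c d,
      (u * |y - u|⁻¹ * (v y * w u) - y * |y - u|⁻¹ * (v y * w u)) = Real.pi * Real.pi := by
    have : ∀ y ∈ Set.Ioo a b, ∫ u in Set.Ioo c d,
        (u * |y - u|⁻¹ * (v y * w u) - y * |y - u|⁻¹ * (v y * w u)) = v y * Real.pi := by
      intro y hy
      rw [← (integral_affine hcd).2, ← integral_const_mul]
      refine setIntegral_congr_fun measurableSet_Ioo fun u hu => ?_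
      have hyu : 0 < u - y := by linarith [hy.2, hu.1]
      rw [abs_sub_comm, abs_of_pos hyu]
      change _ = v y * w u
      field_simp
    rw [setIntegral_congr_fun measurableSet_Ioo this, integral_mul_const, (integral_affine hab).2]
  have e2 : ∫ y in Set.Ioo a b, ∫ u in Set.Ioo c d, u * |y - u|⁻¹ * (v y * w u)
      = Real.pi * ∫ u in Set.Ioo c d, u * (invSqrtAbs (u - a) * invSqrtAbs (u - b) *
        invSqrtAbs (u - c) * invSqrtAbs (u - d)) := by
    rw [integral_integral_swap h2, ← integral_const_mul]
    refine setIntegral_congr_fun measurableSet_Ioo fun u hu => ?_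
    have := integral_arcsine_cauchy hab (c := u) (Or.inr (by linarith [hu.1]))
    rw [show (fun y => u * |y - u|⁻¹ * (v y * w u)) =
      fun y => u * w u * (invSqrtAbs (y - a) * invSqrtAbs (y - b) * |y - u|⁻¹) from
        funext fun y => by simp only [hv]; ring, integral_const_mul, this]
    simp only [hw]
    ring
  have e1 : ∫ y in Set.Ioo a b, ∫ u in Set.Ioo c d, y * |y - u|⁻¹ * (v y * w u)
      = Real.pi * ∫ u in Set.Ioo a b, u * (invSqrtAbs (u - a) * invSqrtAbs (u - b) *
        invSqrtAbs (u - c) * invSqrtAbs (u - d)) := by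
    rw [← integral_const_mul]
    refine setIntegral_congr_fun measurableSet_Ioo fun y hy => ?_
    have := integral_arcsine_cauchy hcd (c := y) (Or.inl (by linarith [hy.2]))
    rw [show (fun u => y * |y - u|⁻¹ * (v y * w u)) =
      fun u => y * v y * (invSqrtAbs (u - c) * invSqrtAbs (u - d) * |u - y|⁻¹) from
        funext fun u => by simp only [hw]; rw [abs_sub_comm]; ring, integral_const_mul, this]
    simp only [hv]
    ring
  rw [integral_integral_sub h2 h1, e2, e1, ← mul_sub] at e0
  exact mul_left_cancel₀ Real.pi_ne_zero e0

/-- The integrand of the periods attached to the four branch points `x 1, …, x 4`. -/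
noncomputable def periodIntegrand (x : ℕ → ℝ) (y : ℝ) : ℝ :=
  invSqrtAbs (y - x 1) * invSqrtAbs (y - x 2) * invSqrtAbs (y - x 3) * invSqrtAbs (y - x 4)

/-- The prefactor `∏_{i<j} (x_j - x_i)^{1/4}`. -/
theorem rho_two_prefactor (x : ℕ → ℝ) :
    (∏ p ∈ (Finset.Icc 1 (2 * 2) ×ˢ Finset.Icc 1 (2 * 2)).filter fun p => p.1 < p.2,
      (x p.2 - x p.1) ^ ((4 : ℝ)⁻¹)) =
    (x 2 - x 1) ^ ((4 : ℝ)⁻¹) * (x 3 - x 1) ^ ((4 : ℝ)⁻¹) * (x 4 - x 1) ^ ((4 : ℝ)⁻¹) *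
    (x 3 - x 2) ^ ((4 : ℝ)⁻¹) * (x 4 - x 2) ^ ((4 : ℝ)⁻¹) * (x 4 - x 3) ^ ((4 : ℝ)⁻¹) := by
  rw [show ((Finset.Icc 1 (2 * 2) ×ˢ Finset.Icc 1 (2 * 2)).filter fun p : ℕ × ℕ => p.1 < p.2) =
    {(1, 2), (1, 3), (1, 4), (2, 3), (2, 4), (3, 4)} by decide]
  simp [mul_assoc]

theorem rho_two (x : ℕ → ℝ) (k : Fin 2 → ℕ)
    (h0 : IntegrableOn (periodIntegrand x) (Set.Ioo (x (k 0)) (x (k 0 + 1))))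
    (h1 : IntegrableOn (periodIntegrand x) (Set.Ioo (x (k 1)) (x (k 1 + 1)))) :
    rho 2 k x = ((x 2 - x 1) ^ ((4 : ℝ)⁻¹) * (x 3 - x 1) ^ ((4 : ℝ)⁻¹) *
      (x 4 - x 1) ^ ((4 : ℝ)⁻¹) * (x 3 - x 2) ^ ((4 : ℝ)⁻¹) * (x 4 - x 2) ^ ((4 : ℝ)⁻¹) *
      (x 4 - x 3) ^ ((4 : ℝ)⁻¹)) *
      ((∫ y in Set.Ioo (x (k 0)) (x (k 0 + 1)), periodIntegrand x y) *
        (∫ y in Set.Ioo (x (k 1)) (x (k 1 + 1)), y * periodIntegrand x y) -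
      (∫ y in Set.Ioo (x (k 0)) (x (k 0 + 1)), y * periodIntegrand x y) *
        (∫ y in Set.Ioo (x (k 1)) (x (k 1 + 1)), periodIntegrand x y)) := by
  rw [rho, rho_two_prefactor]
  congr 1
  have hset : (Set.univ.pi fun r : Fin 2 => Set.Ioo (x (k r)) (x (k r + 1))) =
      MeasurableEquiv.finTwoArrow ⁻¹'
        (Set.Ioo (x (k 0)) (x (k 0 + 1)) ×ˢ Set.Ioo (x (k 1)) (x (k 1 + 1))) := by
    ext u
    simp [Fin.forall_fin_two]
  have hfun : ∀ u : Fin 2 → ℝ,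
      (∏ p ∈ (Finset.univ ×ˢ Finset.univ : Finset (Fin 2 × Fin 2)).filter fun p => p.1 < p.2,
        (u p.2 - u p.1)) * ∏ r, ∏ i ∈ Finset.Icc 1 (2 * 2), |u r - x i| ^ (-(2 : ℝ)⁻¹) =
      (fun p : ℝ × ℝ => periodIntegrand x p.1 * (p.2 * periodIntegrand x p.2) -
        (p.1 * periodIntegrand x p.1) * periodIntegrand x p.2) (MeasurableEquiv.finTwoArrow u) := by
    intro u
    rw [show ((Finset.univ ×ˢ Finset.univ : Finset (Fin 2 × Fin 2)).filter fun p => p.1 < p.2) =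
      {(0, 1)} by decide, show Finset.Icc 1 (2 * 2) = {1, 2, 3, 4} by decide]
    simp [Fin.prod_univ_two, periodIntegrand, invSqrtAbs, MeasurableEquiv.finTwoArrow]
    ring
  rw [hset]
  have hmp := (volume_preserving_finTwoArrow ℝ).setIntegral_preimage_emb
    (MeasurableEquiv.measurableEmbedding _)
    (fun p : ℝ × ℝ => periodIntegrand x p.1 * (p.2 * periodIntegrand x p.2) -
      (p.1 * periodIntegrand x p.1) * periodIntegrand x p.2)
    (Set.Ioo (x (k 0)) (x (k 0 + 1)) ×ˢ Set.Ioo (x (k 1)) (x (k 1 + 1)))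
  refine (integral_congr_ae (.of_forall hfun)).trans (hmp.trans ?_)
  rw [Measure.volume_eq_prod, ← Measure.prod_restrict,
    integral_sub (h0.mul_prod (integrableOn_id_mul h1)) ((integrableOn_id_mul h0).mul_prod h1)]
  exact congrArg₂ (· - ·) (integral_prod_mul _ fun y => y * periodIntegrand x y)
    (integral_prod_mul (fun y => y * periodIntegrand x y) _)

theorem rho_index_two :
    ((Fintype.piFinset fun _ : Fin 2 => Finset.Icc 1 (2 * 2 - 1)).filter
      fun k => ∀ r s : Fin 2, r < s → k r < k s) = {![1, 2], ![1, 3], ![2, 3]} := by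
  decide

theorem sum_perm_fin_two (f : Equiv.Perm (Fin 2) → ℂ) :
    ∑ σ, f σ = f 1 + f (Equiv.swap 0 1) := by
  rw [show (Finset.univ : Finset (Equiv.Perm (Fin 2))) = {1, Equiv.swap 0 1} by decide,
    Finset.sum_pair (by decide)]

theorem coulomb_two_of_nested (β : LinkPattern 2) (h : β.Linked 1 4 ∧ β.Linked 2 3) (x : ℕ → ℝ) :
    coulomb 2 β x = ((rho 2 ![1, 2] x + rho 2 ![2, 3] x : ℝ) : ℂ) := by
  have hv : β.a 0 = 1 ∧ β.b 0 = 4 ∧ β.a 1 = 2 ∧ β.b 1 = 3 := by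
    have h0 := β.a_lt_b 0
    have h1 := β.a_lt_b 1
    have h2 := β.a_mono (show (0 : Fin 2) < 1 by decide)
    simp only [LinkPattern.Linked, Fin.exists_fin_two] at h
    omega
  obtain ⟨a0, b0, a1, b1⟩ := hv
  rw [coulomb, rho_index_two, Finset.sum_insert (by decide), Finset.sum_insert (by decide),
    Finset.sum_singleton]
  simp [linkCoeff, sum_perm_fin_two, Fin.sum_univ_two, Fin.prod_univ_two, a0, b0, a1, b1]

theorem coulomb_two_of_parallel (β : LinkPattern 2) (h : β.Linked 1 2 ∧ β.Linked 3 4) (x : ℕ → ℝ) :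
    coulomb 2 β x = ((rho 2 ![1, 3] x : ℝ) : ℂ) := by
  have hv : β.a 0 = 1 ∧ β.b 0 = 2 ∧ β.a 1 = 3 ∧ β.b 1 = 4 := by
    have h0 := β.a_lt_b 0
    have h1 := β.a_lt_b 1
    have h2 := β.a_mono (show (0 : Fin 2) < 1 by decide)
    simp only [LinkPattern.Linked, Fin.exists_fin_two] at h
    omega
  obtain ⟨a0, b0, a1, b1⟩ := hv
  rw [coulomb, rho_index_two, Finset.sum_insert (by decide), Finset.sum_insert (by decide),
    Finset.sum_singleton]
  simp [linkCoeff, sum_perm_fin_two, Fin.sum_univ_two, Fin.prod_univ_two, a0, b0, a1, b1]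

theorem coulomb_prefactor {p q r s : ℝ} (hp : 0 < p) (hq : 0 < q) (hr : 0 < r) (hs : 0 < s) :
    p ^ ((4 : ℝ)⁻¹) * q ^ ((4 : ℝ)⁻¹) * r ^ ((4 : ℝ)⁻¹) * s ^ ((4 : ℝ)⁻¹) * invSqrtAbs (r * s) =
      (p * q / (r * s)) ^ ((4 : ℝ)⁻¹) := by
  have h : (invSqrtAbs (r * s)) = (((r * s) ^ ((4 : ℝ)⁻¹)) ^ 2)⁻¹ := by
    rw [invSqrtAbs_of_pos (by positivity), Real.rpow_neg (by positivity), ← Real.rpow_natCast,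
      ← Real.rpow_mul (by positivity)]
    norm_num
  rw [h, Real.div_rpow (by positivity) (by positivity), Real.mul_rpow hp.le hq.le,
    Real.mul_rpow hr.le hs.le]
  have := Real.rpow_pos_of_pos hr (4 : ℝ)⁻¹
  have := Real.rpow_pos_of_pos hs (4 : ℝ)⁻¹
  field_simp

/-- **The case `N = 2`**: explicit hypergeometric formulas for the two Coulomb gas integrals. -/
theorem coulomb_two (β₁ β₂ : LinkPattern 2)
    (hβ₁ : β₁.Linked 1 2 ∧ β₁.Linked 3 4) (hβ₂ : β₂.Linked 1 4 ∧ β₂.Linked 2 3)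
    (x : ℕ → ℝ) (h12 : x 1 < x 2) (h23 : x 2 < x 3) (h34 : x 3 < x 4)
    (z : ℝ) (hz : z = ((x 2 - x 1) * (x 4 - x 3)) / ((x 3 - x 1) * (x 4 - x 2))) :
    0 < z ∧ z < 1 ∧
    coulomb 2 β₁ x =
      ((Real.pi ^ 2 * (x 4 - x 1) ^ ((4 : ℝ)⁻¹) * (x 3 - x 2) ^ ((4 : ℝ)⁻¹) *
          z ^ ((4 : ℝ)⁻¹) * gaussHyp z : ℝ) : ℂ) ∧
    coulomb 2 β₂ x =
      ((Real.pi ^ 2 * (x 2 - x 1) ^ ((4 : ℝ)⁻¹) * (x 4 - x 3) ^ ((4 : ℝ)⁻¹) *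
          (1 - z) ^ ((4 : ℝ)⁻¹) * gaussHyp (1 - z) : ℝ) : ℂ) := by
  have h13 : x 1 < x 3 := h12.trans h23
  have h24 : x 2 < x 4 := h23.trans h34
  have h14 : x 1 < x 4 := h13.trans h34
  have d21 : 0 < x 2 - x 1 := sub_pos.2 h12
  have d31 : 0 < x 3 - x 1 := sub_pos.2 h13
  have d41 : 0 < x 4 - x 1 := sub_pos.2 h14
  have d32 : 0 < x 3 - x 2 := sub_pos.2 h23
  have d42 : 0 < x 4 - x 2 := sub_pos.2 h24
  have d43 : 0 < x 4 - x 3 := sub_pos.2 h34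
  have hz' : 1 - z = ((x 4 - x 1) * (x 3 - x 2)) / ((x 3 - x 1) * (x 4 - x 2)) := by
    rw [hz]; field_simp; ring
  have hz0 : 0 < z := by rw [hz]; positivity
  have hz1 : 0 < 1 - z := by rw [hz']; positivity
  have hG : ∀ w, gaussHyp w = ∑' n : ℕ, normBinom n ^ 2 * w ^ n := fun w => rfl
  have f1 : periodIntegrand x = fun y => invSqrtAbs (y - x 1) * invSqrtAbs (y - x 2) *
    invSqrtAbs (y - x 3) * invSqrtAbs (y - x 4) := rfl
  have f2 : periodIntegrand x = fun y => invSqrtAbs (y - x 2) * invSqrtAbs (y - x 3) *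
    invSqrtAbs (y - x 4) * invSqrtAbs (y - x 1) := by ext y; rw [f1]; ring
  have f3 : periodIntegrand x = fun y => invSqrtAbs (y - x 3) * invSqrtAbs (y - x 4) *
    invSqrtAbs (y - x 1) * invSqrtAbs (y - x 2) := by ext y; rw [f1]; ring
  have i1 : IntegrableOn (periodIntegrand x) (Set.Ioo (x 1) (x 2)) :=
    f1 ▸ integrableOn_elliptic h12 (.inr h23) (.inr h24)
  have i2 : IntegrableOn (periodIntegrand x) (Set.Ioo (x 2) (x 3)) :=
    f2 ▸ integrableOn_elliptic h23 (.inr h34) (.inl h12)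
  have i3 : IntegrableOn (periodIntegrand x) (Set.Ioo (x 3) (x 4)) :=
    f3 ▸ integrableOn_elliptic h34 (.inl h13) (.inl h23)
  have A1 : ∫ y in Set.Ioo (x 1) (x 2), periodIntegrand x y
      = invSqrtAbs ((x 3 - x 1) * (x 4 - x 2)) * (Real.pi * gaussHyp z) := by
    rw [f1, hG]
    exact integral_elliptic h12 (.inr h24) h13.ne' hz hz0.le (by linarith)
  have A2 : ∫ y in Set.Ioo (x 2) (x 3), periodIntegrand x y
      = invSqrtAbs ((x 3 - x 1) * (x 4 - x 2)) * (Real.pi * gaussHyp (1 - z)) := by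
    have hden : (x 4 - x 2) * (x 1 - x 3) = -((x 3 - x 1) * (x 4 - x 2)) := by ring
    rw [f2, hG, integral_elliptic (w := 1 - z) h23 (.inl h12) h24.ne'
      (by rw [hden, hz', div_neg, ← neg_div]; ring) hz1.le (by linarith), hden]
    simp [invSqrtAbs]
  have A3 : ∫ y in Set.Ioo (x 3) (x 4), periodIntegrand x y
      = invSqrtAbs ((x 3 - x 1) * (x 4 - x 2)) * (Real.pi * gaussHyp z) := by
    have hden : (x 1 - x 3) * (x 2 - x 4) = (x 3 - x 1) * (x 4 - x 2) := by ring
    rw [f3, hG, integral_elliptic (w := z) h34 (.inl h23) h13.ne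
      (by rw [hden, hz]; ring) hz0.le (by linarith), hden]
  have B : (∫ y in Set.Ioo (x 3) (x 4), y * periodIntegrand x y) -
      ∫ y in Set.Ioo (x 1) (x 2), y * periodIntegrand x y = Real.pi :=
    moment_sub_moment h12 h23 h34
  have P1 := coulomb_prefactor d21 d43 d31 d42
  have P2 := coulomb_prefactor d41 d32 d31 d42
  rw [← hz] at P1
  rw [← hz'] at P2
  refine ⟨hz0, by linarith, ?_, ?_⟩
  · rw [coulomb_two_of_parallel β₁ hβ₁, rho_two x ![1, 3] i1 i3]
    simp only [Matrix.cons_val_zero, Matrix.cons_val_one, Nat.reduceAdd]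
    rw [← P1, A1, A3]
    congr 1
    linear_combination ((x 2 - x 1) ^ ((4 : ℝ)⁻¹) * (x 3 - x 1) ^ ((4 : ℝ)⁻¹) *
      (x 4 - x 1) ^ ((4 : ℝ)⁻¹) * (x 3 - x 2) ^ ((4 : ℝ)⁻¹) * (x 4 - x 2) ^ ((4 : ℝ)⁻¹) *
      (x 4 - x 3) ^ ((4 : ℝ)⁻¹)) *
      (invSqrtAbs ((x 3 - x 1) * (x 4 - x 2)) * (Real.pi * gaussHyp z)) * B
  · rw [coulomb_two_of_nested β₂ hβ₂, rho_two x ![1, 2] i1 i2, rho_two x ![2, 3] i2 i3]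
    simp only [Matrix.cons_val_zero, Matrix.cons_val_one, Nat.reduceAdd]
    rw [← P2, A1, A2, A3]
    congr 1
    linear_combination ((x 2 - x 1) ^ ((4 : ℝ)⁻¹) * (x 3 - x 1) ^ ((4 : ℝ)⁻¹) *
      (x 4 - x 1) ^ ((4 : ℝ)⁻¹) * (x 3 - x 2) ^ ((4 : ℝ)⁻¹) * (x 4 - x 2) ^ ((4 : ℝ)⁻¹) *
      (x 4 - x 3) ^ ((4 : ℝ)⁻¹)) *
      (invSqrtAbs ((x 3 - x 1) * (x 4 - x 2)) * (Real.pi * gaussHyp (1 - z))) * B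
end

section
/- Let D = {z ∈ ℂ : |z| < 1} be the open unit disc and let g : ℂ → ℂ be holomorphic on D. Let θ_1 < θ_2 < θ_1 + 2π and let A = {e^{iθ} : θ_1 < θ < θ_2} be an open arc of the unit circle. Suppose there exists a continuous function u : D ∪ A → ℝ such that u(z) = Re g(z) for all z ∈ D and u is constant on A. Then g extends continuously to D ∪ A: there exists a continuous function G : D ∪ A → ℂ with G(z) = g(z) for all z ∈ D. -/
open Metric Set Filter Topology

/-- **Maximum principle** for a function that is continuous up to the boundary and agrees inside
with the real part of a holomorphic function. -/
theorem nonpos_of_nonpos_frontier_of_eq_re {U : Set ℂ} (hUo : IsOpen U) (hUc : IsPreconnected U)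
    (hUb : Bornology.IsBounded U) {f : ℂ → ℂ} (hf : DifferentiableOn ℂ f U) {p : ℂ → ℝ}
    (hp : ContinuousOn p (closure U)) (hpf : ∀ z ∈ U, p z = (f z).re)
    (hfr : ∀ z ∈ frontier U, p z ≤ 0) {z : ℂ} (hz : z ∈ U) : p z ≤ 0 := by
  obtain ⟨w, hw, hmax⟩ := hUb.isCompact_closure.exists_isMaxOn ⟨z, subset_closure hz⟩ hp
  refine (hmax (subset_closure hz)).trans ?_
  by_cases hwU : w ∈ U
  · have hexp : IsMaxOn (norm ∘ fun z => Complex.exp (f z)) U w := fun y hy => by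
      have hyw : p y ≤ p w := hmax (subset_closure hy)
      simpa [Complex.norm_exp, ← hpf y hy, ← hpf w hwU] using hyw
    have hconst : EqOn p (fun _ => p w) U := fun y hy => by
      have h := Complex.norm_eqOn_of_isPreconnected_of_isMaxOn hUc hUo hf.cexp hwU hexp hy
      simpa [Complex.norm_exp, ← hpf y hy, ← hpf w hwU] using h
    have hconst' : EqOn p (fun _ => p w) (closure U) :=
      hconst.of_subset_closure hp continuousOn_const subset_closure le_rfl
    obtain ⟨y, hy⟩ : (frontier U).Nonempty := by
      refine nonempty_frontier_iff.2 ⟨⟨z, hz⟩, fun h => ?_⟩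
      exact NormedSpace.unbounded_univ ℝ ℂ (h ▸ hUb)
    exact (hconst' (frontier_subset_closure hy)).symm.trans_le (hfr y hy)
  · exact hfr w ⟨hw, by rwa [hUo.interior_eq]⟩

theorem norm_sub_sq_le_two_mul_re {ζ z : ℂ} (hζ : ‖ζ‖ = 1) (hz : ‖z‖ ≤ 1) :
    ‖z - ζ‖ ^ 2 ≤ 2 * (1 - z * starRingEnd ℂ ζ).re := by
  have h1 : ζ.re ^ 2 + ζ.im ^ 2 = 1 := by
    have := Complex.sq_norm ζ
    rw [hζ, Complex.normSq_apply] at this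
    linarith
  have h2 : z.re ^ 2 + z.im ^ 2 ≤ 1 := by
    have := Complex.sq_norm z
    rw [Complex.normSq_apply] at this
    nlinarith [norm_nonneg z]
  rw [Complex.sq_norm, Complex.normSq_apply]
  simp only [Complex.sub_re, Complex.sub_im, Complex.mul_re, Complex.one_re, Complex.conj_re,
    Complex.conj_im]
  nlinarith

/-- Near a boundary point of the disc, a harmonic function vanishing on the boundary is dominated
by a multiple of the linear barrier `1 - Re (z * conj ζ)`. -/
theorem re_le_linear_barrier {ζ : ℂ} (hζ : ‖ζ‖ = 1) {r M : ℝ} (hr : 0 < r) {f : ℂ → ℂ}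
    (hf : DifferentiableOn ℂ f (ball 0 1)) {p : ℂ → ℝ}
    (hp : ContinuousOn p (closedBall 0 1 ∩ closedBall ζ r))
    (hpf : ∀ z ∈ ball (0 : ℂ) 1, p z = (f z).re)
    (hM : ∀ z ∈ closedBall 0 1 ∩ closedBall ζ r, p z ≤ M) (hM0 : 0 ≤ M)
    (hp0 : ∀ z ∈ sphere 0 1 ∩ closedBall ζ r, p z = 0) {z : ℂ} (hz : z ∈ ball 0 1 ∩ ball ζ r) :
    (f z).re ≤ 2 * M / r ^ 2 * (1 - z * starRingEnd ℂ ζ).re := by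
  set K := 2 * M / r ^ 2 with hK
  have hK0 : 0 ≤ K := by positivity
  have hcl : closure (ball 0 1 ∩ ball ζ r) ⊆ closedBall 0 1 ∩ closedBall ζ r :=
    closure_minimal (inter_subset_inter ball_subset_closedBall ball_subset_closedBall)
      (isClosed_closedBall.inter isClosed_closedBall)
  have key := nonpos_of_nonpos_frontier_of_eq_re (U := ball 0 1 ∩ ball ζ r)
    (f := fun z => f z - K * (1 - z * starRingEnd ℂ ζ))
    (p := fun z => p z - K * (1 - z * starRingEnd ℂ ζ).re) (isOpen_ball.inter isOpen_ball)
    ((convex_ball _ _).inter (convex_ball _ _)).isPreconnected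
    (isBounded_ball.subset inter_subset_left)
    ((hf.mono inter_subset_left).sub (by fun_prop))
    ((hp.mono hcl).sub (by fun_prop))
    (fun y hy => by simp [hpf y hy.1]) ?_ hz
  · rw [← hpf z hz.1]
    linarith
  · intro y hy
    rw [(isOpen_ball.inter isOpen_ball).frontier_eq] at hy
    have hyc := hcl hy.1
    have hy1 : ‖y‖ ≤ 1 := by simpa using hyc.1
    have hbar := norm_sub_sq_le_two_mul_re hζ hy1
    rcases hy1.lt_or_eq with hlt | heq
    · have hyr : r ≤ ‖y - ζ‖ := by
        by_contra! h
        exact hy.2 ⟨by simpa using hlt, by simpa [dist_eq_norm] using h⟩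
      have h1 : r ^ 2 ≤ 2 * (1 - y * starRingEnd ℂ ζ).re :=
        (pow_le_pow_left₀ hr.le hyr 2).trans hbar
      have h2 : M = K * (r ^ 2 / 2) := by rw [hK]; field_simp
      have h3 : K * (r ^ 2 / 2) ≤ K * (1 - y * starRingEnd ℂ ζ).re := by gcongr; linarith
      linarith [hM y hyc]
    · rw [hp0 y ⟨by simpa using heq, hyc.2⟩]
      have : 0 ≤ (1 - y * starRingEnd ℂ ζ).re := by nlinarith [sq_nonneg ‖y - ζ‖]
      have := mul_nonneg hK0 this
      linarith

/-- Gradient estimate: the derivative at the centre of a disc is controlled by a bound on the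
real part. -/
theorem norm_deriv_le_of_abs_re_le {f : ℂ → ℂ} {z : ℂ} {R B : ℝ} (hR : 0 < R) (hB : 0 < B)
    (hf : DifferentiableOn ℂ f (ball z R)) (hre : ∀ w ∈ ball z R, |(f w).re| ≤ B) :
    ‖deriv f z‖ ≤ 2 * Real.exp 1 ^ 2 * B / R := by
  have hfz : DifferentiableAt ℂ f z := hf.differentiableAt (ball_mem_nhds z hR)
  set F : ℂ → ℂ := fun w => Complex.exp (f w / B) with hF
  have hnorm : ∀ w, ‖F w‖ = Real.exp ((f w).re / B) := fun w => by
    rw [hF, Complex.norm_exp, Complex.div_ofReal_re]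
  have hsub : closedBall z (R / 2) ⊆ ball z R := closedBall_subset_ball (by linarith)
  have hFd : DifferentiableOn ℂ F (ball z R) := (hf.div_const _).cexp
  have hcauchy : ‖deriv F z‖ ≤ Real.exp 1 / (R / 2) := by
    refine Complex.norm_deriv_le_of_forall_mem_sphere_norm_le (by positivity)
      (hFd.diffContOnCl_ball hsub) fun w hw => ?_
    rw [hnorm, Real.exp_le_exp, div_le_one hB]
    exact (abs_le.1 (hre w (hsub (sphere_subset_closedBall hw)))).2
  have hder : deriv F z = F z * (deriv f z / B) :=
    (hfz.hasDerivAt.div_const (B : ℂ)).cexp.deriv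
  have hlow : (Real.exp 1)⁻¹ ≤ ‖F z‖ := by
    rw [hnorm, ← Real.exp_neg, Real.exp_le_exp, le_div_iff₀ hB]
    linarith [(abs_le.1 (hre z (mem_ball_self hR))).1]
  rw [hder, norm_mul, norm_div, Complex.norm_real, Real.norm_of_nonneg hB.le] at hcauchy
  have h := (mul_le_mul_of_nonneg_right hlow (by positivity)).trans hcauchy
  have he := Real.exp_pos 1
  rw [le_div_iff₀ hR]
  have h2 : (Real.exp 1)⁻¹ * (‖deriv f z‖ / B) * (Real.exp 1 * B * R)
      ≤ Real.exp 1 / (R / 2) * (Real.exp 1 * B * R) := by gcongr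
  field_simp at h2 ⊢
  linarith

/-- If the real part of a holomorphic function on the disc vanishes continuously on the boundary
near a boundary point `ζ₀`, then the function has a limit at `ζ₀`. -/
theorem exists_tendsto_of_re_eq_zero_on_sphere {f : ℂ → ℂ} (hf : DifferentiableOn ℂ f (ball 0 1))
    {ζ₀ : ℂ} (hζ₀ : ‖ζ₀‖ = 1) {r : ℝ} (hr : 0 < r) (hr1 : r ≤ 1) {p : ℂ → ℝ}
    (hp : ContinuousOn p (closedBall 0 1 ∩ closedBall ζ₀ (2 * r)))
    (hpf : ∀ z ∈ ball (0 : ℂ) 1, p z = (f z).re)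
    (hp0 : ∀ z ∈ sphere 0 1 ∩ closedBall ζ₀ (2 * r), p z = 0) :
    ∃ y, Tendsto f (𝓝[ball 0 1] ζ₀) (𝓝 y) := by
  obtain ⟨M₀, hM₀⟩ := ((isCompact_closedBall (0 : ℂ) 1).inter_right
    (isClosed_closedBall (x := ζ₀) (ε := 2 * r))).exists_bound_of_continuousOn hp
  set M := max M₀ 1 with hMdef
  have hM : ∀ z ∈ closedBall 0 1 ∩ closedBall ζ₀ (2 * r), |p z| ≤ M := fun z hz =>
    (hM₀ z hz).trans (le_max_left _ _)
  have hMpos : 0 < M := lt_max_of_lt_right one_pos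
  set K := 2 * M / r ^ 2 with hK
  have hKpos : 0 < K := by positivity
  have hderiv : ∀ z ∈ ball 0 1 ∩ ball ζ₀ (r / 4), ‖deriv f z‖ ≤ 4 * Real.exp 1 ^ 2 * K := by
    rintro z ⟨hz1, hzr⟩
    rw [mem_ball_zero_iff] at hz1
    rw [mem_ball, dist_eq_norm] at hzr
    have hRr : 1 - ‖z‖ < r / 4 := by
      have := norm_sub_norm_le ζ₀ z
      rw [norm_sub_rev, hζ₀] at this
      linarith
    have hzpos : 0 < ‖z‖ := by linarith
    set R := 1 - ‖z‖ with hR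
    have hRpos : 0 < R := by linarith
    set ζ : ℂ := z / ‖z‖ with hζdef
    have hζ : ‖ζ‖ = 1 := by
      rw [hζdef, norm_div, Complex.norm_real, norm_norm, div_self hzpos.ne']
    have hzζ : dist z ζ = R := by
      have : z - ζ = ((‖z‖ - 1 : ℝ) : ℂ) * ζ := by
        have h0 : (‖z‖ : ℂ) ≠ 0 := by exact_mod_cast hzpos.ne'
        rw [hζdef]; push_cast; field_simp
      rw [dist_eq_norm, this, norm_mul, hζ, Complex.norm_real, Real.norm_eq_abs, abs_sub_comm,
        abs_of_pos hRpos, mul_one]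
    have hsub : closedBall ζ r ⊆ closedBall ζ₀ (2 * r) := by
      refine closedBall_subset_closedBall' ?_
      have := dist_triangle ζ z ζ₀
      rw [dist_comm ζ z, hzζ, dist_eq_norm z ζ₀] at this
      linarith
    have hsub' := inter_subset_inter_right (closedBall (0 : ℂ) 1) hsub
    have hball : ball z R ⊆ ball 0 1 := by
      refine ball_subset_ball' ?_
      rw [dist_zero_right, hR]
      linarith
    have hre : ∀ w ∈ ball z R, |(f w).re| ≤ K * (2 * R) := by
      intro w hw
      have hwζ : dist w ζ < 2 * R := by
        have := dist_triangle w z ζ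
        rw [mem_ball] at hw
        linarith
      have hwU : w ∈ ball 0 1 ∩ ball ζ r := ⟨hball hw, by rw [mem_ball]; linarith⟩
      have hbar : (1 - w * starRingEnd ℂ ζ).re ≤ 2 * R := by
        have h1 : 1 - w * starRingEnd ℂ ζ = (ζ - w) * starRingEnd ℂ ζ := by
          rw [sub_mul, Complex.mul_conj, Complex.normSq_eq_norm_sq, hζ]; simp
        refine (Complex.re_le_norm _).trans ?_
        rw [h1, norm_mul, Complex.norm_conj, hζ, mul_one, ← dist_eq_norm, dist_comm]
        exact hwζ.le
      have hup := re_le_linear_barrier hζ hr hf (hp.mono hsub') hpf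
        (fun y hy => (abs_le.1 (hM y (hsub' hy))).2) hMpos.le
        (fun y hy => hp0 y ⟨hy.1, hsub hy.2⟩) hwU
      have hlow := re_le_linear_barrier (p := fun y => -p y) hζ hr hf.neg (hp.mono hsub').neg
        (fun y hy => by simp [hpf y hy])
        (fun y hy => by linarith [(abs_le.1 (hM y (hsub' hy))).1]) hMpos.le
        (fun y hy => by simp [hp0 y ⟨hy.1, hsub hy.2⟩]) hwU
      rw [Pi.neg_apply, Complex.neg_re] at hlow
      have := mul_le_mul_of_nonneg_left hbar hKpos.le
      exact abs_le.2 ⟨by linarith, by linarith⟩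
    refine (norm_deriv_le_of_abs_re_le hRpos (by positivity) (hf.mono hball) hre).trans_eq ?_
    field_simp
    ring
  have hlip : LipschitzOnWith (4 * Real.exp 1 ^ 2 * K).toNNReal f
      (ball 0 1 ∩ ball ζ₀ (r / 4)) := by
    refine Convex.lipschitzOnWith_of_nnnorm_deriv_le (𝕜 := ℂ)
      (fun z hz => hf.differentiableAt (isOpen_ball.mem_nhds hz.1)) (fun z hz => ?_)
      ((convex_ball _ _).inter (convex_ball _ _))
    exact NNReal.le_toNNReal_of_coe_le (hderiv z hz)
  obtain ⟨F, hF, hFf⟩ := hlip.extend_finite_dimension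
  refine ⟨F ζ₀, (hF.continuous.tendsto ζ₀ |>.mono_left nhdsWithin_le_nhds).congr' ?_⟩
  filter_upwards [self_mem_nhdsWithin,
    mem_nhdsWithin_of_mem_nhds (ball_mem_nhds ζ₀ (by positivity : 0 < r / 4))] with z hz hz'
  exact (hFf ⟨hz, hz'⟩).symm

/-- The image of an open interval under `θ ↦ exp (θ * I)` is relatively open in the circle. -/
theorem exists_sphere_inter_closedBall_subset_arc {θ₁ θ₂ : ℝ} {ζ₀ : ℂ}
    (hζ₀ : ζ₀ ∈ (fun θ : ℝ => Complex.exp (θ * Complex.I)) '' Ioo θ₁ θ₂) :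
    ∃ r, 0 < r ∧ r ≤ 1 ∧ sphere 0 1 ∩ closedBall ζ₀ (2 * r) ⊆
      (fun θ : ℝ => Complex.exp (θ * Complex.I)) '' Ioo θ₁ θ₂ := by
  obtain ⟨θ, hθ, rfl⟩ := hζ₀
  set ζ := Complex.exp (θ * Complex.I) with hζ
  have hζ0 : ζ ≠ 0 := Complex.exp_ne_zero _
  have hcont : ContinuousAt (fun z : ℂ => θ + (z / ζ).arg) ζ := by
    refine continuousAt_const.add (ContinuousAt.comp (g := Complex.arg) ?_ (by fun_prop))
    rw [div_self hζ0]
    exact Complex.continuousAt_arg (by simp)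
  have hev : ∀ᶠ z in 𝓝 ζ, θ + (z / ζ).arg ∈ Ioo θ₁ θ₂ :=
    hcont.eventually_mem (isOpen_Ioo.mem_nhds (by simpa [div_self hζ0] using hθ))
  obtain ⟨ε, hε, hball⟩ := Metric.eventually_nhds_iff_ball.1 hev
  refine ⟨min (ε / 4) 1, by positivity, min_le_right _ _, ?_⟩
  rintro z ⟨hz1, hz⟩
  refine ⟨θ + (z / ζ).arg, hball z ?_, ?_⟩
  · rw [mem_closedBall] at hz
    rw [mem_ball]
    linarith [min_le_left (ε / 4) 1]
  · have hnorm : ‖z / ζ‖ = 1 := by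
      rw [norm_div, hζ, Complex.norm_exp_ofReal_mul_I, div_one]
      simpa using hz1
    have h := Complex.norm_mul_exp_arg_mul_I (z / ζ)
    rw [hnorm, Complex.ofReal_one, one_mul] at h
    simp only [Complex.ofReal_add, add_mul, Complex.exp_add]
    rw [h, ← hζ, mul_div_cancel₀ _ hζ0]

/-- **Schwarz-reflection continuity (Lemma 4.19(1)).** If `g` is holomorphic on the unit disc
`D` and `Re g` extends continuously to an open boundary arc `A`, being constant there, then `g`
itself extends continuously to `D ∪ A`. -/
theorem holomorphic_extends_continuously_to_arc
    (g : ℂ → ℂ) (hg : DifferentiableOn ℂ g (Metric.ball 0 1))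
    (θ₁ θ₂ : ℝ) (h₁₂ : θ₁ < θ₂) (h₂ : θ₂ < θ₁ + 2 * Real.pi)
    (A : Set ℂ) (hA : A = (fun θ : ℝ => Complex.exp (θ * Complex.I)) '' Set.Ioo θ₁ θ₂)
    (u : ℂ → ℝ) (hu : ContinuousOn u (Metric.ball 0 1 ∪ A))
    (huRe : ∀ z ∈ Metric.ball (0 : ℂ) 1, u z = (g z).re)
    (huconst : ∃ c : ℝ, ∀ z ∈ A, u z = c) :
    ∃ G : ℂ → ℂ, ContinuousOn G (Metric.ball 0 1 ∪ A) ∧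
      ∀ z ∈ Metric.ball (0 : ℂ) 1, G z = g z := by
  obtain ⟨c, hc⟩ := huconst
  have hAnorm : ∀ z ∈ A, ‖z‖ = 1 := by
    rw [hA]
    rintro _ ⟨θ, -, rfl⟩
    exact Complex.norm_exp_ofReal_mul_I θ
  refine ⟨extendFrom (ball 0 1) g, continuousOn_extendFrom ?_ ?_,
    extendFrom_extends hg.continuousOn⟩
  · rw [closure_ball _ one_ne_zero]
    exact union_subset ball_subset_closedBall fun z hz => by simp [hAnorm z hz]
  · rintro ζ (hζ | hζ)
    · exact ⟨g ζ, hg.continuousOn ζ hζ⟩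
    · obtain ⟨r, hr, hr1, hsub⟩ := exists_sphere_inter_closedBall_subset_arc (hA ▸ hζ)
      rw [← hA] at hsub
      have hdom : closedBall 0 1 ∩ closedBall ζ (2 * r) ⊆ ball 0 1 ∪ A := by
        rintro z ⟨hz1, hz⟩
        rw [← ball_union_sphere] at hz1
        exact hz1.imp id fun h => hsub ⟨h, hz⟩
      obtain ⟨y, hy⟩ := exists_tendsto_of_re_eq_zero_on_sphere (f := fun z => g z - c)
        (p := fun z => u z - c) (hg.sub_const _) (hAnorm ζ hζ) hr hr1
        ((hu.mono hdom).sub continuousOn_const) (fun z hz => by simp [huRe z hz])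
        (fun z hz => by simp [hc z (hsub hz)])
      exact ⟨y + c, by simpa using hy.add_const (c : ℂ)⟩
end
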